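/- If x and y are coprime positive integers, m ≥ 1 an integer, and p an odd prime such that x² + 3^(2m) = 2·y^p, then (x, y, m, p) is one of (13, 5, 2, 3), (79, 5, 1, 5), (545, 53, 3, 3). -/

import Mathlib

/-- `δ₄ = 1` if `p ≡ 1 (mod 4)` and `δ₄ = -1` if `p ≡ 3 (mod 4)`. -/
def d4 (p : ℕ) : ℤ := if p % 4 = 1 then 1 else -1

/-- `δ₈ = 1` if `p ≡ 1, 3 (mod 8)` and `δ₈ = -1` if `p ≡ 5, 7 (mod 8)`. -/
def d8 (p : ℕ) : ℤ := if p % 8 = 1 ∨ p % 8 = 3 then 1 else -1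

/-- `F_p(u,v) = Re((1+i)(u+iv)^p)`. -/
def Ffun (p : ℕ) (u v : ℤ) : ℤ :=
  ((⟨1, 1⟩ : GaussianInt) * (⟨u, v⟩ : GaussianInt) ^ p).re

/-- `G_p(u,v) = Im((1+i)(u+iv)^p)`. -/
def Gfun (p : ℕ) (u v : ℤ) : ℤ :=
  ((⟨1, 1⟩ : GaussianInt) * (⟨u, v⟩ : GaussianInt) ^ p).im

/-- `H_p(u,v) = G_p(u,v)/(u + δ₄ v)` (exact division whenever `u + δ₄ v ≠ 0`). -/
def Hfun (p : ℕ) (u v : ℤ) : ℤ := Gfun p u v / (u + d4 p * v)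


section
theorem gi_unit_pow_four (u : GaussianIntˣ) : (u : GaussianInt)^4 = 1 := by
  have h : (Zsqrtd.norm (u : GaussianInt)).natAbs = 1 := Zsqrtd.norm_eq_one_iff.2 u.isUnit
  have h0 : 0 ≤ Zsqrtd.norm (u : GaussianInt) := GaussianInt.norm_nonneg _
  have h1 : Zsqrtd.norm (u : GaussianInt) = 1 := by omega
  rcases hu : (u : GaussianInt) with ⟨a, b⟩
  rw [hu, Zsqrtd.norm_def] at h1
  simp only at h1
  have h1' : a^2+b^2=1 := by linarith
  have ha1 : a ≤ 1 := by nlinarith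
  have ha2 : -1 ≤ a := by nlinarith
  have hb1 : b ≤ 1 := by nlinarith
  have hb2 : -1 ≤ b := by nlinarith
  interval_cases a <;> interval_cases b <;> first | (exfalso; revert h1; norm_num; done) | (simp [pow_succ, Zsqrtd.ext_iff])

theorem partA1 (x y m p : ℕ) (hm : 1 ≤ m)
    (hcop : Nat.gcd x y = 1) (hp : Nat.Prime p) (hop : Odd p)
    (heq : x ^ 2 + 3 ^ (2 * m) = 2 * y ^ p) :
    ∃ a b : ℤ, a^2+b^2 = 2*y ∧ Odd a ∧ Odd b ∧ IsCoprime a b ∧ Odd y ∧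
      (⟨a,b⟩ : GaussianInt)^p = 2^((p-1)/2) * (⟨x, 3^m⟩ : GaussianInt) := by
  have h3x : ¬ 3 ∣ x := by
    intro h
    have h2 : 3 ∣ 2 * y^p := by
      rw [← heq]
      exact dvd_add (dvd_pow h (by norm_num)) (dvd_pow_self 3 (by omega))
    have h3 : 3 ∣ y := by
      rcases (Nat.Prime.dvd_mul Nat.prime_three).1 h2 with h | h
      · omega
      · exact Nat.prime_three.dvd_of_dvd_pow h
    have := Nat.dvd_gcd h h3
    rw [hcop] at this; omega
  have h9 : 3^(2*m) % 8 = 1 := by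
    rw [pow_mul, Nat.pow_mod]; norm_num
  have hxo : x % 2 = 1 := by
    rcases Nat.mod_two_eq_zero_or_one x with h | h
    · exfalso
      have : x^2 % 2 = 0 := by rw [Nat.pow_mod, h]; 
      omega
    · exact h
  have hx8 : x^2 % 8 = 1 := by
    have : x % 8 = 1 ∨ x % 8 = 3 ∨ x % 8 = 5 ∨ x % 8 = 7 := by omega
    rcases this with h | h | h | h <;> rw [Nat.pow_mod, h]
  have hyo : Odd y := by
    by_contra h
    rw [Nat.not_odd_iff_even] at h
    have : 2 ∣ y^p := dvd_pow h.two_dvd hp.ne_zero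
    omega
  have h3o : (3:ℤ)^m % 2 = 1 := by
    rw [← Int.odd_iff]; exact Odd.pow (by decide)
  obtain ⟨c, hc⟩ : ∃ c : ℤ, (x:ℤ) + 3^m = 2*c := by
    refine ⟨((x:ℤ)+3^m)/2, ?_⟩; omega
  obtain ⟨e, he⟩ : ∃ e : ℤ, 3^m - (x:ℤ) = 2*e := by
    refine ⟨(3^m - (x:ℤ))/2, ?_⟩; omega
  have hX : (x:ℤ) = c - e := by linarith
  have hM : (3:ℤ)^m = c + e := by linarith
  have heqZ : (x:ℤ)^2 + (3^m)^2 = 2 * y^p := by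
    have := congrArg (Nat.cast : ℕ → ℤ) heq
    push_cast at this
    rw [← this]; ring
  have hce : c^2+e^2 = (y:ℤ)^p := by
    rw [hX, hM] at heqZ; linarith
  set γ : GaussianInt := ⟨c, e⟩ with hγ
  set γ' : GaussianInt := ⟨c, -e⟩ with hγ'
  have hmul : γ * γ' = (y : GaussianInt)^p := by
    have h1 : ((y:GaussianInt))^p = (((y:ℤ)^p : ℤ) : GaussianInt) := by push_cast; rfl
    rw [h1, ← hce]
    have h2 : ∀ n : ℤ, ((n:ℤ):GaussianInt) = ⟨n, 0⟩ := fun n => rfl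
    rw [h2, hγ, hγ', Zsqrtd.ext_iff]
    constructor <;> simp <;> ring
  have hcopγ : IsCoprime γ γ' := by
    have hxm : IsCoprime (x:ℤ) (3^m) := by
      apply IsCoprime.pow_right
      rw [Int.isCoprime_iff_gcd_eq_one]
      have : Nat.Coprime 3 x := (Nat.Prime.coprime_iff_not_dvd Nat.prime_three).2 h3x
      exact this.symm
    obtain ⟨r, s, hrs⟩ := hxm
    obtain ⟨k, hk⟩ : ∃ k : ℤ, (y:ℤ)^p = 2*k+1 := by
      have : Odd ((y:ℤ)^p) := Odd.pow (by exact_mod_cast hyo)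
      exact this
    have h2 : (2:GaussianInt) = ((r+s : ℤ):GaussianInt) * (γ + γ') + ((s-r : ℤ):GaussianInt) * (⟨0,-1⟩ * (γ - γ')) := by
      have h : (2:ℤ) = (r+s) * (c+c) + (s-r)*(e+e) := by
        rw [hX, hM] at hrs; linarith
      have h' : (2:GaussianInt) = ((2:ℤ):GaussianInt) := rfl
      rw [h', h]
      simp [hγ, hγ', Zsqrtd.ext_iff]
    have h1 : (1:GaussianInt) = γ*γ' - 2 * (k : GaussianInt) := by
      rw [hmul]
      have h1 : ((y:GaussianInt))^p = (((y:ℤ)^p : ℤ) : GaussianInt) := by push_cast; rfl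
      rw [h1, hk]; push_cast; ring
    refine ⟨γ' - (k:GaussianInt) * (((r+s : ℤ):GaussianInt) + ((s-r : ℤ):GaussianInt) * ⟨0,-1⟩), - (k:GaussianInt) * (((r+s : ℤ):GaussianInt) - ((s-r : ℤ):GaussianInt) * ⟨0,-1⟩), ?_⟩
    rw [h1]
    conv_rhs => rw [h2]
    ring
  obtain ⟨δ, hδ⟩ := exists_associated_pow_of_mul_eq_pow' hcopγ hmul
  obtain ⟨u, hu⟩ := hδ
  have hu4 := gi_unit_pow_four u
  obtain ⟨d, hd⟩ := hop
  have hd2 : (p-1)/2 = d := by omega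
  set I : GaussianInt := ⟨0,1⟩ with hI
  have hI2 : I^2 = -1 := by simp [hI, pow_two, Zsqrtd.ext_iff]
  set ω : GaussianInt := ⟨1,1⟩ with hω
  have hω2 : ω^2 = 2*I := by
    have h' : (2:GaussianInt) = ((2:ℤ):GaussianInt) := rfl
    rw [h']
    simp [hω, hI, pow_two, Zsqrtd.ext_iff]
  have hup : ((u:GaussianInt)^p)^p = u := by
    rw [← pow_mul]
    have : p * p = 4*(d*d+d)+1 := by rw [hd]; ring
    rw [this, pow_add, pow_mul, hu4]; simp
  have hmain : (I^d * ω * (δ * (u:GaussianInt)^p))^p = 2^d * (⟨x, 3^m⟩ : GaussianInt) := by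
    have hωp : ω^p = ω * (2*I)^d := by rw [hd, pow_succ, pow_mul, hω2]; ring
    rw [mul_pow, mul_pow, mul_pow δ, hup, hu, hωp, mul_pow]
    have hi : (I^d)^p * I^d = 1 := by
      rw [← pow_mul, ← pow_add]
      have : d * p + d = 2*(d*(d+1)) := by rw [hd]; ring
      rw [this, pow_mul, hI2]
      exact (Nat.even_mul_succ_self d).neg_one_pow
    have h2 : ω * γ = (⟨x, 3^m⟩ : GaussianInt) := by
      simp [hω, hγ, Zsqrtd.ext_iff]; constructor <;> linarith
    rw [← h2]
    linear_combination (2^d * ω * γ) * hi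
  rcases hg : I^d * ω * (δ * (u:GaussianInt)^p) with ⟨a, b⟩
  rw [hg] at hmain
  -- norms
  have hnorm : (a^2+b^2)^p = (2*(y:ℤ))^p := by
    have := congrArg Zsqrtd.norm hmain
    have hn : ∀ (g : GaussianInt) (n : ℕ), Zsqrtd.norm (g^n) = (Zsqrtd.norm g)^n := fun g n => map_pow Zsqrtd.normMonoidHom g n
    rw [hn, Zsqrtd.norm_mul, hn] at this
    have h2 : Zsqrtd.norm (2:GaussianInt) = 4 := by rfl
    rw [h2] at this
    simp only [Zsqrtd.norm_def] at this
    have e1 : a * a - (-1)*b*b = a^2+b^2 := by ring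
    rw [e1] at this
    rw [this]
    have e2 : (x:ℤ)*x - (-1)*3^m*3^m = 2*y^p := by rw [← heqZ]; ring
    rw [e2, mul_pow, hd, pow_succ (2:ℤ), pow_mul]; ring
  have hab : a^2+b^2 = 2*(y:ℤ) := (Odd.strictMono_pow (⟨d, hd⟩ : Odd p)).injective hnorm
  have hyoZ : Odd (y:ℤ) := by exact_mod_cast hyo
  have hboth : Odd a ∧ Odd b := by
    obtain ⟨t, ht⟩ := hyoZ
    rcases Int.even_or_odd' a with ⟨a', ha | ha⟩ <;> rcases Int.even_or_odd' b with ⟨b', hb | hb⟩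
    · exfalso; rw [ha, hb, ht] at hab; ring_nf at hab; omega
    · exfalso; rw [ha, hb, ht] at hab; ring_nf at hab; omega
    · exfalso; rw [ha, hb, ht] at hab; ring_nf at hab; omega
    · exact ⟨⟨a', ha⟩, ⟨b', hb⟩⟩
  refine ⟨a, b, hab, hboth.1, hboth.2, ?_, hyo, by rw [hd2]; exact hmain⟩
  rw [Int.isCoprime_iff_gcd_eq_one]
  by_contra hne
  obtain ⟨q, hq, hqd⟩ := Nat.exists_prime_and_dvd hne
  have hqa : (q:ℤ) ∣ a := (Int.natCast_dvd_natCast.2 hqd).trans (Int.gcd_dvd_left a b)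
  have hqb : (q:ℤ) ∣ b := (Int.natCast_dvd_natCast.2 hqd).trans (Int.gcd_dvd_right a b)
  have hdv : ((q:ℤ):GaussianInt) ∣ 2^d * (⟨x, 3^m⟩ : GaussianInt) := by
    rw [← hmain]
    apply dvd_pow _ hp.ne_zero
    rw [Zsqrtd.intCast_dvd]; exact ⟨hqa, hqb⟩
  have h2d : (2:GaussianInt)^d = (((2:ℤ)^d : ℤ):GaussianInt) := by push_cast; rfl
  rw [h2d, Zsqrtd.intCast_dvd] at hdv
  simp only [Zsqrtd.smul_val] at hdv
  have hqp : Prime (q:ℤ) := Nat.prime_iff_prime_int.1 hq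
  have hq2 : ¬ (q:ℤ) ∣ 2^d := by
    intro h
    have := hqp.dvd_of_dvd_pow h
    have h2 : (q:ℤ) ∣ 2 := this
    have : q = 2 := (Nat.prime_dvd_prime_iff_eq hq Nat.prime_two).1 (by exact_mod_cast h2)
    subst this
    have := hboth.1
    rw [Int.odd_iff] at this
    omega
  have hqx := (hqp.dvd_or_dvd hdv.1).resolve_left hq2
  have hqm := hqp.dvd_of_dvd_pow ((hqp.dvd_or_dvd hdv.2).resolve_left hq2)
  have : q = 3 := (Nat.prime_dvd_prime_iff_eq hq Nat.prime_three).1 (by exact_mod_cast hqm)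
  subst this
  exact h3x (by exact_mod_cast hqx)
end

section
/-- The Lucas-type sequence `u_j`. -/
def uu (V y : ℤ) : ℕ → ℤ
  | 0 => 1
  | 1 => V + y
  | (n+2) => V * uu V y (n+1) - y^2 * uu V y n

theorem uu_zero (V y : ℤ) : uu V y 0 = 1 := by simp [uu]
theorem uu_one (V y : ℤ) : uu V y 1 = V + y := by simp [uu]
theorem uu_succ (V y : ℤ) (n : ℕ) : uu V y (n+2) = V * uu V y (n+1) - y^2 * uu V y n := by
  simp [uu]

theorem im_pow_odd (a b y : ℤ) (h : a^2+b^2 = 2*y) (j : ℕ) :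
    ((⟨a,b⟩ : GaussianInt)^(2*j+1)).im = 2^j * b * uu (a^2-b^2) y j ∧
    ((⟨a,b⟩ : GaussianInt)^(2*(j+1)+1)).im = 2^(j+1) * b * uu (a^2-b^2) y (j+1) := by
  induction j with
  | zero =>
    constructor
    · simp [uu]
    · have : y*2 = a^2+b^2 := by linarith
      simp [uu, pow_succ]
      linear_combination b * h
  | succ n ih =>
    refine ⟨ih.2, ?_⟩
    set g : GaussianInt := ⟨a,b⟩ with hg
    have key : ∀ w : GaussianInt, (w * g^4).im = 2*(a^2-b^2) * (w*g^2).im - (2*y)^2 * w.im := by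
      intro w
      rcases w with ⟨r, s⟩
      rw [← h]
      simp [hg, pow_succ]; ring
    have e1 : g^(2*(n+1+1)+1) = g^(2*n+1) * g^4 := by ring
    have e2 : g^(2*(n+1)+1) = g^(2*n+1) * g^2 := by ring
    rw [e1, key, ← e2, ih.1, ih.2, uu_succ]; ring

theorem uu_mod3_A (V y : ℤ) (hV : V % 3 = 2) (hy : y % 3 = 2) (j : ℕ) :
    uu V y j % 3 = 1 ∧ uu V y (j+1) % 3 = 1 := by
  induction j with
  | zero => simp [uu]; omega
  | succ n ih =>
    refine ⟨ih.2, ?_⟩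
    rw [uu_succ]
    rcases ih with ⟨h1, h2⟩
    simp [Int.sub_emod, Int.mul_emod, pow_two, h1, h2, hV, hy]

theorem uu_mod3_B (V y : ℤ) (hV : V % 3 = 0) (hy : y % 3 = 1) (j : ℕ) :
    uu V y j % 3 ≠ 0 ∧ uu V y (j+1) % 3 ≠ 0 := by
  induction j with
  | zero => simp [uu]; omega
  | succ n ih =>
    refine ⟨ih.2, ?_⟩
    rw [uu_succ]
    rcases ih with ⟨h1, h2⟩
    have : uu V y n % 3 = 1 ∨ uu V y n % 3 = 2 := by omega
    rcases this with h | h <;> simp [Int.sub_emod, Int.mul_emod, pow_two, h, hV, hy]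

theorem uu_mod3_C (V y : ℤ) (hV : V % 3 = 1) (hy : y % 3 = 2) (k : ℕ) :
    uu V y (6*k) % 3 = 1 ∧ uu V y (6*k+1) % 3 = 0 ∧ uu V y (6*k+2) % 3 = 2 ∧
    uu V y (6*k+3) % 3 = 2 ∧ uu V y (6*k+4) % 3 = 0 ∧ uu V y (6*k+5) % 3 = 1 := by
  have step : ∀ n, uu V y (n+2) % 3 = (uu V y (n+1) % 3 - uu V y n % 3) % 3 := by
    intro n
    rw [uu_succ]
    simp [Int.sub_emod, Int.mul_emod, pow_two, hV, hy]
  have aux : ∀ n, uu V y n % 3 = 1 → uu V y (n+1) % 3 = 0 →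
     uu V y (n+2) % 3 = 2 ∧
    uu V y (n+3) % 3 = 2 ∧ uu V y (n+4) % 3 = 0 ∧ uu V y (n+5) % 3 = 1 ∧ uu V y (n+6) % 3 = 1 ∧ uu V y (n+7) % 3 = 0 := by
    intro n h0 h1
    have h2 : uu V y (n+2) % 3 = 2 := by rw [step n, h0, h1]; rfl
    have h3 : uu V y (n+3) % 3 = 2 := by rw [step (n+1), h1, h2]; rfl
    have h4 : uu V y (n+4) % 3 = 0 := by rw [step (n+2), h2, h3]; rfl
    have h5 : uu V y (n+5) % 3 = 1 := by rw [step (n+3), h3, h4]; rfl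
    have h6 : uu V y (n+6) % 3 = 1 := by rw [step (n+4), h4, h5]; rfl
    have h7 : uu V y (n+7) % 3 = 0 := by rw [step (n+5), h5, h6]; rfl
    exact ⟨h2, h3, h4, h5, h6, h7⟩
  have h : uu V y (6*k) % 3 = 1 ∧ uu V y (6*k+1) % 3 = 0 := by
    induction k with
    | zero => simp [uu]; omega
    | succ n ih =>
      have := aux _ ih.1 ih.2
      rw [show 6*(n+1) = 6*n+6 by ring]
      exact ⟨this.2.2.2.2.1, this.2.2.2.2.2⟩
  have h' := aux _ h.1 h.2
  exact ⟨h.1, h.2, h'.1, h'.2.1, h'.2.2.1, h'.2.2.2.1⟩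

def S3list : List (ℕ × ℕ) := [(1, 1), (3, 5), (11, 19), (41, 71), (0, 112), (112, 71), (142, 19), (150, 5), (152, 1), (152, 152), (150, 148), (142, 134), (112, 82), (0, 41), (41, 82), (11, 134), (3, 148), (1, 152)]
def S5list : List (ℕ × ℕ) := [(1, 0), (9, 4), (161, 72), (0, 1292), (2728, 72), (2880, 4), (2888, 0), (2880, 2885), (2728, 2817), (0, 1597), (161, 2817), (9, 2885)]

theorem pell3_mod (X : ℕ) : ∀ a : ℕ, a^2 + 2 = 3*X^2 → (X % 153, a % 153) ∈ S3list := by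
  have hcl : ∀ s ∈ S3list, ((s.2 + 2*s.1) % 153, (2*s.2+3*s.1) % 153) ∈ S3list := by decide
  induction X using Nat.strong_induction_on with
  | _ X ih =>
    intro a h
    rcases Nat.lt_or_ge X 2 with hX | hX
    · interval_cases X
      · omega
      · have : a = 1 := by nlinarith
        subst this; decide
    · have h1 : 3*X < 2*a := by nlinarith
      have h2 : a < 2*X := by nlinarith
      have h3 : X < a := by nlinarith
      obtain ⟨X', hX'⟩ : ∃ X', X' + a = 2*X := ⟨2*X-a, by omega⟩
      obtain ⟨a', ha'⟩ : ∃ a', a' + 3*X = 2*a := ⟨2*a-3*X, by omega⟩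
      have e1 : X = a' + 2*X' := by omega
      have e2 : a = 2*a' + 3*X' := by omega
      have := hcl _ (ih X' (by omega) a' (by rw [e1, e2] at h; nlinarith))
      rw [e1, e2]
      simpa [Nat.add_mod, Nat.mul_mod] using this

theorem pell5_mod (Z : ℕ) : ∀ X : ℕ, X^2 = 5*Z^2 + 1 → (X % 2889, Z % 2889) ∈ S5list := by
  have hcl : ∀ s ∈ S5list, ((9*s.1 + 20*s.2) % 2889, (4*s.1+9*s.2) % 2889) ∈ S5list := by decide
  induction Z using Nat.strong_induction_on with
  | _ Z ih =>
    intro X h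
    rcases Nat.eq_zero_or_pos Z with hZ | hZ
    · subst hZ
      have : X = 1 := by nlinarith
      subst this; decide
    · have h1 : 20*Z < 9*X := by nlinarith
      have h2 : 4*X ≤ 9*Z := by nlinarith
      have h3 : 2*Z < X := by nlinarith
      obtain ⟨X', hX'⟩ : ∃ X', X' + 20*Z = 9*X := ⟨9*X-20*Z, by omega⟩
      obtain ⟨Z', hZ'⟩ : ∃ Z', Z' + 4*X = 9*Z := ⟨9*Z-4*X, by omega⟩
      have e1 : X = 9*X' + 20*Z' := by omega
      have e2 : Z = 4*X' + 9*Z' := by omega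
      have := hcl _ (ih Z' (by omega) X' (by rw [e1, e2] at h; nlinarith))
      rw [e1, e2]
      simpa [Nat.add_mod, Nat.mul_mod] using this

theorem case_p3 (a : ℕ) (k : ℕ) (hk : 1 ≤ k) (h : a^2 + 2 = 3^(2*k-1)) : k = 1 ∨ k = 2 := by
  by_contra hc
  have hk3 : 3 ≤ k := by omega
  obtain ⟨j, rfl⟩ : ∃ j, k = j + 3 := ⟨k-3, by omega⟩
  have e : 3^(2*(j+3)-1) = 3 * (3^(j+2))^2 := by
    rw [← pow_mul, ← pow_succ']; congr 1; omega
  rw [e] at h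
  have h1 := pell3_mod _ _ h
  have h2 : ∀ s ∈ S3list, s.1 % 9 = 0 → s.1 % 17 = 0 := by decide
  have := h2 _ h1
  have h9 : 3^(j+2) % 9 = 0 := by rw [pow_add]; omega
  have h17 : ¬ 17 ∣ 3^(j+2) := by
    intro h
    have := (by norm_num : Nat.Prime 17).dvd_of_dvd_pow h
    omega
  simp only at this
  omega

theorem case_p5 (Z : ℕ) (m : ℕ) (hm : 1 ≤ m) (h : (9^m)^2 = 5*Z^2+1) : m = 1 := by
  by_contra hc
  obtain ⟨j, rfl⟩ : ∃ j, m = j + 2 := ⟨m-2, by omega⟩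
  have h1 := pell5_mod _ _ h
  have h2 : ∀ s ∈ S5list, s.1 % 27 = 0 → s.1 % 107 = 0 := by decide
  have := h2 _ h1
  have h9 : 9^(j+2) % 27 = 0 := by rw [pow_add]; omega
  have h17 : ¬ 107 ∣ 9^(j+2) := by
    intro h
    have := (by norm_num : Nat.Prime 107).dvd_of_dvd_pow h
    omega
  simp only at this
  omega
end

section
theorem cube_mod (x s : ℤ) (k : ℕ) (hk : 1 ≤ k) (hs : s = 1 ∨ s = -1) (h : (3:ℤ)^k ∣ x - s) : (3:ℤ)^(k+1) ∣ x^3 - s := by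
  obtain ⟨c, hc⟩ := h
  obtain ⟨j, rfl⟩ : ∃ j, k = j+1 := ⟨k-1, by omega⟩
  have hx : x = s + 3^(j+1)*c := by linarith
  have hs2 : s^2 = 1 := by rcases hs with h | h <;> rw [h] <;> norm_num
  refine ⟨s^2*c + s * 3^(j+1) * c^2 + 3^(2*j+1)*c^3, ?_⟩
  rw [hx]
  have : (s + 3^(j+1)*c)^3 - s = s*(s^2-1) + 3^(j+1+1) * (s^2*c + s * 3^(j+1) * c^2 + 3^(2*j+1)*c^3) := by
    ring
  rw [this, hs2]; ring

theorem gi_cub (a b : ℤ) (h3b : (3:ℤ) ∣ b) (h3a : ¬ (3:ℤ) ∣ a) (r : ℕ) :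
    ∃ A c : ℤ, (⟨a,b⟩ : GaussianInt)^(2*3^r) = ⟨A, 3^r*b*c⟩ ∧ (3:ℤ)^(r+1) ∣ A - 1 ∧ ¬ (3:ℤ) ∣ c := by
  induction r with
  | zero =>
    refine ⟨a^2-b^2, 2*a, ?_, ?_, ?_⟩
    · simp [pow_two, Zsqrtd.ext_iff]; constructor <;> ring
    · obtain ⟨b', rfl⟩ := h3b
      have : a % 3 = 1 ∨ a % 3 = 2 := by omega
      have h2 : a^2 % 3 = 1 := by
        rcases this with h | h <;> simp [pow_two, Int.mul_emod, h]
      have h3 : a^2 - (3*b')^2 - 1 = a^2 - 1 - 3*(3*b'^2) := by ring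
      rw [h3]; norm_num; omega
    · omega
  | succ r ih =>
    obtain ⟨A, c, h1, h2, h3⟩ := ih
    obtain ⟨b', hb'⟩ := h3b
    have hB : (3:ℤ)^r*b*c = 3^(r+1)*(b'*c) := by rw [hb']; ring
    refine ⟨A^3 - 3*A*(3^r*b*c)^2, c*A^2 - c * (3*(3^r*(b'*c))^2), ?_, ?_, ?_⟩
    · rw [pow_succ 3, ← mul_assoc, pow_mul, h1, hb']
      simp [pow_succ, Zsqrtd.ext_iff]; constructor <;> ring
    · have e := cube_mod A 1 (r+1) (by omega) (Or.inl rfl) h2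
      have e2 : (3:ℤ)^(r+1+1) ∣ 3*A*(3^r*b*c)^2 := by
        refine ⟨A * 3^(r+1)*(b'*c)^2, ?_⟩
        rw [hB]; ring
      have : A^3 - 3*A*(3^r*b*c)^2 - 1 = (A^3-1) - 3*A*(3^r*b*c)^2 := by ring
      rw [this]; exact dvd_sub e e2
    · intro h
      have hA : A % 3 = 1 := by
        have : (3:ℤ) ∣ A - 1 := (dvd_pow_self 3 (by omega)).trans h2
        omega
      have h4 : (3:ℤ) ∣ c * A^2 := by
        have : c*A^2 = (c*A^2 - c * (3*(3^r*(b'*c))^2)) + 3 * (c * (3^r*(b'*c))^2) := by ring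
        rw [this]; exact dvd_add h (dvd_mul_right _ _)
      have h5 : ¬ (3:ℤ) ∣ A := by omega
      have p3 : Prime (3:ℤ) := Int.prime_three
      rcases p3.dvd_or_dvd h4 with h | h
      · exact h3 h
      · exact h5 (p3.dvd_of_dvd_pow h)

theorem gi_pw (A B0 c b : ℤ) (r : ℕ) (h3b : (3:ℤ) ∣ b) (hB : B0 = 3^r*b*c) (hA : (3:ℤ)^(r+1) ∣ A - 1) (w : ℕ) :
    ∃ A' c' : ℤ, (⟨A,B0⟩ : GaussianInt)^w = ⟨A', 3^r*b*c'⟩ ∧ (3:ℤ)^(r+1) ∣ A' - 1 ∧ (3:ℤ) ∣ c' - w*c := by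
  induction w with
  | zero => exact ⟨1, 0, by simp [Zsqrtd.ext_iff], by simp, by simp⟩
  | succ w ih =>
    obtain ⟨A', c', h1, h2, h3⟩ := ih
    obtain ⟨b', hb'⟩ := h3b
    refine ⟨A'*A - (3^r*b*c')*B0, A'*c + c'*A, ?_, ?_, ?_⟩
    · rw [pow_succ, h1, hB]
      simp [Zsqrtd.ext_iff]; constructor <;> ring
    · have : A' * A - 3^r*b*c'*B0 - 1 = (A'-1)*A + (A-1) - 3^(r+1) * (b'*c'*B0) := by
        rw [hb']; ring
      rw [this]
      exact dvd_sub (dvd_add (Dvd.dvd.mul_right h2 _) hA) (dvd_mul_right _ _)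
    · have d1 : (3:ℤ) ∣ A - 1 := (dvd_pow_self 3 (by omega)).trans hA
      have d2 : (3:ℤ) ∣ A' - 1 := (dvd_pow_self 3 (by omega)).trans h2
      have : A'*c + c'*A - ((w+1:ℕ):ℤ)*c = (A'-1)*c + c'*(A-1) + (c' - w*c) := by push_cast; ring
      rw [this]
      exact dvd_add (dvd_add (Dvd.dvd.mul_right d2 _) (Dvd.dvd.mul_left d1 _)) h3

theorem two_pow_three (r : ℕ) : (3:ℤ)^(r+1) ∣ 2^(3^r) - (-1) := by
  induction r with
  | zero => norm_num
  | succ r ih =>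
    have := cube_mod _ (-1) (r+1) (by omega) (Or.inr rfl) ih
    rw [pow_succ 3 r, pow_mul]; exact this

theorem excl1 (a b : ℤ) (p : ℕ) (hp3 : p % 3 = 1) (hop : Odd p) (hp1 : 1 < p) (h3b : (3:ℤ) ∣ b) (hb : b ≠ 0) (h3a : ¬ (3:ℤ) ∣ a)
    (ε : ℤ) (hε : ε = 1 ∨ ε = -1)
    (h : ((⟨a,b⟩ : GaussianInt)^p).im = 2^((p-1)/2) * b * ε) : False := by
  obtain ⟨d, hd⟩ := hop
  have hd0 : d ≠ 0 := by omega
  have hd3 : 3 ∣ d := by omega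
  obtain ⟨r, w, hw, hdw⟩ := Nat.exists_eq_pow_mul_and_not_dvd hd0 3 (by norm_num)
  have hr : r ≠ 0 := by
    rintro rfl
    apply hw; simpa [hdw] using hd3
  obtain ⟨A, c, h1, h2, h3⟩ := gi_cub a b h3b h3a r
  obtain ⟨A', c', h4, h5, h6⟩ := gi_pw A _ c b r h3b rfl h2 w
  have hp : (⟨a,b⟩ : GaussianInt)^p = ⟨A', 3^r*b*c'⟩ * ⟨a, b⟩ := by
    rw [hd, hdw, pow_succ, ← mul_assoc, pow_mul, h1, h4]
  have hdd : (p-1)/2 = d := by omega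
  rw [hp, hdd] at h
  simp at h
  have h7 : A' + 3^r*c'*a = 2^d*ε := by
    apply mul_left_cancel₀ hb; linarith
  have h8 : (3:ℤ)^(r+1) ∣ 2^d - (-1)^w := by
    rw [hdw, pow_mul]
    exact (two_pow_three r).trans (sub_dvd_pow_sub_pow _ _ w)
  have h9 : (3:ℤ)^(r+1) ∣ ε * (-1)^w - 1 - 3^r*c'*a := by
    have : ε * (-1)^w - 1 - 3^r*c'*a = (A'-1) - ε * (2^d - (-1)^w) := by linear_combination -h7
    rw [this]
    exact dvd_sub h5 (Dvd.dvd.mul_left h8 _)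
  have h10 : ε * (-1)^w = 1 := by
    have e1 : ε * (-1)^w = 1 ∨ ε * (-1)^w = -1 := by
      rcases hε with h | h <;> rcases neg_one_pow_eq_or ℤ w with h' | h' <;> rw [h, h'] <;> norm_num
    rcases e1 with h | h
    · exact h
    · exfalso
      rw [h] at h9
      have e2 : (3:ℤ) ∣ -1-1 - 3^r*c'*a := (dvd_pow_self 3 (by omega)).trans h9
      have e3 : (3:ℤ) ∣ 3^r*c'*a := Dvd.dvd.mul_right (Dvd.dvd.mul_right (dvd_pow_self 3 hr) _) _
      have := dvd_add e2 e3
      norm_num at this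
  rw [h10] at h9
  have e4 : (3:ℤ) ∣ c'*a := by
    have : (3:ℤ)^r*3 ∣ 3^r*(c'*a) := by
      have h11 := (dvd_neg).2 h9
      rw [← pow_succ]
      have e : (3:ℤ)^r*(c'*a) = -(1-1-3^r*c'*a) := by ring
      rw [e]; exact h11
    exact (mul_dvd_mul_iff_left (by positivity)).1 this
  have p3 : Prime (3:ℤ) := Int.prime_three
  have e5 := (p3.dvd_or_dvd e4).resolve_right h3a
  have e6 : (3:ℤ) ∣ w*c := by
    have := dvd_sub e5 h6
    simpa using this
  rcases p3.dvd_or_dvd e6 with h | h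
  · exact hw (by exact_mod_cast h)
  · exact h3 h

theorem sign_mod (a b : ℤ) (p : ℕ) (hp : p.Prime) (hop : Odd p) (hpb : ¬ (p:ℤ) ∣ b) 
    (ε : ℤ) (h : ((⟨a,b⟩ : GaussianInt)^p).im = 2^((p-1)/2) * b * ε) :
    (p:ℤ) ∣ 2^((p-1)/2) * ε - (-1)^((p-1)/2) := by
  obtain ⟨d, hd⟩ := hop
  have hdd : (p-1)/2 = d := by omega
  rw [hdd] at h ⊢
  obtain ⟨r, hr⟩ := exists_add_pow_prime_eq hp ((a:ℤ):GaussianInt) (⟨0,b⟩)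
  have e : (a:GaussianInt) + ⟨0,b⟩ = ⟨a,b⟩ := by simp [Zsqrtd.ext_iff]
  have e2 : (⟨0,b⟩:GaussianInt)^p = ⟨0, b^p * (-1)^d⟩ := by
    have : (⟨0,b⟩:GaussianInt)^2 = ((-b^2 : ℤ) : GaussianInt) := by
      rw [Zsqrtd.ext_iff]; constructor
      · simp only [pow_two, Zsqrtd.re_mul, Zsqrtd.re_intCast]; ring
      · simp only [pow_two, Zsqrtd.im_mul, Zsqrtd.im_intCast]; ring
    rw [hd, pow_succ, pow_mul, this, ← Int.cast_pow, neg_pow, ← pow_mul]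
    simp only [Zsqrtd.smul_val]
    rw [Zsqrtd.ext_iff]; constructor
    · simp
    · simp only; ring
  rw [e, e2, ← Int.cast_pow] at hr
  rw [hr] at h
  have e3 : ((p:GaussianInt)*⟨a,b⟩*⟨0,b⟩*r).im = p*((⟨a,b⟩:GaussianInt)*⟨0,b⟩*r).im := by
    have : (p:GaussianInt) = ((p:ℤ):GaussianInt) := by simp
    rw [this, mul_assoc, mul_assoc, Zsqrtd.im_smul, ← mul_assoc]
  have e4 : ∀ w : GaussianInt, (p:ℤ) ∣ ((p:GaussianInt)*w).im := by
    intro w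
    have : (p:GaussianInt) = ((p:ℤ):GaussianInt) := by simp
    rw [this, Zsqrtd.im_smul]; exact dvd_mul_right _ _
  simp only [Zsqrtd.im_add, Zsqrtd.im_intCast, zero_add] at h
  have e5 : (p:ℤ) ∣ 2^d*b*ε - b^p*(-1)^d := by
    rw [← h]
    simp only [add_sub_cancel_left, mul_assoc]
    exact e4 _
  have e6 : (p:ℤ) ∣ b^p - b := by
    have := Fact.mk hp
    have := ZMod.pow_card (b : ZMod p)
    rw [← ZMod.intCast_zmod_eq_zero_iff_dvd]
    push_cast; rw [this]; simp
  have e7 : (p:ℤ) ∣ (2^d*ε - (-1)^d) * b := by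
    have : (2^d*ε - (-1)^d) * b = (2^d*b*ε - b^p*(-1)^d) + (b^p-b)*(-1)^d := by ring
    rw [this]; exact dvd_add e5 (Dvd.dvd.mul_right e6 _)
  exact ((Nat.prime_iff_prime_int.1 hp).dvd_or_dvd e7).resolve_right hpb

theorem two_pow_mod (p : ℕ) (hp : p.Prime) (h8 : p % 8 = 1 ∨ p % 8 = 7) : (p:ℤ) ∣ 2^((p-1)/2) - 1 := by
  have := Fact.mk hp
  have hp2 : p ≠ 2 := by omega
  obtain ⟨s, hs⟩ := (ZMod.exists_sq_eq_two_iff hp2).2 h8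
  rw [← ZMod.intCast_zmod_eq_zero_iff_dvd]
  push_cast
  rw [hs, ← pow_two, ← pow_mul, show 2*((p-1)/2) = p-1 by omega, ZMod.pow_card_sub_one_eq_one]
  · simp
  · rintro rfl
    have : ((2:ℕ):ZMod p) = 0 := by push_cast; rw [hs]; simp
    rw [ZMod.natCast_eq_zero_iff] at this
    have := Nat.le_of_dvd (by norm_num) this
    have := hp.two_le; omega
end

section
set_option maxHeartbeats 1000000 in
theorem partA (x y m p : ℕ) (hx : 0 < x) (hy : 0 < y) (hm : 1 ≤ m)
    (hcop : Nat.gcd x y = 1) (hp : Nat.Prime p) (hop : Odd p)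
    (heq : x ^ 2 + 3 ^ (2 * m) = 2 * y ^ p) :
    ((x, y, m, p) = (13, 5, 2, 3) ∨ (x, y, m, p) = (79, 5, 1, 5) ∨
      (x, y, m, p) = (545, 53, 3, 3)) ∨
    (11 ≤ p ∧ ∃ a : ℤ, 0 < a ∧ Odd a ∧ IsCoprime a 3 ∧ a^2 + (3^m)^2 = 2 * (y:ℤ) ∧ Odd y ∧
      ((p % 24 = 5 ∧ uu (a^2-(3^m)^2) y ((p-1)/2) = -1) ∨ 
        (p % 24 = 11 ∧ uu (a^2-(3^m)^2) y ((p-1)/2) = 1))) := by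
  obtain ⟨a, b, hab, hao, hbo, hcab, hyo, hpow⟩ := partA1 x y m p hm hcop hp hop heq
  obtain ⟨d, hd⟩ := id hop
  have hdd : (p-1)/2 = d := by omega
  have him := (im_pow_odd a b y hab d).1
  rw [← hd, hpow, hdd] at him
  have h2d : (2:GaussianInt)^d = (((2:ℤ)^d : ℤ):GaussianInt) := by push_cast; rfl
  rw [h2d, Zsqrtd.im_smul] at him
  simp only at him
  have hbu : b * uu (a^2-b^2) y d = 3^m := by
    have h2 : (2:ℤ)^d ≠ 0 := by positivity
    apply mul_left_cancel₀ h2; rw [him]; ring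
  -- 3 ∣ b
  have h3b : (3:ℤ) ∣ b := by
    by_contra hb
    have hb2 : b^2 % 3 = 1 := by
      have : b % 3 = 1 ∨ b % 3 = 2 := by omega
      rcases this with h | h <;> simp [pow_two, Int.mul_emod, h]
    have hu : (3:ℤ) ∣ uu (a^2-b^2) y d := by
      have : (3:ℤ) ∣ b * uu (a^2-b^2) y d := by rw [hbu]; exact dvd_pow_self 3 (by omega)
      exact (Int.prime_three.dvd_or_dvd this).resolve_left hb
    have ha2 : a^2 % 3 = 0 ∨ a^2 % 3 = 1 := by
      have : a % 3 = 0 ∨ a % 3 = 1 ∨ a % 3 = 2 := by omega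
      rcases this with h | h | h <;> simp [pow_two, Int.mul_emod, h]
    rcases ha2 with h | h
    · have := (uu_mod3_A (a^2-b^2) y (by omega) (by omega) d).1
      omega
    · have := (uu_mod3_B (a^2-b^2) y (by omega) (by omega) d).1
      omega
  have h3a : ¬ (3:ℤ) ∣ a := by
    intro h
    obtain ⟨r, s, hrs⟩ := hcab
    have : (3:ℤ) ∣ 1 := by rw [← hrs]; exact dvd_add (Dvd.dvd.mul_left h _) (Dvd.dvd.mul_left h3b _)
    norm_num at this
  have ha2 : a^2 % 3 = 1 := by
    have : a % 3 = 1 ∨ a % 3 = 2 := by omega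
    rcases this with h | h <;> simp [pow_two, Int.mul_emod, h]
  have hb2 : b^2 % 9 = 0 := by
    obtain ⟨c, rfl⟩ := h3b
    rw [show (3*c)^2 = 9*c^2 by ring]; omega
  have hC := uu_mod3_C (a^2-b^2) y (by omega) (by omega)
  have hbabs : ∃ k ≤ m, b.natAbs = 3^k := by
    have : b.natAbs ∣ 3^m := by
      have : b ∣ 3^m := ⟨_, hbu.symm⟩
      have := Int.natAbs_dvd_natAbs.2 this
      simpa [Int.natAbs_pow] using this
    exact (Nat.dvd_prime_pow Nat.prime_three).1 this
  obtain ⟨k, hkm, hk⟩ := hbabs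
  have hk1 : 1 ≤ k := by
    by_contra h
    have : k = 0 := by omega
    subst this
    omega
  have hbk2 : b^2 = (3^k)^2 := by
    rw [← Int.natAbs_sq, hk]; push_cast; rfl
  have habs : 3^k * (uu (a^2-b^2) y d).natAbs = 3^m := by
    have := congrArg Int.natAbs hbu
    rw [Int.natAbs_mul, hk] at this
    simpa [Int.natAbs_pow] using this
  have hab' : (a.natAbs:ℤ)^2 = a^2 := Int.natAbs_sq a
  rcases eq_or_ne p 3 with hp3 | hp3
  · left
    have hd1 : d = 1 := by omega
    subst hd1
    rw [uu_one] at hbu habs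
    -- b*(3a^2-b^2)=2*3^m
    obtain ⟨n, rfl⟩ := Nat.exists_eq_add_of_le hkm
    rw [pow_add] at habs
    have habs' : (a^2-b^2+y).natAbs = 3^n := Nat.eq_of_mul_eq_mul_left (by positivity) habs
    have hmod : (a^2-b^2+y) % 9 = 3 ∨ (a^2-b^2+y) % 9 = 6 := by omega
    have hn : n = 1 := by
      rcases n with _ | _ | n
      · simp at habs'; omega
      · rfl
      · exfalso
        have : 3^(n+1+1) % 9 = 0 := by rw [pow_add, pow_one, pow_add]; omega
        omega
    subst hn
    have hkey : a^2 + 2 = (3:ℤ)^(2*k-1) := by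
      have e : (3:ℤ)^(2*k) = 3 * 3^(2*k-1) := by rw [← pow_succ']; congr 1; omega
      have e1 : b^2 = 3 * 3^(2*k-1) := by rw [hbk2, ← e, ← pow_mul, mul_comm]
      have e2 : (3:ℤ)^(2*k-1) % 3 = 0 := by
        rw [show 2*k-1 = (2*k-2)+1 by omega, pow_succ]; omega
      omega
    have hkeyN : a.natAbs^2 + 2 = 3^(2*k-1) := by zify; simpa using hkey
    rcases case_p3 _ _ hk1 hkeyN with rfl | rfl
    · left
      norm_num at hkey hbk2
      have hy5 : y = 5 := by omega
      subst hy5 hp3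
      norm_num at heq
      have : x = 13 := Nat.pow_left_injective (n := 2) (by norm_num) (by simp only; omega)
      subst this; rfl
    · right; right
      norm_num at hkey hbk2
      have hy5 : y = 53 := by omega
      subst hy5 hp3
      norm_num at heq
      have : x = 545 := Nat.pow_left_injective (n := 2) (by norm_num) (by simp only; omega)
      subst this; rfl
  · have hp5 : 5 ≤ p := by
      have := hp.two_le
      have : p ≠ 4 := by rintro rfl; revert hp; norm_num
      omega
    have hpn3 : p % 3 ≠ 0 := by
      intro h
      exact hp3 ((Nat.prime_dvd_prime_iff_eq Nat.prime_three hp).1 (by omega)).symm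
    have hu3 : uu (a^2-b^2) y d % 3 ≠ 0 := by
      have := hC (d/6)
      have h6 : d = 6*(d/6) ∨ d = 6*(d/6)+1 ∨ d = 6*(d/6)+2 ∨ d = 6*(d/6)+3 ∨ d = 6*(d/6)+4 ∨ d = 6*(d/6)+5 := by omega
      rcases h6 with h | h | h | h | h | h
      · rw [h]; omega
      · omega
      · rw [h]; omega
      · rw [h]; omega
      · omega
      · rw [h]; omega
    have hkm' : k = m := by
      obtain ⟨n, rfl⟩ := Nat.exists_eq_add_of_le hkm
      rw [pow_add] at habs
      have habs' : (uu (a^2-b^2) y d).natAbs = 3^n := Nat.eq_of_mul_eq_mul_left (by positivity) habs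
      rcases n with _ | n
      · rfl
      · exfalso
        have : 3^(n+1) % 3 = 0 := by rw [pow_succ]; omega
        omega
    subst hkm'
    have hu1 : (uu (a^2-b^2) y d).natAbs = 1 := by
      have h3 : 0 < 3^k := by positivity
      exact Nat.eq_of_mul_eq_mul_left h3 (by rw [habs, mul_one])
    have hε : uu (a^2-b^2) y d = 1 ∨ uu (a^2-b^2) y d = -1 := by omega
    have hb0 : b ≠ 0 := by
      rintro rfl
      have : 0 < 3^k := by positivity
      simp at hk; omega
    have himg : ((⟨a,b⟩ : GaussianInt)^p).im = 2^((p-1)/2) * b * uu (a^2-b^2) y d := by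
      rw [hdd, hd]; exact (im_pow_odd a b y hab d).1
    have hp1 : p % 3 ≠ 1 := fun h => excl1 a b p h hop (by omega) h3b hb0 h3a _ hε himg
    have hpb : ¬ (p:ℤ) ∣ b := by
      intro h
      have h1 := Int.natAbs_dvd_natAbs.2 h
      rw [hk] at h1
      have h2 : p ∣ 3 := hp.dvd_of_dvd_pow (by simpa using h1)
      exact hp3 ((Nat.prime_dvd_prime_iff_eq hp Nat.prime_three).1 h2)
    have hsign := sign_mod a b p hp hop hpb _ himg
    rw [hdd] at hsign
    have hcases : (p % 24 = 5 ∧ uu (a^2-b^2) y d = -1) ∨ (p % 24 = 11 ∧ uu (a^2-b^2) y d = 1) := by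
      have h24 : p % 24 = 5 ∨ p % 24 = 11 ∨ p % 24 = 17 ∨ p % 24 = 23 := by omega
      have hC6 := hC (d/6)
      rcases h24 with h | h | h | h
      · left; refine ⟨h, ?_⟩
        have e : d = 6*(d/6)+2 := by omega
        rw [← e] at hC6; omega
      · right; refine ⟨h, ?_⟩
        have e : d = 6*(d/6)+5 := by omega
        rw [← e] at hC6; omega
      · exfalso
        have e : d = 6*(d/6)+2 := by omega
        rw [← e] at hC6
        have hu : uu (a^2-b^2) y d = -1 := by omega
        have ht := two_pow_mod p hp (by omega)
        have hev : Even d := by rw [Nat.even_iff]; omega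
        rw [hu, hev.neg_one_pow] at hsign
        rw [hdd] at ht
        have := dvd_add hsign ht
        rw [show (2:ℤ)^d * -1 - 1 + (2^d - 1) = -2 by ring, dvd_neg] at this
        have := Int.le_of_dvd (by norm_num) this
        omega
      · exfalso
        have e : d = 6*(d/6)+5 := by omega
        rw [← e] at hC6
        have hu : uu (a^2-b^2) y d = 1 := by omega
        have ht := two_pow_mod p hp (by omega)
        have hod : Odd d := by rw [Nat.odd_iff]; omega
        rw [hu, hod.neg_one_pow] at hsign
        rw [hdd] at ht
        have := dvd_sub hsign ht
        rw [show (2:ℤ)^d * 1 - -1 - (2^d - 1) = 2 by ring] at this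
        have := Int.le_of_dvd (by norm_num) this
        omega
    rcases eq_or_ne p 5 with hp5' | hp5'
    · left; right; left
      have hd2 : d = 2 := by omega
      have hu : uu (a^2-b^2) y d = -1 := by omega
      rw [hd2, uu_succ, uu_one, uu_zero] at hu
      have hev : ∃ Z : ℤ, a^2-b^2 = 2*Z := by
        obtain ⟨s, hs⟩ := hao
        obtain ⟨t, ht⟩ := hbo
        exact ⟨2*s^2+2*s-2*t^2-2*t, by rw [hs, ht]; ring⟩
      obtain ⟨Z, hZ⟩ := hev
      have hyZ : (y:ℤ) = Z + b^2 := by linarith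
      rw [hZ, hyZ] at hu
      have hfin : (b^2)^2 = 5*Z^2+1 := by linear_combination -hu
      have h9 : b^2 = 9^k := by rw [hbk2, ← pow_mul, mul_comm, pow_mul]; norm_num
      have hfinN : (9^k)^2 = 5*Z.natAbs^2+1 := by
        zify; rw [← h9]; simpa using hfin
      have hk1 := case_p5 _ _ hm hfinN
      subst hk1
      norm_num at hfinN
      have hZ4 : Z.natAbs = 4 := by
        have : Z.natAbs^2 = 4^2 := by omega
        exact Nat.pow_left_injective (by norm_num) this
      have hb9 : b^2 = 9 := by rw [h9]; norm_num
      have hZ' : Z = 4 ∨ Z = -4 := by omega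
      have hy5 : y = 5 := by
        rcases hZ' with h | h
        · exfalso
          have : a^2 = 17 := by omega
          have h1 : a < 5 := by nlinarith
          have h2 : -5 < a := by nlinarith
          interval_cases a <;> omega
        · omega
      subst hy5 hp5'
      norm_num at heq
      have : x = 79 := Nat.pow_left_injective (n := 2) (by norm_num) (by simp only; omega)
      subst this; rfl
    · right
      refine ⟨?_, |a|, ?_, ?_, ?_, ?_, hyo, ?_⟩
      · omega
      · apply abs_pos.2; rintro rfl; simp at h3a
      · exact odd_abs.2 hao
      · have hc3 : IsCoprime a 3 := ((Int.prime_three.coprime_iff_not_dvd).2 h3a).symm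
        rcases abs_choice a with h | h <;> rw [h]
        · exact hc3
        · exact hc3.neg_left
      · rw [sq_abs, ← hbk2]; exact hab
      · rw [sq_abs, ← hbk2, hdd]; exact hcases
end

section
open NumberTheorySymbols

theorem uu_dvd_E (V y : ℤ) (j t : ℕ) (ht : t + 1 ≤ j) :
    uu V y j ∣ uu V y (j+t) + y^(2*t) * uu V y (j-t) ∧
    uu V y j ∣ uu V y (j+(t+1)) + y^(2*(t+1)) * uu V y (j-(t+1)) := by
  induction t with
  | zero =>
    constructor
    · simp only [add_zero, mul_zero, pow_zero, Nat.sub_zero, one_mul]; exact dvd_add dvd_rfl dvd_rfl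
    · obtain ⟨i, rfl⟩ : ∃ i, j = i+1 := ⟨j-1, by omega⟩
      refine ⟨V, ?_⟩
      rw [show i + 1 + (0+1) = i+2 by ring, uu_succ]
      simp; ring
  | succ t ih =>
    obtain ⟨h1, h2⟩ := ih (by omega)
    refine ⟨h2, ?_⟩
    obtain ⟨i, rfl⟩ : ∃ i, j = i+t+2 := ⟨j-t-2, by omega⟩
    have e1 : i + t + 2 - t = i+2 := by omega
    have e2 : i + t + 2 - (t+1) = i+1 := by omega
    have e3 : i + t + 2 - (t+1+1) = i := by omega
    rw [e1] at h1
    rw [e2] at h2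
    rw [e3]
    have e4 : uu V y (i + t + 2 + (t+1+1)) = V * uu V y (i+t+2+(t+1)) - y^2 * uu V y (i+t+2+t) := by
      exact uu_succ V y (i+t+2+t)
    have e5 := uu_succ V y i
    have : uu V y (i + t + 2 + (t+1+1)) + y^(2*(t+1+1)) * uu V y i =
      V * (uu V y (i+t+2+(t+1)) + y^(2*(t+1)) * uu V y (i+1)) - y^2 * (uu V y (i+t+2+t) + y^(2*t)*uu V y (i+2)) := by
      rw [e4, e5]; ring
    rw [this]
    exact dvd_sub (Dvd.dvd.mul_left h2 _) (Dvd.dvd.mul_left h1 _)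

theorem uu_dvd_E' (V y : ℤ) (j t : ℕ) (ht : t ≤ j) :
    uu V y j ∣ uu V y (j+t) + y^(2*t) * uu V y (j-t) := by
  rcases Nat.lt_or_ge t j with h | h
  · exact (uu_dvd_E V y j t h).1
  · have : t = j := by omega
    subst this
    rcases t with _ | t
    · rw [uu_zero]; exact one_dvd _
    · exact (uu_dvd_E V y (t+1) t le_rfl).2

theorem uu_dvd_D (V y : ℤ) (j i : ℕ) :
    uu V y j ∣ uu V y (i+2*j+1) - y^(2*j+1) * uu V y i ∧
    uu V y j ∣ uu V y (i+1+2*j+1) - y^(2*j+1) * uu V y (i+1) := by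
  rcases j with _ | j
  · rw [uu_zero]; exact ⟨one_dvd _, one_dvd _⟩
  induction i with
  | zero =>
    have h1 := uu_dvd_E V y (j+1) j le_rfl
    obtain ⟨h1, h2⟩ := h1
    rw [show j + 1 - j = 1 by omega, uu_one] at h1
    rw [show j + 1 - (j+1) = 0 by omega, uu_zero] at h2
    have e1 : uu V y (0+2*(j+1)+1) = V * uu V y (j+1+(j+1)) - y^2 * uu V y (j+1+j) := by
      rw [show 0+2*(j+1)+1 = (j+1+j)+2 by ring, uu_succ]; rfl
    have h3 : uu V y (j+1) ∣ uu V y (0+2*(j+1)+1) - y^(2*(j+1)+1) * uu V y 0 := by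
      have : uu V y (0+2*(j+1)+1) - y^(2*(j+1)+1) * uu V y 0 =
        V * (uu V y (j + 1 + (j + 1)) + y ^ (2 * (j + 1)) * 1) - y^2 * (uu V y (j + 1 + j) + y ^ (2 * j) * (V + y)) := by
        rw [e1, uu_zero]; ring
      rw [this]
      exact dvd_sub (Dvd.dvd.mul_left h2 _) (Dvd.dvd.mul_left h1 _)
    refine ⟨h3, ?_⟩
    have e2 : uu V y (0+1+2*(j+1)+1) = V * uu V y (0+2*(j+1)+1) - y^2 * uu V y (j+1+(j+1)) := by
      rw [show 0+1+2*(j+1)+1 = (j+1+(j+1))+2 by ring, uu_succ]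
      rw [show (0+2*(j+1)+1) = j+1+(j+1)+1 by ring]
    have : uu V y (0+1+2*(j+1)+1) - y^(2*(j+1)+1) * uu V y (0+1) =
       V * (uu V y (0+2*(j+1)+1) - y^(2*(j+1)+1) * uu V y 0) - y^2 * (uu V y (j + 1 + (j + 1)) + y ^ (2 * (j + 1)) * 1) := by
      rw [e2, uu_zero, zero_add, uu_one]; ring
    rw [this]
    exact dvd_sub (Dvd.dvd.mul_left h3 _) (Dvd.dvd.mul_left h2 _)
  | succ i ih =>
    obtain ⟨h1, h2⟩ := ih
    refine ⟨h2, ?_⟩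
    have e1 : uu V y (i+1+1+2*(j+1)+1) = V * uu V y (i+1+2*(j+1)+1) - y^2 * uu V y (i+2*(j+1)+1) := by
      rw [show i+1+1+2*(j+1)+1 = (i+2*(j+1)+1)+2 by ring, uu_succ]
      rw [show i+1+2*(j+1)+1 = (i+2*(j+1)+1)+1 by ring]
    have : uu V y (i+1+1+2*(j+1)+1) - y^(2*(j+1)+1) * uu V y (i+1+1) =
      V * (uu V y (i + 1 + 2 * (j + 1) + 1) - y ^ (2 * (j + 1) + 1) * uu V y (i + 1)) - y^2 * (uu V y (i + 2 * (j + 1) + 1) - y ^ (2 * (j + 1) + 1) * uu V y i) := by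
      rw [e1, uu_succ]; ring
    rw [this]
    exact dvd_sub (Dvd.dvd.mul_left h2 _) (Dvd.dvd.mul_left h1 _)

theorem uu_mod4 (V y : ℤ) (hV : V % 4 = 0) (hy : y % 4 = 1) (k : ℕ) :
    uu V y (4*k) % 4 = 1 ∧ uu V y (4*k+1) % 4 = 1 ∧ uu V y (4*k+2) % 4 = 3 ∧ uu V y (4*k+3) % 4 = 3 := by
  have step : ∀ n, uu V y (n+2) % 4 = (- (uu V y n % 4)) % 4 := by
    intro n
    rw [uu_succ]
    simp [Int.sub_emod, Int.mul_emod, pow_two, hV, hy]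
  have h : uu V y (4*k) % 4 = 1 ∧ uu V y (4*k+1) % 4 = 1 := by
    induction k with
    | zero => simp [uu]; omega
    | succ n ih =>
      have h2 : uu V y (4*n+2) % 4 = 3 := by rw [step, ih.1]; rfl
      have h3 : uu V y (4*n+3) % 4 = 3 := by rw [step (4*n+1), ih.2]; rfl
      constructor
      · rw [show 4*(n+1) = 4*n+2+2 by ring, step, h2]; rfl
      · rw [show 4*(n+1)+1 = 4*n+3+2 by ring, step, h3]; rfl
  refine ⟨h.1, h.2, ?_, ?_⟩
  · rw [step, h.1]; rfl
  · rw [step (4*k+1), h.2]; rfl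

theorem uu_trig (V y : ℤ) (θ : ℝ) (hV : (V:ℝ) = 2*y*Real.cos (2*θ)) (j : ℕ) :
    (uu V y j : ℝ) * Real.sin θ = (y:ℝ)^j * Real.sin ((2*j+1)*θ) ∧ 
    (uu V y (j+1) : ℝ) * Real.sin θ = (y:ℝ)^(j+1) * Real.sin ((2*(j+1)+1)*θ) := by
  induction j with
  | zero =>
    constructor
    · simp [uu]
    · rw [uu_one]
      push_cast
      rw [hV]
      have : (2*(0+1)+1)*θ = 2*θ+θ := by ring
      rw [this, Real.sin_add, Real.sin_two_mul, Real.cos_two_mul]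
      ring
  | succ j ih =>
    obtain ⟨h1, h2⟩ := ih
    push_cast at h1 h2 ⊢
    refine ⟨h2, ?_⟩
    rw [uu_succ]
    push_cast
    have e : (V * uu V y (j+1) - y^2 * uu V y j : ℝ) * Real.sin θ = V * (uu V y (j+1) * Real.sin θ) - y^2 * (uu V y j * Real.sin θ) := by ring
    rw [e, h1, h2, hV]
    have e1 : (2*((j:ℝ)+1+1)+1)*θ = (2*(j+1)+1)*θ + 2*θ := by ring
    have e2 : (2*(j:ℝ)+1)*θ = (2*(j+1)+1)*θ - 2*θ := by ring
    rw [e1, e2, Real.sin_add, Real.sin_sub]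
    ring

theorem sign_floor (t : ℝ) (ht : 0 ≤ t) : 0 ≤ (-1:ℝ)^⌊t⌋₊ * Real.sin (Real.pi * t) := by
  have h1 := Nat.floor_le ht
  have h2 := Nat.lt_floor_add_one t
  have e : Real.pi * t = Real.pi * (t - ⌊t⌋₊) + ⌊t⌋₊ * Real.pi := by ring
  rw [e, Real.sin_add_nat_mul_pi, ← mul_assoc, ← mul_pow]
  norm_num
  apply Real.sin_nonneg_of_nonneg_of_le_pi
  · have := Real.pi_pos; nlinarith
  · have := Real.pi_pos; nlinarith

/-- floor sum -/
def cc (H : ℕ → ℕ) (n l : ℕ) : ℕ := ∑ i ∈ Finset.Icc 1 (H l), n * i / l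

structure Hgood (H : ℕ → ℕ) : Prop where
  mono : ∀ n l i j, 0 < l → j * l ≤ n * i → i ≤ H l → j ≤ H n
  lt : ∀ l, 0 < l → H l < l

theorem Hgood_floor (x : ℝ) (h0 : 0 ≤ x) (h1 : x < 1) : Hgood (fun l => ⌊(l:ℝ)*x⌋₊) := by
  constructor
  · intro n l i j hl h hi
    have hl' : (0:ℝ) < l := by exact_mod_cast hl
    rw [Nat.le_floor_iff (by positivity)] at hi ⊢
    have h' : (j:ℝ)*l ≤ n*i := by exact_mod_cast h
    have h3 : (n:ℝ)*i ≤ n*(l*x) := by gcongr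
    have : (j:ℝ)*l ≤ (n*x)*l := by linarith
    exact le_of_mul_le_mul_right this hl'
  · intro l hl
    have hl' : (0:ℝ) < l := by exact_mod_cast hl
    rw [Nat.floor_lt (by positivity)]
    nlinarith

theorem Hgood_quarter : Hgood (fun l => l/4) := by
  have h := Hgood_floor (1/4) (by norm_num) (by norm_num)
  have e : (fun l : ℕ => ⌊(l:ℝ)*(1/4)⌋₊) = fun l => l/4 := by
    funext l
    have := Nat.floor_div_natCast (l:ℝ) 4
    rw [mul_one_div]
    simpa using this
  rwa [e] at h

theorem cc_add (H : ℕ → ℕ) (n l : ℕ) (hl : 0 < l) : Even (cc H (n+2*l) l + cc H n l) := by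
  have : cc H (n+2*l) l = cc H n l + 2 * ∑ i ∈ Finset.Icc 1 (H l), i := by
    unfold cc
    rw [Finset.mul_sum, ← Finset.sum_add_distrib]
    apply Finset.sum_congr rfl
    intro i _
    rw [show (n+2*l)*i = n*i + (2*i)*l by ring, Nat.add_mul_div_right _ _ hl]
  rw [this]
  exact ⟨cc H n l + ∑ i ∈ Finset.Icc 1 (H l), i, by ring⟩

theorem cc_sub (H : ℕ → ℕ) (hH : Hgood H) (n n' l : ℕ) (hl : 0 < l) (h : n + n' = 2*l) (hc : Nat.Coprime n' l) :
    Even (cc H n l + cc H n' l + H l) := by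
  have : cc H n l + cc H n' l + H l = 2 * ∑ i ∈ Finset.Icc 1 (H l), i := by
    have hcard : ∑ i ∈ Finset.Icc 1 (H l), 1 = H l := by simp
    have hcard2 : cc H n l + cc H n' l + H l = cc H n l + cc H n' l + ∑ i ∈ Finset.Icc 1 (H l), 1 := by rw [hcard]
    rw [hcard2]
    unfold cc
    rw [Finset.mul_sum, ← Finset.sum_add_distrib, ← Finset.sum_add_distrib]
    apply Finset.sum_congr rfl
    intro i hi
    rw [Finset.mem_Icc] at hi
    have hil := hH.lt l hl
    have e : n * i + n'*i = (2*i)*l := by rw [← add_mul, h]; ring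
    have hnd : ¬ l ∣ n' * i := by
      intro hd
      have := Nat.le_of_dvd (by omega) (hc.symm.dvd_of_dvd_mul_left hd)
      omega
    set q := n'*i/l with hq
    have hq1 := Nat.div_add_mod (n'*i) l
    have hq2 := Nat.mod_lt (n'*i) hl
    have hq3 : n'*i % l ≠ 0 := fun h => hnd (Nat.dvd_of_mod_eq_zero h)
    rw [← hq] at hq1
    have hle : q + 1 ≤ 2*i := by
      by_contra hcon
      have : 2*i ≤ q := by omega
      have : l*(2*i) ≤ l*q := Nat.mul_le_mul_left _ this
      nlinarith [Nat.pos_of_ne_zero hq3]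
    have : n*i/l = 2*i - (q+1) := by
      rw [Nat.div_eq_iff hl]
      obtain ⟨c, hc⟩ := Nat.exists_eq_add_of_le hle
      rw [hc] at e ⊢
      rw [show q+1+c-(q+1) = c by omega]
      have e2 : (q+1+c)*l = l*q + l + c*l := by ring
      have e3 : (c+1)*l = c*l + l := by ring
      constructor
      · have := Nat.pos_of_ne_zero hq3; omega
      · have := Nat.pos_of_ne_zero hq3; omega
    omega
  rw [this]; exact even_two_mul _

theorem cc_recip (H : ℕ → ℕ) (hH : Hgood H) (n l : ℕ) (hn : 0 < n) (hl : 0 < l) (hc : Nat.Coprime n l) :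
    cc H n l + cc H l n = H l * H n := by
  have key : ∀ n l : ℕ, 0 < n → 0 < l → cc H n l = ∑ i ∈ Finset.Icc 1 (H l), ∑ j ∈ Finset.Icc 1 (H n), if j*l ≤ n*i then 1 else 0 := by
    intro n l hn hl
    unfold cc
    apply Finset.sum_congr rfl
    intro i hi
    rw [Finset.mem_Icc] at hi
    rw [← Finset.sum_filter]
    have : (Finset.Icc 1 (H n)).filter (fun j => j*l ≤ n*i) = Finset.Icc 1 (n*i/l) := by
      ext j
      simp only [Finset.mem_filter, Finset.mem_Icc, Nat.le_div_iff_mul_le hl]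
      constructor
      · rintro ⟨⟨h1, h2⟩, h3⟩; exact ⟨h1, h3⟩
      · rintro ⟨h1, h3⟩; exact ⟨⟨h1, hH.mono n l i j hl h3 hi.2⟩, h3⟩
    rw [this]; simp
  rw [key n l hn hl, key l n hl hn, Finset.sum_comm (s := Finset.Icc 1 (H n)), ← Finset.sum_add_distrib]
  have : ∀ i ∈ Finset.Icc 1 (H l), (∑ j ∈ Finset.Icc 1 (H n), (if j*l ≤ n*i then 1 else 0)) + (∑ j ∈ Finset.Icc 1 (H n), if i*n ≤ l*j then 1 else 0) = H n := by
    intro i hi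
    rw [Finset.mem_Icc] at hi
    rw [← Finset.sum_add_distrib]
    have : ∀ j ∈ Finset.Icc 1 (H n), ((if j*l ≤ n*i then 1 else 0) + if i*n ≤ l*j then 1 else 0) = 1 := by
      intro j hj
      rw [Finset.mem_Icc] at hj
      have hne : j*l ≠ n*i := by
        intro h
        have : l ∣ n*i := ⟨j, by rw [← h]; ring⟩
        have := Nat.le_of_dvd (by omega) (hc.symm.dvd_of_dvd_mul_left this)
        have := hH.lt l hl
        omega
      rw [mul_comm i n, mul_comm l j]
      split_ifs <;> omega
    rw [Finset.sum_congr rfl this]; simp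
  rw [Finset.sum_congr rfl this]; simp
end

section
open NumberTheorySymbols

theorem neg_one_pow_congr' (m n : ℕ) (h : Even (m + n)) : (-1:ℤ)^m = (-1)^n := by
  rw [Nat.even_add] at h
  rcases Nat.even_or_odd m with hm | hm
  · rw [hm.neg_one_pow, (h.1 hm).neg_one_pow]
  · have : Odd n := by
      rw [← Nat.not_even_iff_odd] at hm ⊢; tauto
    rw [hm.neg_one_pow, this.neg_one_pow]

theorem parity_aux (A B Hi Hj qi qj c1 c2 c3 c4 : ℕ) (hAi2 : Even (A + (Hi + qi))) (hAj2 : Even (B + (Hj + qj)))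
    (r1 : Even (c1+c2) ↔ Even (Hj*Hi)) (r2 : Even (c3+c4) ↔ Even (qj*qi)) :
    Even (B*Hi + A*B + A*Hj + (c2+c4) + (c1+c3)) := by
  simp only [Nat.even_add, Nat.even_mul] at hAi2 hAj2 r1 r2 ⊢
  by_cases h1 : Even Hi <;> by_cases h2 : Even Hj <;> by_cases h3 : Even qi <;> by_cases h4 : Even qj <;>
  simp only [h1, h2, h3, h4, iff_true, iff_false, true_or, or_true, false_or, or_false, true_iff, false_iff, not_true, not_false_iff, not_not] at hAi2 hAj2 r1 r2 ⊢ <;>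
  simp only [hAi2, hAj2, r1, r2, not_not, or_true, true_or, or_false, false_or, iff_true, true_iff, iff_false, false_iff] <;> tauto

section recip
variable (V : ℤ) (y : ℕ) (H : ℕ → ℕ) (χ : ℤ)

theorem natAbs_sign (hsgn : ∀ j, 0 ≤ (-1:ℤ)^(H (2*j+1)) * uu V y j) (j : ℕ) :
    uu V y j = (-1:ℤ)^(H (2*j+1)) * (uu V y j).natAbs := by
  have h := hsgn j
  have h1 : ((uu V y j).natAbs : ℤ) = |uu V y j| := Int.natCast_natAbs _
  rw [h1]
  rcases neg_one_pow_eq_or ℤ (H (2*j+1)) with e | e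
  · rw [e] at h ⊢; rw [one_mul] at h ⊢; rw [abs_of_nonneg h]
  · rw [e] at h ⊢; rw [abs_of_nonpos (by linarith)]; ring

theorem uu_mod4' (V y : ℤ) (hV : V % 4 = 0) (hy : y % 4 = 1) (j : ℕ) : uu V y j % 4 = (-1)^(j/2) % 4 := by
  have h := uu_mod4 V y hV hy (j/4)
  have : j = 4*(j/4) ∨ j = 4*(j/4)+1 ∨ j = 4*(j/4)+2 ∨ j = 4*(j/4)+3 := by omega
  rcases this with e | e | e | e
  · have e2 : j/2 = 2*(j/4) := by omega
    rw [e2, (even_two_mul _).neg_one_pow, e]; omega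
  · have e2 : j/2 = 2*(j/4) := by omega
    rw [e2, (even_two_mul _).neg_one_pow, e]; omega
  · have e2 : j/2 = 2*(j/4)+1 := by omega
    rw [e2, (odd_two_mul_add_one _).neg_one_pow, e]; omega
  · have e2 : j/2 = 2*(j/4)+1 := by omega
    rw [e2, (odd_two_mul_add_one _).neg_one_pow, e]; omega

theorem natAbs_half (hV : V % 4 = 0) (hy : y % 4 = 1) (hsgn : ∀ j, 0 ≤ (-1:ℤ)^(H (2*j+1)) * uu V y j) (j : ℕ) :
    (uu V y j).natAbs % 2 = 1 ∧ Even ((uu V y j).natAbs/2 + (H (2*j+1) + j/2)) := by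
  have h1 := natAbs_sign V y H hsgn j
  have h2 := uu_mod4' V y hV (by omega) j
  generalize (uu V y j).natAbs = A at h1 ⊢
  generalize uu V y j = u at h1 h2
  rcases Nat.even_or_odd (H (2*j+1)) with e1 | e1 <;> rcases Nat.even_or_odd (j/2) with e2 | e2
  · rw [e1.neg_one_pow] at h1; rw [e2.neg_one_pow] at h2
    have : A % 4 = 1 := by omega
    refine ⟨by omega, Even.add ?_ (Even.add e1 e2)⟩; rw [Nat.even_iff]; omega
  · rw [e1.neg_one_pow] at h1; rw [e2.neg_one_pow] at h2
    have : A % 4 = 3 := by omega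
    refine ⟨by omega, Odd.add_odd ?_ (Even.add_odd e1 e2)⟩; rw [Nat.odd_iff]; omega
  · rw [e1.neg_one_pow] at h1; rw [e2.neg_one_pow] at h2
    have : A % 4 = 3 := by omega
    refine ⟨by omega, Odd.add_odd ?_ (Odd.add_even e1 e2)⟩; rw [Nat.odd_iff]; omega
  · rw [e1.neg_one_pow] at h1; rw [e2.neg_one_pow] at h2
    have : A % 4 = 1 := by omega
    refine ⟨by omega, Even.add ?_ (Odd.add_odd e1 e2)⟩; rw [Nat.even_iff]; omega

theorem J_neg_one (A : ℕ) (hA : A % 2 = 1) : J(-1 | A) = (-1)^(A/2) := by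
  rw [jacobiSym.at_neg_one (Nat.odd_iff.2 hA), ZMod.χ₄_eq_neg_one_pow hA]

theorem J_neg_one_pow (A n : ℕ) (hA : A % 2 = 1) : J((-1)^n | A) = (-1)^(A/2*n) := by
  rw [jacobiSym.pow_left, J_neg_one A hA, pow_mul]

theorem uu_mod_y (V y : ℤ) (j : ℕ) : y ∣ uu V y j - V^j ∧ y ∣ uu V y (j+1) - V^(j+1) := by
  induction j with
  | zero => simp [uu]
  | succ j ih =>
    refine ⟨ih.2, ?_⟩
    rw [uu_succ]
    have : V * uu V y (j+1) - y^2*uu V y j - V^(j+1+1) = V * (uu V y (j+1) - V^(j+1)) - y*(y * uu V y j) := by ring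
    rw [this]
    exact dvd_sub (Dvd.dvd.mul_left ih.2 _) (dvd_mul_right _ _)

theorem J_congr (a b : ℤ) (n : ℕ) (h : (n:ℤ) ∣ a - b) : J(a | n) = J(b | n) := by
  exact jacobiSym.mod_left' ((Int.emod_emod_of_dvd a dvd_rfl).symm.trans (by rw [Int.emod_emod_of_dvd a dvd_rfl]; exact ((Int.modEq_iff_dvd).2 h).symm))

theorem J_y (hV : V % 4 = 0) (hy : y % 4 = 1) (hJ : J(V | y) = χ)
    (hsgn : ∀ j, 0 ≤ (-1:ℤ)^(H (2*j+1)) * uu V y j) (j : ℕ) : J(y | (uu V y j).natAbs) = χ^j ∧ J(uu V y j | y) = χ^j := by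
  have hA := (natAbs_half V y H hV hy hsgn j).1
  have h1 : J(uu V y j | y) = χ^j := by
    rw [J_congr _ _ y (uu_mod_y V y j).1, jacobiSym.pow_left, hJ]
  refine ⟨?_, h1⟩
  rw [jacobiSym.quadratic_reciprocity_one_mod_four hy (Nat.odd_iff.2 hA), ← h1]
  conv_rhs => rw [natAbs_sign V y H hsgn j]
  rw [jacobiSym.mul_left, J_neg_one_pow y _ (by omega)]
  have : Even (y/2 * H (2*j+1)) := by
    apply Even.mul_right; rw [Nat.even_iff]; omega
  rw [this.neg_one_pow, one_mul]

theorem main_recip (hH : Hgood H) (hV : V % 4 = 0) (hy : y % 4 = 1) (hJ : J(V | y) = χ) (hχ : χ^2 = 1)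
    (hsgn : ∀ j, 0 ≤ (-1:ℤ)^(H (2*j+1)) * uu V y j) (M : ℕ) : ∀ i j, (2*i+1) + 2*(2*j+1) = M → Nat.Coprime (2*i+1) (2*j+1) →
    J(uu V y i | (uu V y j).natAbs) = χ^(i*j) * (-1)^(cc H (2*i+1) (2*j+1) + cc (fun l => l/4) (2*i+1) (2*j+1)) := by
  induction M using Nat.strong_induction_on with
  | _ M ih =>
  intro i j hM hc
  have hQ := Hgood_quarter
  set Q : ℕ → ℕ := fun l => l/4 with hQdef
  obtain ⟨hAj, hAj2⟩ := natAbs_half V y H hV hy hsgn j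
  obtain ⟨hAi, hAi2⟩ := natAbs_half V y H hV hy hsgn i
  have hQj : Q (2*j+1) = j/2 := by simp only [hQdef]; omega
  have hQi : Q (2*i+1) = i/2 := by simp only [hQdef]; omega
  have hχpow : ∀ m n : ℕ, Even (m+n) → χ^m = χ^n := by
    intro m n h
    have hχ' : χ = 1 ∨ χ = -1 := by
      have : (χ-1)*(χ+1) = 0 := by linear_combination hχ
      rcases mul_eq_zero.1 this with h | h
      · left; linarith
      · right; linarith
    rcases hχ' with h' | h'
    · rw [h']; simp
    · rw [h']; exact neg_one_pow_congr' m n h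
  rcases Nat.lt_trichotomy i j with hij | hij | hij
  · -- swap
    have e := ih _ (by omega) j i rfl hc.symm
    have r := cc_recip H hH _ _ (by omega) (by omega) hc
    have r' := cc_recip Q hQ _ _ (by omega) (by omega) hc
    set c1 := cc H (2*i+1) (2*j+1)
    set c2 := cc H (2*j+1) (2*i+1)
    set c3 := cc Q (2*i+1) (2*j+1)
    set c4 := cc Q (2*j+1) (2*i+1)
    rw [hQj, hQi] at r'
    set A := (uu V y i).natAbs with hA
    set B := (uu V y j).natAbs with hB
    rw [natAbs_sign V y H hsgn j, ← hB, jacobiSym.mul_left, J_neg_one_pow A _ hAi] at e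
    rw [natAbs_sign V y H hsgn i, ← hA, jacobiSym.mul_left, J_neg_one_pow B _ hAj,
      jacobiSym.quadratic_reciprocity (Nat.odd_iff.2 hAi) (Nat.odd_iff.2 hAj)]
    have e' : J((B:ℤ) | A) = (-1)^(A/2*H (2*j+1)) * (χ^(j*i) * (-1)^(c2+c4)) := by
      rw [← e, ← mul_assoc, ← pow_add, (even_two_mul _ |> fun h => by rw [← two_mul]; exact h : Even (A/2*H (2*j+1) + A/2*H (2*j+1))).neg_one_pow, one_mul]
    rw [e', mul_comm j i]
    have : (-1:ℤ)^(B/2*H (2*i+1)) * ((-1)^(A/2*(B/2)) * ((-1)^(A/2*H (2*j+1)) * (χ^(i*j) * (-1)^(c2+c4)))) =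
       χ^(i*j) * (-1)^(B/2*H (2*i+1) + A/2*(B/2) + A/2*H (2*j+1) + (c2+c4)) := by ring
    rw [this]
    congr 1
    apply neg_one_pow_congr'
    have r1 : Even (c1+c2) ↔ Even (H (2*j+1) * H (2*i+1)) := by rw [r]
    have r2 : Even (c3+c4) ↔ Even (j/2 * (i/2)) := by rw [r']
    exact parity_aux _ _ _ _ _ _ _ _ _ _ hAi2 hAj2 r1 r2
  · subst hij
    have : 2*i+1 = 1 := by simpa using hc
    have : i = 0 := by omega
    subst this
    have e1 : cc H 1 1 = 0 := by
      have := hH.lt 1 (by norm_num)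
      unfold cc; rw [show H 1 = 0 by omega]; simp
    have e2 : cc Q 1 1 = 0 := by
      have := hQ.lt 1 (by norm_num)
      unfold cc; rw [show Q 1 = 0 by omega]; simp
    simp [uu_zero, e1, e2]
  · rcases Nat.lt_or_ge (2*j) i with h2 | h2
    · obtain ⟨i', rfl⟩ : ∃ i', i = i'+2*j+1 := ⟨i-2*j-1, by omega⟩
      have hn : 2*(i'+2*j+1)+1 = (2*i'+1) + 2*(2*j+1) := by ring
      have hc' : Nat.Coprime (2*i'+1) (2*j+1) := by
        rw [hn] at hc; simpa using hc
      have e := ih _ (by omega) i' j rfl hc'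
      have hd : (((uu V y j).natAbs : ℕ):ℤ) ∣ uu V y (i'+2*j+1) - y^(2*j+1) * uu V y i' :=
        Int.natAbs_dvd.2 (uu_dvd_D V y j i').1
      rw [J_congr _ _ _ hd, jacobiSym.mul_left, jacobiSym.pow_left, (J_y V y H χ hV hy hJ hsgn j).1, e, hn]
      have p1 := cc_add H (2*i'+1) (2*j+1) (by omega)
      have p2 := cc_add Q (2*i'+1) (2*j+1) (by omega)
      have e3 : (-1:ℤ)^(cc H (2*i'+1) (2*j+1) + cc Q (2*i'+1) (2*j+1)) = (-1)^(cc H (2*i'+1+2*(2*j+1)) (2*j+1) + cc Q (2*i'+1+2*(2*j+1)) (2*j+1)) := by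
        apply neg_one_pow_congr'
        simp only [Nat.even_add] at p1 p2 ⊢; tauto
      rw [e3, ← mul_assoc, ← pow_mul, ← pow_add]
      congr 1
      apply hχpow
      have : j * (2*j+1) + i'*j + (i'+2*j+1)*j = 2*(2*j^2+j+i'*j) := by ring
      rw [this]; exact even_two_mul _
    · obtain ⟨t, rfl⟩ : ∃ t, i = j + t := ⟨i-j, by omega⟩
      obtain ⟨s, rfl⟩ : ∃ s, j = s + t := ⟨j-t, by omega⟩
      have hn : (2*(s+t+t)+1) + (2*s+1) = 2*(2*(s+t)+1) := by ring
      have hc' : Nat.Coprime (2*s+1) (2*(s+t)+1) := by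
        have h1 : Nat.Coprime (2*(2*(s+t)+1) - (2*(s+t+t)+1)) (2*(s+t)+1) := by
          rw [Nat.coprime_comm]
          have := hc.symm
          rw [Nat.coprime_iff_gcd_eq_one] at this ⊢
          have g1 := Nat.gcd_dvd_left (2*(s+t)+1) (2*(2*(s+t)+1) - (2*(s+t+t)+1))
          have g2 := Nat.gcd_dvd_right (2*(s+t)+1) (2*(2*(s+t)+1) - (2*(s+t+t)+1))
          have g3 := Nat.dvd_sub (Dvd.dvd.mul_left g1 2) g2
          rw [Nat.sub_sub_self (by omega)] at g3
          have g4 := Nat.dvd_gcd g1 g3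
          rw [this] at g4
          exact Nat.dvd_one.1 g4
        rwa [show 2*(2*(s+t)+1) - (2*(s+t+t)+1) = 2*s+1 by omega] at h1
      have e := ih _ (by omega) s (s+t) rfl hc'
      have hd : (((uu V y (s+t)).natAbs : ℕ):ℤ) ∣ uu V y (s+t+t) - ((-1) * ((y^t)^2 * uu V y s)) := by
        apply Int.natAbs_dvd.2
        have := uu_dvd_E' V y (s+t) t (by omega)
        rw [show s + t - t = s by omega] at this
        convert this using 1; ring
      rw [J_congr _ _ _ hd, jacobiSym.mul_left, jacobiSym.mul_left, jacobiSym.pow_left, jacobiSym.pow_left, (J_y V y H χ hV hy hJ hsgn (s+t)).1, e, J_neg_one _ hAj]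
      have p1 := cc_sub H hH _ _ (2*(s+t)+1) (by omega) hn hc'
      have p2 := cc_sub Q hQ _ _ (2*(s+t)+1) (by omega) hn hc'
      rw [hQj] at p2
      have e4 : ((χ^(s+t))^t)^2 = 1 := by
        have : ((χ^(s+t))^t)^2 = (χ^2)^((s+t)*t) := by ring
        rw [this, hχ, one_pow]
      rw [e4, one_mul]
      have e5 : χ^((s+t+t)*(s+t)) = χ^(s*(s+t)) := by
        apply hχpow
        have : (s+t+t)*(s+t) + s*(s+t) = 2*((s+t)*(s+t)) := by ring
        rw [this]; exact even_two_mul _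
      rw [e5]
      have : ∀ m n : ℕ, (-1:ℤ)^m * (χ^(s*(s+t)) * (-1)^n) = χ^(s*(s+t)) * (-1)^(m+n) := by intros; ring
      rw [this]
      congr 1
      apply neg_one_pow_congr'
      rw [Nat.even_iff] at p1 p2 hAj2 ⊢
      omega
end recip
end

section
open NumberTheorySymbols

theorem block_sum (p K n i0 : ℕ) (hK : 0 < K) (hp : 0 < p) (hc : Nat.Coprime p K) (hn : n * K % p = 1 % p) (h1 : i0 + K ≤ p) :
    2 * ∑ i ∈ Finset.range K, (n * (i0 + i) % p) = 2 * i0 + (K-1) * (p+1) := by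
  have key : ∀ i ∈ Finset.range K, ∃ c, c < K ∧ K * (n * (i0+i) % p) = (i0 + i) + p * c := by
    intro i hi
    have hi' := Finset.mem_range.1 hi
    set r := n * (i0+i) % p with hr
    have hrp : r < p := Nat.mod_lt _ hp
    have e1 : K * r ≡ i0 + i [MOD p] := by
      have : r ≡ n * (i0+i) [MOD p] := Nat.mod_modEq _ _
      have h2 : n * K ≡ 1 [MOD p] := hn
      calc K * r ≡ K * (n*(i0+i)) [MOD p] := this.mul_left K
        _ = (n*K) * (i0+i) := by ring
        _ ≡ 1 * (i0+i) [MOD p] := h2.mul_right _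
        _ = i0 + i := one_mul _
    have e2 : (K*r) % p = i0 + i := by
      rw [e1]; exact Nat.mod_eq_of_lt (by omega)
    refine ⟨K*r/p, ?_, ?_⟩
    · rw [Nat.div_lt_iff_lt_mul hp]
      exact (Nat.mul_lt_mul_left hK).2 hrp
    · have := Nat.mod_add_div (K*r) p
      omega
  choose! c hc1 hc2 using key
  have hinj : Set.InjOn c (Finset.range K : Set ℕ) := by
    intro i hi j hj hij
    have hi' := Finset.mem_coe.1 hi
    have hj' := Finset.mem_coe.1 hj
    have ei := hc2 i hi'
    have ej := hc2 j hj'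
    have : i0 + i + p * c i ≡ i0 + j + p * c i [MOD K] := by
      rw [← ei, hij, ← ej]
      exact (Nat.modEq_zero_iff_dvd.2 (dvd_mul_right _ _)).trans (Nat.modEq_zero_iff_dvd.2 (dvd_mul_right _ _)).symm
    have h2 : i ≡ j [MOD K] := by
      have := Nat.ModEq.add_right_cancel' _ this
      exact Nat.ModEq.add_left_cancel' _ this
    exact Nat.ModEq.eq_of_lt_of_lt h2 (Finset.mem_range.1 hi') (Finset.mem_range.1 hj')
  have himg : (Finset.range K).image c = Finset.range K := by
    apply Finset.eq_of_subset_of_card_le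
    · intro x hx
      obtain ⟨i, hi, rfl⟩ := Finset.mem_image.1 hx
      exact Finset.mem_range.2 (hc1 i hi)
    · rw [Finset.card_image_of_injOn hinj]
  have hsum : ∑ i ∈ Finset.range K, c i = ∑ i ∈ Finset.range K, i := by
    conv_rhs => rw [← himg]
    rw [Finset.sum_image hinj]
  have hG := Finset.sum_range_id_mul_two K
  have hs : K * ∑ i ∈ Finset.range K, (n * (i0 + i) % p) = K * i0 + (1 + p) * ∑ i ∈ Finset.range K, i := by
    rw [Finset.mul_sum, Finset.sum_congr rfl hc2, Finset.sum_add_distrib, Finset.sum_add_distrib, ← Finset.mul_sum, hsum]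
    simp; ring
  apply Nat.eq_of_mul_eq_mul_left hK
  calc K * (2 * ∑ i ∈ Finset.range K, (n * (i0 + i) % p)) = 2 * (K * ∑ i ∈ Finset.range K, (n * (i0 + i) % p)) := by ring
    _ = 2 * K * i0 + (1+p) * ((∑ i ∈ Finset.range K, i) * 2) := by rw [hs]; ring
    _ = 2 * K * i0 + (1+p) * (K * (K-1)) := by rw [hG]
    _ = _ := by ring

theorem floor_parity (n p i : ℕ) (hn : n % 2 = 1) (hp : p % 2 = 1) : (n * i / p) % 2 = (i + n * i % p) % 2 := by
  have h := Nat.div_add_mod (n*i) p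
  obtain ⟨n', rfl⟩ : ∃ k, n = 2*k+1 := ⟨n/2, by omega⟩
  obtain ⟨p', rfl⟩ : ∃ k, p = 2*k+1 := ⟨p/2, by omega⟩
  generalize (2*n'+1)*i / (2*p'+1) = a at *
  generalize (2*n'+1)*i % (2*p'+1) = b at *
  have : 2*(p'*a) + a + b = 2*(n'*i) + i := by linarith
  omega

theorem sum_parity (f g : ℕ → ℕ) (t : ℕ) (h : ∀ i < t, f i % 2 = g i % 2) :
    (∑ i ∈ Finset.range t, f i) % 2 = (∑ i ∈ Finset.range t, g i) % 2 := by
  rw [Finset.sum_nat_mod, Finset.sum_congr rfl (fun i hi => h i (Finset.mem_range.1 hi)), ← Finset.sum_nat_mod]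

/-- the combinatorial core -/
theorem comb_core (p L t : ℕ) (hp3 : 3 < p) (hpo : p % 2 = 1) (hLt : 2*(L + t) < p) 
    (hL : t % 2 = 0 → (L + 1 + (p+1)/2) % 2 = 1)
    (hall : ∀ n, n % 2 = 1 → Nat.Coprime n p → (∑ i ∈ Finset.range t, n * (L+1+i) / p) % 2 = 0) : t = 0 := by
  have h2 : t % 2 = 0 := by
    have h := hall (2*p-1) (by omega) (by
      have : Nat.Coprime (2*p-1) (2*p) := by
        have := Nat.coprime_self_sub_left (n := 2*p) (m := 1) (by omega)
        simpa using this
      exact this.coprime_mul_left_right)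
    rw [sum_parity _ (fun _ => 1) t] at h
    · simpa using h
    · intro i hi
      have : (2*p-1) * (L+1+i) / p = 2*(L+1+i)-1 := by
        obtain ⟨s, hs⟩ : ∃ s, L+1+i = s+1 := ⟨L+i, by ring⟩
        obtain ⟨P, hP⟩ : ∃ P, p = P + 1 := ⟨p-1, by omega⟩
        rw [hs, show 2*(s+1)-1 = 2*s+1 by omega, show 2*p-1 = 2*P+1 by omega, hP]
        apply Nat.div_eq_of_lt_le
        · have : s ≤ P := by omega
          nlinarith
        · nlinarith
      rw [this]; simp; omega
  have h4 : t % 4 = 0 := by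
    have h := hall (p-2) (by omega) (by
        have : Nat.Coprime 2 p := (Nat.coprime_two_left).2 (Nat.odd_iff.2 hpo)
        have := Nat.coprime_self_sub_left (n := p) (m := 2) (by omega)
        rw [this]; exact (Nat.coprime_two_left).2 (Nat.odd_iff.2 hpo))
    rw [Finset.sum_congr rfl (g := fun i => L + i)] at h
    · rw [Finset.sum_add_distrib] at h
      have hG := Finset.sum_range_id_mul_two t
      simp at h
      obtain ⟨T, rfl⟩ : ∃ T, t = 2*T := ⟨t/2, by omega⟩
      have hG2 : (∑ i ∈ Finset.range (2*T), i) = T * (2*T-1) := by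
        have : 2*T*(2*T-1) = T*(2*T-1)*2 := by ring
        omega
      rw [hG2] at h
      rcases Nat.eq_zero_or_pos T with h0 | h0
      · omega
      · obtain ⟨U, rfl⟩ : ∃ U, T = U+1 := ⟨T-1, by omega⟩
        have e : (U+1) * (2*(U+1)-1) = 2*((U+1)*U) + (U+1) := by
          rw [show 2*(U+1)-1 = 2*U+1 by omega]; ring
        rw [e, show 2*(U+1)*L = 2*((U+1)*L) by ring] at h
        omega
    · intro i hi
      have hi' := Finset.mem_range.1 hi
      obtain ⟨P, hP⟩ : ∃ P, p = P + 2 := ⟨p-2, by omega⟩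
      rw [show L+1+i = L+i+1 by ring, hP, Nat.add_sub_cancel]
      apply Nat.div_eq_of_lt_le
      · have : 2*(L+i+1) ≤ P+2 := by omega
        nlinarith
      · nlinarith
  have hk : ∀ k, 2^(k+2) ∣ t := by
    intro k
    induction k with
    | zero => exact Nat.dvd_of_mod_eq_zero (by simpa using h4)
    | succ k ih =>
      obtain ⟨T, hT⟩ := ih
      set K := 2^(k+2) with hKdef
      have hK4 : K = 4 * 2^k := by rw [hKdef, pow_add]; ring
      have hKpos : 0 < 2^k := by positivity
      rcases Nat.eq_zero_or_pos T with h0 | h0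
      · rw [hT, h0]; simp
      have hKt : K ≤ t := by rw [hT]; exact Nat.le_mul_of_pos_right _ h0
      have hcop : Nat.Coprime p K := by
        rw [hKdef]; apply Nat.Coprime.pow_right; exact (Nat.coprime_two_right).2 (Nat.odd_iff.2 hpo)
      obtain ⟨n, hn2, hnK⟩ : ∃ n, n % 2 = 1 ∧ n * K % p = 1 % p := by
        obtain ⟨n0, hn0⟩ := Nat.exists_mul_mod_eq_one_of_coprime hcop.symm (by omega)
        rcases Nat.mod_two_eq_zero_or_one n0 with h | h
        · refine ⟨n0 + p, by omega, ?_⟩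
          rw [add_mul, Nat.add_mul_mod_self_left, mul_comm, hn0.2, Nat.mod_eq_of_lt (by omega)]
        · refine ⟨n0, h, ?_⟩
          rw [mul_comm, hn0.2, Nat.mod_eq_of_lt (by omega)]
      have hnp : Nat.Coprime n p := by
        have : (n*K) ≡ 1 [MOD p] := hnK
        have h3 : Nat.Coprime (n*K) p := by
          have := this.gcd_eq; rw [Nat.gcd_one_left] at this; exact this
        exact h3.coprime_mul_right
      have h := hall n hn2 hnp
      rw [sum_parity _ (fun i => (L+1+i) + n * (L+1+i) % p) t (fun i _ => floor_parity _ _ _ hn2 hpo), Finset.sum_add_distrib] at h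
      have hs1 : (∑ i ∈ Finset.range t, (L+1+i)) % 2 = 0 := by
        rw [Finset.sum_add_distrib]
        have hG := Finset.sum_range_id_mul_two t
        obtain ⟨W, rfl⟩ : ∃ T, t = 4*T := ⟨t/4, by omega⟩
        have hG2 : (∑ i ∈ Finset.range (4*W), i) = 2*(W * (4*W-1)) := by
          have : 4*W*(4*W-1) = 2*(W*(4*W-1))*2 := by ring
          omega
        rw [hG2]; simp
        rw [show 4*W*(L+1) = 2*(2*W*(L+1)) by ring]; omega
      have hs2 : (∑ i ∈ Finset.range t, (n * (L+1+i) % p)) = ∑ b ∈ Finset.range T, ∑ i ∈ Finset.range K, (n * ((L+1+K*b)+i) % p) := by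
        rw [hT]
        clear h hs1 hT h0 hKt
        induction T with
        | zero => simp
        | succ T ih => 
          rw [Finset.sum_range_succ, ← ih, mul_add, mul_one, Finset.sum_range_add]
          congr 1
          apply Finset.sum_congr rfl; intro i _; rw [← add_assoc (L+1)]
      rw [hs2] at h
      have hb : ∀ b < T, (∑ i ∈ Finset.range K, (n * ((L+1+K*b)+i) % p)) % 2 = 1 % 2 := by
        intro b hb
        have hbK : K * b + K ≤ t := by
          rw [hT]; calc K*b+K = K*(b+1) := by ring
            _ ≤ K * T := by gcongr; omega
        have := block_sum p K n (L+1+K*b) (by omega) (by omega) hcop hnK (by omega)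
        have hL' := hL h2
        obtain ⟨P, hP⟩ : ∃ P, p + 1 = 2 * P := ⟨(p+1)/2, by omega⟩
        rw [hP] at hL' this
        have e : (K-1) * (2*P) = 2*(2*((2*2^k-1)*P) + P) := by
          rw [show K - 1 = 2*(2*2^k-1)+1 by omega]; ring
        rw [e] at this
        have e2 : K * b = 2*(2*2^k*b) := by rw [hK4]; ring
        omega
      have h5 := sum_parity _ _ T hb
      simp at h5
      have hTe : T % 2 = 0 := by omega
      rw [hT]
      obtain ⟨U, rfl⟩ : ∃ U, T = 2*U := ⟨T/2, by omega⟩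
      exact ⟨U, by rw [hKdef]; ring⟩
  by_contra h0
  have := Nat.le_of_dvd (by omega) (hk t)
  have h3 : t < 2^(t+2) := lt_trans (Nat.lt_two_pow_self) (Nat.pow_lt_pow_right (by norm_num) (by omega))
  omega

theorem comb (p h : ℕ) (hp3 : 3 < p) (hp8 : p % 8 = 3 ∨ p % 8 = 5) (hh : 2*h < p)
    (hall : ∀ n, n % 2 = 1 → Nat.Coprime n p → 
      Even (∑ i ∈ Finset.Icc 1 h, n * i / p + ∑ i ∈ Finset.Icc 1 (p/4), n * i / p)) : h = p/4 := by
  have hI : ∀ (n k : ℕ), ∑ i ∈ Finset.Icc 1 k, n * i / p = ∑ i ∈ Finset.range k, n * (i+1)/p := by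
    intro n k
    rw [Finset.range_eq_Ico, Finset.sum_Ico_add' (fun i => n * i / p) 0 k 1]
    rfl
  rcases le_total h (p/4) with hle | hle
  · obtain ⟨t, ht⟩ := Nat.exists_eq_add_of_le hle
    have := comb_core p h t hp3 (by omega) (by omega) (by omega) (by
      intro n hn hc
      have e := hall n hn hc
      rw [hI, hI, ht, Finset.sum_range_add, Nat.even_iff] at e
      have : ∑ i ∈ Finset.range t, n * (h+1+i)/p = ∑ i ∈ Finset.range t, n * (h+i+1)/p := by
        apply Finset.sum_congr rfl; intro i _; rw [show h+1+i = h+i+1 by ring]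
      omega)
    omega
  · obtain ⟨t, ht⟩ := Nat.exists_eq_add_of_le hle
    have := comb_core p (p/4) t hp3 (by omega) (by omega) (by omega) (by
      intro n hn hc
      have e := hall n hn hc
      rw [hI, hI, ht, Finset.sum_range_add, Nat.even_iff] at e
      have : ∑ i ∈ Finset.range t, n * (p/4+1+i)/p = ∑ i ∈ Finset.range t, n * (p/4+i+1)/p := by
        apply Finset.sum_congr rfl; intro i _; rw [show p/4+1+i = p/4+i+1 by ring]
      omega)
    omega
end

section
open NumberTheorySymbols

theorem partB (y p : ℕ) (a b : ℤ) (ha : 0 < a) (hb : 0 < b) (hao : Odd a) (hbo : Odd b) (hab : IsCoprime a b)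
    (hy : a^2 + b^2 = 2*(y:ℤ)) (hp : 11 ≤ p)
    (h : (p % 8 = 5 ∧ uu (a^2-b^2) y ((p-1)/2) = -1) ∨ (p % 8 = 3 ∧ uu (a^2-b^2) y ((p-1)/2) = 1)) :
    ∃ κ : ℕ, (κ = 1 ∨ κ = 3) ∧
      |(p:ℝ) * |Real.arctan (b/a) - Real.pi/4| - κ * (Real.pi/4)| ≤ Real.pi/2 / (y:ℝ)^((p-1)/2) := by
  obtain ⟨a', ha'⟩ := hao
  obtain ⟨b', hb'⟩ := hbo
  have e1 : a^2 = 4*(a'*(a'+1)) + 1 := by rw [ha']; ring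
  have e2 : b^2 = 4*(b'*(b'+1)) + 1 := by rw [hb']; ring
  obtain ⟨a2, ha2⟩ := Int.even_mul_succ_self a'
  obtain ⟨b2, hb2⟩ := Int.even_mul_succ_self b'
  have hy4 : y % 4 = 1 := by omega
  have hyodd : y % 2 = 1 := by omega
  set V : ℤ := a^2 - b^2 with hVdef
  have hV4 : V % 4 = 0 := by omega
  have haR : (0:ℝ) < a := by exact_mod_cast ha
  have hbR : (0:ℝ) < b := by exact_mod_cast hb
  have hyR : (a:ℝ)^2 + (b:ℝ)^2 = 2*(y:ℝ) := by exact_mod_cast hy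
  have hypos : (0:ℝ) < y := by nlinarith [sq_nonneg (a:ℝ), pow_pos haR 2, pow_pos hbR 2]
  set θ := Real.arctan (b/a) with hθ
  have hθ0 : 0 < θ := by rw [hθ]; exact Real.arctan_pos.2 (by positivity)
  have hθ1 : θ < Real.pi/2 := Real.arctan_lt_pi_div_two _
  have hπ := Real.pi_pos
  have hcos : (V:ℝ) = 2*((y:ℤ):ℝ)*Real.cos (2*θ) := by
    rw [Real.cos_two_mul, hθ, Real.cos_sq_arctan]
    push_cast
    rw [show (y:ℝ) = ((a:ℝ)^2 + (b:ℝ)^2)/2 by linarith]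
    have : (V:ℝ) = (a:ℝ)^2 - (b:ℝ)^2 := by rw [hVdef]; push_cast; ring
    rw [this]
    field_simp
    ring
  have hsin0 : 0 < Real.sin θ := Real.sin_pos_of_pos_of_lt_pi hθ0 (by linarith)
  set x := θ / Real.pi with hx
  have hx0 : 0 ≤ x := by positivity
  have hx1 : x < 1/2 := by rw [hx, div_lt_iff₀ hπ]; linarith
  have hxθ : Real.pi * x = θ := by rw [hx]; field_simp
  set H : ℕ → ℕ := fun l => ⌊(l:ℝ)*x⌋₊ with hH
  have hHg : Hgood H := Hgood_floor x hx0 (by linarith)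
  have hsgn : ∀ j, 0 ≤ (-1:ℤ)^(H (2*j+1)) * uu V y j := by
    intro j
    have t := (uu_trig V y θ hcos j).1
    have s := sign_floor (((2*j+1:ℕ):ℝ)*x) (by positivity)
    have e : Real.pi * (((2*j+1:ℕ):ℝ)*x) = (2*j+1)*θ := by rw [← hxθ]; push_cast; ring
    rw [e] at s
    have : 0 ≤ ((-1:ℝ)^(H (2*j+1)) * uu V y j) * Real.sin θ := by
      rw [mul_assoc, t]
      have : (-1:ℝ)^(H (2*j+1)) * (((y:ℤ):ℝ)^j * Real.sin ((2*j+1)*θ)) = (y:ℝ)^j * ((-1:ℝ)^(H (2*j+1)) * Real.sin ((2*j+1)*θ)) := by push_cast; ring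
      rw [this]
      exact mul_nonneg (by positivity) s
    have := nonneg_of_mul_nonneg_left this hsin0
    exact_mod_cast this
  set χ := J(V | y) with hχdef
  have hcopVy : IsCoprime V (y:ℤ) := by
    have c1 : IsCoprime a (y:ℤ) := by
      have : IsCoprime a (2*(y:ℤ)) := by
        rw [← hy]
        have : IsCoprime a (b^2 + a * a) := IsCoprime.add_mul_left_right (hab.pow_right) a
        convert this using 1; ring
      exact this.of_mul_right_right
    have c2 : IsCoprime (2:ℤ) (y:ℤ) := by
      rw [Int.isCoprime_iff_gcd_eq_one]
      have := (Nat.coprime_two_left).2 (Nat.odd_iff.2 hyodd)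
      exact_mod_cast this
    have c3 : IsCoprime (2*a^2) (y:ℤ) := c2.mul_left (c1.pow_left)
    have : IsCoprime (2*a^2 + (y:ℤ) * (-2)) (y:ℤ) := IsCoprime.add_mul_left_left c3 (-2)
    convert this using 1
    linarith
  have hχ2 : χ^2 = 1 := jacobiSym.sq_one (Int.isCoprime_iff_gcd_eq_one.1 hcopVy)
  obtain ⟨d, hd⟩ : ∃ d, p = 2*d+1 := ⟨p/2, by omega⟩
  have hd' : (p-1)/2 = d := by omega
  rw [hd'] at h ⊢
  have hchi : ∀ i, χ^(i*d) = 1 := by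
    intro i
    rcases h with ⟨h8, hu⟩ | ⟨h8, hu⟩
    · obtain ⟨k, hk⟩ : ∃ k, d = 2*k := ⟨d/2, by omega⟩
      rw [hk, show i*(2*k) = 2*(i*k) by ring, pow_mul, hχ2, one_pow]
    · have := (J_y V y H χ hV4 hy4 hχdef.symm hsgn d).2
      rw [hu, jacobiSym.one_left] at this
      rw [mul_comm, pow_mul, ← this, one_pow]
  have hna : (uu V y d).natAbs = 1 := by rcases h with ⟨_, hu⟩ | ⟨_, hu⟩ <;> rw [hu] <;> rfl
  have hfl : H p = p/4 := by
    apply comb p (H p) (by omega) (by omega)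
    · have : ((H p : ℕ):ℝ) ≤ p * x := Nat.floor_le (by positivity)
      have h3 : (p:ℝ) * x < p * (1/2) := by
        apply mul_lt_mul_of_pos_left hx1; exact_mod_cast (by omega : 0 < p)
      have : (2*(H p:ℕ):ℝ) < p := by linarith
      exact_mod_cast this
    · intro n hn hc
      obtain ⟨i, hi⟩ : ∃ i, n = 2*i+1 := ⟨n/2, by omega⟩
      have := main_recip V y H χ hHg hV4 hy4 hχdef.symm hχ2 hsgn _ i d rfl (by rw [← hi, ← hd]; exact hc)
      rw [hna, jacobiSym.one_right, hchi, one_mul, ← hi, ← hd] at this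
      rcases Nat.even_or_odd (cc H n p + cc (fun l => l/4) n p) with h | h
      · exact h
      · rw [h.neg_one_pow] at this; norm_num at this
  have habs : |(uu V y d : ℝ)| = 1 := by
    rcases h with ⟨_, hu⟩ | ⟨_, hu⟩ <;> rw [hu] <;> simp
  have htr := (uu_trig V y θ hcos d).1
  have hsp : |Real.sin ((p:ℝ)*θ)| ≤ 1 / (y:ℝ)^d := by
    have e : (p:ℝ)*θ = (2*d+1)*θ := by rw [hd]; push_cast; ring
    rw [e]
    have := congrArg abs htr
    rw [abs_mul, abs_mul, habs, abs_of_pos hsin0, abs_of_pos (by push_cast; positivity)] at this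
    rw [le_div_iff₀ (by positivity), mul_comm]
    push_cast at this
    rw [← this, one_mul]; exact Real.sin_le_one θ
  set q := p/4 with hq
  have hl1 : (q:ℝ) * Real.pi ≤ p * θ := by
    have : ((H p : ℕ):ℝ) ≤ p * x := Nat.floor_le (by positivity)
    rw [hfl] at this
    rw [← hxθ]; nlinarith
  have hl2 : (p:ℝ) * θ < (q+1) * Real.pi := by
    have : (p:ℝ) * x < (H p : ℕ) + 1 := Nat.lt_floor_add_one _
    rw [hfl] at this
    rw [← hxθ]; nlinarith
  -- close to a multiple
  have hjj : ∃ j : ℕ, (j = q ∨ j = q+1) ∧ |(p:ℝ)*θ - j*Real.pi| ≤ Real.pi/2 / (y:ℝ)^d := by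
    rcases le_total ((p:ℝ)*θ - q*Real.pi) (Real.pi/2) with hc | hc
    · refine ⟨q, Or.inl rfl, ?_⟩
      have h0 : 0 ≤ (p:ℝ)*θ - q*Real.pi := by linarith
      have := Real.mul_le_sin h0 hc
      rw [abs_of_nonneg h0]
      have e : Real.sin ((p:ℝ)*θ - q*Real.pi) ≤ 1/(y:ℝ)^d := by
        rw [Real.sin_sub_nat_mul_pi]
        refine le_trans (le_abs_self _) ?_
        rw [abs_mul]; simpa using hsp
      have h3 : 2/Real.pi * ((p:ℝ)*θ - q*Real.pi) ≤ 1/(y:ℝ)^d := le_trans this e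
      calc (p:ℝ)*θ - q*Real.pi = Real.pi/2 * (2/Real.pi * ((p:ℝ)*θ - q*Real.pi)) := by field_simp
        _ ≤ Real.pi/2 * (1/(y:ℝ)^d) := by gcongr
        _ = _ := by ring
    · refine ⟨q+1, Or.inr rfl, ?_⟩
      have h0 : 0 ≤ ((q+1:ℕ):ℝ)*Real.pi - p * θ := by push_cast; linarith
      have := Real.mul_le_sin h0 (by push_cast; linarith)
      rw [abs_sub_comm, abs_of_nonneg h0]
      have e : Real.sin (((q+1:ℕ):ℝ)*Real.pi - p * θ) ≤ 1/(y:ℝ)^d := by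
        rw [Real.sin_nat_mul_pi_sub]
        refine le_trans (le_abs_self _) ?_
        rw [abs_neg, abs_mul]; simpa using hsp
      have h3 := le_trans this e
      calc ((q+1:ℕ):ℝ)*Real.pi - p * θ = Real.pi/2 * (2/Real.pi * (((q+1:ℕ):ℝ)*Real.pi - p * θ)) := by field_simp
        _ ≤ Real.pi/2 * (1/(y:ℝ)^d) := by gcongr
        _ = _ := by ring
  obtain ⟨j, hj, hjb⟩ := hjj
  refine ⟨((4*(j:ℤ) - p).natAbs), ?_, ?_⟩
  · omega
  · refine le_trans ?_ hjb
    have e : (((4*(j:ℤ) - p).natAbs : ℕ):ℝ) = |4*(j:ℝ) - p| := by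
      rw [Nat.cast_natAbs]; push_cast; ring_nf
    have e2 : (p:ℝ) * |θ - Real.pi/4| = |p * (θ - Real.pi/4)| := by
      rw [abs_mul, abs_of_nonneg (Nat.cast_nonneg p : (0:ℝ) ≤ p)]
    have e3 : |4*(j:ℝ) - p| * (Real.pi/4) = |(4*(j:ℝ)-p) * (Real.pi/4)| := by
      rw [abs_mul, abs_of_pos (by positivity : 0 < Real.pi/4)]
    rw [e, e2, e3]
    refine le_trans (abs_abs_sub_abs_le _ _) ?_
    apply le_of_eq; congr 1; ring

theorem partB' (y p : ℕ) (a b : ℤ) (ha : 0 < a) (hb : 0 < b) (hao : Odd a) (hbo : Odd b) (hab : IsCoprime a b) (hne : a ≠ b)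
    (hy : a^2 + b^2 = 2*(y:ℤ)) (hp : 11 ≤ p)
    (h : (p % 8 = 5 ∧ uu (a^2-b^2) y ((p-1)/2) = -1) ∨ (p % 8 = 3 ∧ uu (a^2-b^2) y ((p-1)/2) = 1)) :
    ∃ κ z w : ℕ, (κ = 1 ∨ κ = 3) ∧ 1 ≤ w ∧ w < z ∧ z^2 + w^2 = y ∧ ((b:ℤ) = z + w ∨ (b:ℤ) = z - w) ∧
      |(p:ℝ) * Real.arctan (w/z) - κ * (Real.pi/4)| ≤ Real.pi/2 / (y:ℝ)^((p-1)/2) := by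
  obtain ⟨κ, hκ, hB⟩ := partB y p a b ha hb hao hbo hab hy hp h
  obtain ⟨a', ha'⟩ := hao
  obtain ⟨b', hb'⟩ := hbo
  obtain ⟨z, hz⟩ : ∃ z : ℕ, (z:ℤ) = a' + b' + 1 := ⟨(a'+b'+1).toNat, by omega⟩
  obtain ⟨w, hw⟩ : ∃ w : ℕ, (w:ℤ) = |a' - b'| := ⟨(a'-b').natAbs, by simp⟩
  have hw2 : (w:ℤ) = a' - b' ∨ (w:ℤ) = b' - a' := by
    rcases abs_choice (a'-b') with h | h <;> rw [h] at hw <;> omega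
  refine ⟨κ, z, w, hκ, by omega, by omega, ?_, by omega, ?_⟩
  · have hw3 : (w:ℤ)^2 = (a'-b')^2 := by rw [hw, sq_abs]
    zify; rw [hz, hw3]; subst ha' hb'; nlinarith
  · convert hB using 3
    congr 1
    have haR : (0:ℝ) < a := by exact_mod_cast ha
    have hbR : (0:ℝ) < b := by exact_mod_cast hb
    have key : Real.arctan ((b:ℝ)/a) - Real.pi/4 = Real.arctan ((b-a)/(a+b)) := by
      rw [← Real.arctan_one]
      have := Real.arctan_add (x := (b:ℝ)/a) (y := -1) (by 
        have : 0 < (b:ℝ)/a := by positivity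
        linarith)
      rw [Real.arctan_neg] at this
      rw [sub_eq_add_neg, this]
      congr 1
      have h1 : 1 - (b:ℝ)/a * -1 = (a+b)/a := by field_simp; ring
      have h2 : (b:ℝ)/a + -1 = (b-a)/a := by field_simp; ring
      rw [h1, h2, div_div_div_cancel_right₀ haR.ne']
    rw [key]
    have hzR : (z:ℝ) = (a+b)/2 := by
      have : (2*z:ℤ) = a + b := by omega
      have : (2*z:ℝ) = a + b := by exact_mod_cast this
      linarith
    have habs : |Real.arctan (((b:ℝ)-a)/(a+b))| = Real.arctan (|(b:ℝ)-a|/(a+b)) := by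
      rcases le_total (a:ℝ) b with h | h
      · rw [abs_of_nonneg, abs_of_nonneg (by linarith : (0:ℝ) ≤ b - a)]
        exact Real.arctan_nonneg.2 (div_nonneg (by linarith) (by linarith))
      · rw [abs_of_nonpos, abs_of_nonpos (by linarith : (b:ℝ) - a ≤ 0), ← Real.arctan_neg]
        · congr 1; ring
        · rw [← neg_nonneg, ← Real.arctan_neg]
          apply Real.arctan_nonneg.2
          rw [← neg_div]
          exact div_nonneg (by linarith) (by linarith)
    rw [habs, hzR]
    have hwR : (w:ℝ) = |(b:ℝ)-a|/2 := by
      have : (2*w:ℤ) = |b - a| := by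
        rcases abs_choice (b-a) with h | h <;> rcases abs_choice (a'-b') with h' | h' <;> rw [h] <;> rw [h'] at hw <;> 
         (have := abs_nonneg (b-a); have := abs_nonneg (a'-b'); omega)
      have : (2*w:ℝ) = |(b:ℝ) - a| := by exact_mod_cast this
      linarith
    rw [hwR]
    congr 1
    field_simp
end

section
open Polynomial in
theorem cheb_monic (X : ℝ) (hX : 0 < X) (j : ℕ) : ∃ P : ℝ[X], P.natDegree = j ∧ P.Monic ∧ 
    ∀ t, 0 ≤ t → t ≤ X → |P.eval t| ≤ 2 * (X/4)^j := by
  rcases Nat.eq_zero_or_pos j with h0 | h0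
  · subst h0
    exact ⟨1, by simp, monic_one, by intro t _ _; simp⟩
  set Lp : ℝ[X] := C (2/X) * Polynomial.X + C (-1) with hLp
  have h2 : (2/X:ℝ) ≠ 0 := by positivity
  have hLd : Lp.natDegree = 1 := natDegree_linear h2
  have hLc : Lp.leadingCoeff = 2/X := leadingCoeff_linear h2
  set a : ℝ := 2 * (X/4)^j with ha
  have ha0 : a ≠ 0 := by positivity
  have hTd : (Chebyshev.T ℝ j).natDegree = j := by rw [Chebyshev.natDegree_T]; simp
  have hTl : (Chebyshev.T ℝ j).leadingCoeff = 2^(j-1) := by rw [Chebyshev.leadingCoeff_T]; simp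
  refine ⟨C a * (Chebyshev.T ℝ j).comp Lp, ?_, ?_, ?_⟩
  · rw [natDegree_C_mul ha0, natDegree_comp, hTd, hLd, mul_one]
  · unfold Monic
    rw [leadingCoeff_mul, leadingCoeff_C, leadingCoeff_comp (by rw [hLd]; norm_num), hTd, hTl, hLc, ha]
    obtain ⟨i, rfl⟩ : ∃ i, j = i+1 := ⟨j-1, by omega⟩
    have gen : ∀ u v : ℝ, 2*u^(i+1) * (2^i * v^(i+1)) = (2*(u*v))^(i+1) := by intros; ring
    rw [Nat.add_sub_cancel, gen]
    have : 2 * (X/4*(2/X)) = 1 := by field_simp; norm_num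
    rw [this, one_pow]
  · intro t h0t htX
    rw [eval_mul, eval_C, eval_comp, abs_mul, abs_of_pos (by positivity : 0 < a)]
    have : |(Chebyshev.T ℝ j).eval (Lp.eval t)| ≤ 1 := by
      apply Chebyshev.abs_eval_T_real_le_one
      simp only [hLp, eval_add, eval_mul, eval_C, eval_X]
      rw [abs_le]
      have h3 : 0 ≤ 2/X*t := by positivity
      have h4 : 2/X*t ≤ 2 := by rw [div_mul_eq_mul_div, div_le_iff₀ hX]; linarith
      constructor <;> linarith
    calc a * _ ≤ a * 1 := by gcongr
      _ = a := mul_one a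

theorem det_bound {N : ℕ} {𝕜 : Type*} [RCLike 𝕜] (M : Matrix (Fin N) (Fin N) 𝕜) (A B : Fin N → ℝ)
    (h : ∀ i j, ‖M i j‖ ≤ B i * A j) : ‖M.det‖ ≤ (Nat.factorial N) * ((∏ i, B i) * ∏ j, A j) := by
  rw [Matrix.det_apply]
  refine le_trans (norm_sum_le _ _) ?_
  have : ∀ σ ∈ (Finset.univ : Finset (Equiv.Perm (Fin N))), ‖Equiv.Perm.sign σ • ∏ i, M (σ i) i‖ ≤ (∏ i, B i) * ∏ j, A j := by
    intro σ _
    have e : ‖Equiv.Perm.sign σ • ∏ i, M (σ i) i‖ = ∏ i, ‖M (σ i) i‖ := by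
      rw [← norm_prod]
      rcases Int.units_eq_one_or (Equiv.Perm.sign σ) with h | h <;> rw [h] <;> simp
    rw [e]
    calc ∏ i, ‖M (σ i) i‖ ≤ ∏ i, (B (σ i) * A i) := by
          apply Finset.prod_le_prod
          · intros; positivity
          · intros; apply h
      _ = _ := by rw [Finset.prod_mul_distrib, Equiv.prod_comp σ B]
  refine le_trans (Finset.sum_le_card_nsmul _ _ _ this) ?_
  simp [Fintype.card_perm]

theorem vand_bound (N : ℕ) (t : Fin N → ℝ) (X : ℝ) (hX : 0 < X) (h : ∀ i, 0 ≤ t i ∧ t i ≤ X) :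
    |(Matrix.vandermonde t).det| ≤ (Nat.factorial N) * (2^N * (X/4)^(N*(N-1)/2)) := by
  choose P hd hm hb using cheb_monic X hX
  have e := Matrix.det_eval_matrixOfPolynomials_eq_det_vandermonde t (fun j => P j) (fun j => hd j) (fun j => hm j)
  rw [e]
  have := det_bound (Matrix.of fun i j : Fin N => (P j).eval (t i)) (fun j => 2 * (X/4)^(j:ℕ)) (fun _ => 1) (by
    intro i j
    rw [one_mul]
    exact hb j (t i) (h i).1 (h i).2)
  rw [Real.norm_eq_abs] at this
  refine le_trans this ?_
  rw [Finset.prod_const_one, one_mul, Finset.prod_mul_distrib, Finset.prod_const, Finset.prod_pow_eq_pow_sum, Fin.sum_univ_eq_sum_range (fun i => i), Finset.sum_range_id]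
  simp
end

section
/-- divided-difference matrix -/
noncomputable def ddW {N : ℕ} (t : Fin N → ℂ) : Matrix (Fin N) (Fin N) ℂ :=
  fun j i => if i ≤ j then Lagrange.nodalWeight (Finset.Iic j) t i else 0

theorem ddW_det {N : ℕ} (t : Fin N → ℂ) (ht : Function.Injective t) : (ddW t).det * (Matrix.vandermonde t).det = 1 := by
  have h1 : (ddW t).det = ∏ j, ∏ k ∈ Finset.Iio j, (t j - t k)⁻¹ := by
    rw [Matrix.det_of_isLowerTriangular]
    · apply Finset.prod_congr rfl
      intro j _
      simp only [ddW, le_refl, if_true, Lagrange.nodalWeight]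
      apply Finset.prod_congr _ (fun _ _ => rfl)
      ext k; simp [lt_iff_le_and_ne, and_comm]
    · intro i j hij
      have : i < j := hij
      simp [ddW, not_le.2 this]
  have h2 : (Matrix.vandermonde t).det = ∏ j, ∏ k ∈ Finset.Iio j, (t j - t k) := by
    rw [Matrix.det_vandermonde]
    apply Finset.prod_comm'
    intro x y; simp
  rw [h1, h2, ← Finset.prod_mul_distrib]
  apply Finset.prod_eq_one
  intro j _
  rw [← Finset.prod_mul_distrib]
  apply Finset.prod_eq_one
  intro k hk
  have : t j ≠ t k := fun h => (Finset.mem_Iio.1 hk).ne (ht h).symm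
  exact inv_mul_cancel₀ (sub_ne_zero.2 this)

theorem det_dd {N : ℕ} (t : Fin N → ℂ) (ht : Function.Injective t) (F : Matrix (Fin N) (Fin N) ℂ) (A B : Fin N → ℝ)
    (h : ∀ j c, ‖∑ i ∈ Finset.Iic j, Lagrange.nodalWeight (Finset.Iic j) t i * F i c‖ ≤ B j * A c) :
    ‖F.det‖ ≤ ‖(Matrix.vandermonde t).det‖ * ((Nat.factorial N) * ((∏ i, B i) * ∏ j, A j)) := by
  have h1 := det_bound (ddW t * F) A B (by
    intro j c
    refine le_trans (le_of_eq ?_) (h j c)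
    congr 1
    rw [Matrix.mul_apply]
    rw [← Finset.sum_subset (Finset.subset_univ (Finset.Iic j))]
    · apply Finset.sum_congr rfl; intro i hi
      simp [ddW, Finset.mem_Iic.1 hi]
    · intro i _ hi
      have : ¬ i ≤ j := fun h => hi (Finset.mem_Iic.2 h)
      simp [ddW, this])
  have h2 : F.det = (Matrix.vandermonde t).det * (ddW t * F).det := by
    rw [Matrix.det_mul, ← mul_assoc, mul_comm (Matrix.vandermonde t).det, ddW_det t ht, one_mul]
  rw [h2, norm_mul]
  gcongr

theorem dd_cauchy {N : ℕ} (t : Fin N → ℂ) (ht : Function.Injective t) (j : Fin N) (X D M : ℝ) (hX : 0 ≤ X) (hD : 0 < D)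
    (htX : ∀ i, ‖t i‖ ≤ X) (f : ℂ → ℂ) (hf : Differentiable ℂ f) (hM : ∀ u, ‖u‖ = X + D → ‖f u‖ ≤ M) :
    ‖∑ i ∈ Finset.Iic j, Lagrange.nodalWeight (Finset.Iic j) t i * f (t i)‖ ≤ (X+D)/D * M * (D⁻¹)^(j:ℕ) := by
  have hρ : 0 < X + D := by linarith
  set s := Finset.Iic j with hs
  have hne : ∀ u, ‖u‖ = X + D → ∀ i, u ≠ t i := by
    intro u hu i h
    have := htX i
    rw [← h, hu] at this; linarith
  have hc : ∀ i, f (t i) = (2*Real.pi*Complex.I)⁻¹ • ∮ z in C(0, X+D), (z - t i)⁻¹ • f z := by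
    intro i
    rw [Complex.two_pi_I_inv_smul_circleIntegral_sub_inv_smul_of_differentiable_on_off_countable Set.countable_empty]
    · simp only [Metric.mem_ball, dist_zero_right]; have := htX i; linarith
    · exact hf.continuous.continuousOn
    · intro x _; exact hf x
  have hcirc : ∀ i, CircleIntegrable (fun z => (z - t i)⁻¹ • f z) 0 (X+D) := by
    intro i
    apply ContinuousOn.circleIntegrable hρ.le
    have c1 : ContinuousOn (fun z => (z - t i)⁻¹) (Metric.sphere 0 (X+D)) := by
      apply ContinuousOn.inv₀ (by fun_prop)
      intro u hu
      exact sub_ne_zero.2 (hne u (by simpa using hu) i)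
    exact c1.smul hf.continuous.continuousOn
  have key : ∑ i ∈ s, Lagrange.nodalWeight s t i * f (t i) = (2*Real.pi*Complex.I)⁻¹ • ∮ z in C(0, X+D), (∏ i ∈ s, (z - t i))⁻¹ • f z := by
    have e1 : ∑ i ∈ s, Lagrange.nodalWeight s t i * f (t i) = (2*Real.pi*Complex.I)⁻¹ • ∑ i ∈ s, ∮ z in C(0, X+D), Lagrange.nodalWeight s t i • ((z - t i)⁻¹ • f z) := by
      rw [Finset.smul_sum]
      apply Finset.sum_congr rfl
      intro i _
      rw [circleIntegral.integral_smul, smul_comm, ← hc i]; rfl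
    rw [e1, ← circleIntegral.integral_fun_sum]
    · congr 1
      apply circleIntegral.integral_congr hρ.le
      intro u hu
      have hu' : ‖u‖ = X + D := by simpa using hu
      simp only [smul_eq_mul]
      have hL := Lagrange.eval_interpolate_not_at_node (s := s) (v := t) (x := u) (fun _ => (1:ℂ)) (fun i _ => hne u hu' i)
      have h1 : Lagrange.interpolate s t (fun _ => (1:ℂ)) = 1 := Lagrange.interpolate_one ht.injOn ⟨j, by simp [hs]⟩
      rw [h1, Polynomial.eval_one, Lagrange.eval_nodal] at hL
      have hnz : ∏ i ∈ s, (u - t i) ≠ 0 := Finset.prod_ne_zero_iff.2 (fun i _ => sub_ne_zero.2 (hne u hu' i))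
      have h2 : (∏ i ∈ s, (u - t i))⁻¹ = ∑ i ∈ s, Lagrange.nodalWeight s t i * (u - t i)⁻¹ * 1 := by
        rw [inv_eq_of_mul_eq_one_right]; exact hL.symm
      rw [h2, Finset.sum_mul]
      apply Finset.sum_congr rfl; intro i _; ring
    · intro i _
      exact (hcirc i).const_fun_smul
  rw [key]
  have hM0 : 0 ≤ M := le_trans (norm_nonneg _) (hM ((X+D:ℝ):ℂ) (by rw [Complex.norm_real, Real.norm_of_nonneg hρ.le]))
  have := circleIntegral.norm_two_pi_i_inv_smul_integral_le_of_norm_le_const (c := 0) hρ.le (f := fun z => (∏ i ∈ s, (z - t i))⁻¹ • f z) (C := (D⁻¹)^((j:ℕ)+1) * M) (by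
    intro u hu
    have hu' : ‖u‖ = X + D := by simpa using hu
    rw [norm_smul, norm_inv, norm_prod]
    have hcard : s.card = (j:ℕ)+1 := by simp [hs]
    have : (∏ i ∈ s, ‖u - t i‖)⁻¹ ≤ (D⁻¹)^((j:ℕ)+1) := by
      rw [← Finset.prod_inv_distrib, ← hcard, ← Finset.prod_const]
      apply Finset.prod_le_prod
      · intros; positivity
      · intro i _
        apply inv_anti₀ hD
        have h3 := norm_sub_norm_le u (t i)
        have := htX i
        linarith
    exact mul_le_mul this (hM u hu') (norm_nonneg _) (by positivity))
  refine le_trans this (le_of_eq ?_)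
  rw [pow_succ]; field_simp
end

section
theorem prod_dist (i m : ℕ) : ∏ k ∈ (Finset.Iic (i+m)).erase i, |(i:ℝ) - k| = (Nat.factorial i : ℝ) * (Nat.factorial m : ℝ) := by
  induction m with
  | zero =>
    have : (Finset.Iic (i+0)).erase i = Finset.range i := by
      ext k; simp
    rw [this, ← Finset.prod_range_reflect]
    simp only [Nat.factorial_zero, Nat.cast_one, mul_one]
    rw [← Finset.prod_range_add_one_eq_factorial]
    push_cast
    apply Finset.prod_congr rfl
    intro k hk
    have hk := Finset.mem_range.1 hk
    rw [Nat.cast_sub (by omega), Nat.cast_sub (by omega)]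
    rw [abs_of_nonneg] <;> push_cast <;> ring_nf
    positivity
  | succ m ih =>
    have : (Finset.Iic (i+(m+1))).erase i = insert (i+m+1) ((Finset.Iic (i+m)).erase i) := by
      ext k; simp; omega
    rw [this, Finset.prod_insert (by simp), ih, Nat.factorial_succ]
    push_cast
    rw [show (i:ℝ) - (i+m+1) = -(m+1) by ring, abs_neg, abs_of_nonneg (by positivity)]
    ring

theorem weight_bound {N : ℕ} (t : Fin N → ℕ) (ht : StrictMono t) (i j : Fin N) (hij : i ≤ j) :
    ‖Lagrange.nodalWeight (Finset.Iic j) (fun i => (t i : ℂ)) i‖ ≤ 2^(j:ℕ) / (Nat.factorial j) := by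
  have hdist : ∀ a b : Fin N, a ≤ b → (b:ℕ) - (a:ℕ) + t a ≤ t b := by
    intro a b hab
    obtain ⟨m, hm⟩ := Nat.exists_eq_add_of_le (show (a:ℕ) ≤ b from hab)
    induction m generalizing b with
    | zero => 
      have : a = b := Fin.ext (by omega)
      subst this; simp
    | succ m ih =>
      have hlt : (a:ℕ) + m < N := by have := b.2; omega
      have := ih ⟨a+m, hlt⟩ (by rw [Fin.le_def]; simp) (by simp)
      have h2 : t ⟨a+m, hlt⟩ < t b := ht (by rw [Fin.lt_def]; simp; omega)
      simp at this
      omega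
  have hd : ∀ a b : Fin N, |((a:ℕ):ℝ) - (b:ℕ)| ≤ ‖(t a : ℂ) - (t b : ℂ)‖ := by
    intro a b
    have e : ‖(t a : ℂ) - (t b : ℂ)‖ = |(t a : ℝ) - t b| := by
      rw [← Complex.ofReal_natCast, ← Complex.ofReal_natCast, ← Complex.ofReal_sub, Complex.norm_real, Real.norm_eq_abs]
    rw [e]
    rcases le_total a b with h | h
    · have h1 := hdist a b h
      have h2 : (a:ℕ) ≤ b := h
      have h3 : ((b:ℕ):ℝ) + t a ≤ t b + (a:ℕ) := by exact_mod_cast (by omega : (b:ℕ) + t a ≤ t b + (a:ℕ))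
      have h2' : ((a:ℕ):ℝ) ≤ (b:ℕ) := by exact_mod_cast h2
      rw [abs_of_nonpos (by linarith), abs_of_nonpos (by linarith)]; linarith
    · have h1 := hdist b a h
      have h2 : (b:ℕ) ≤ a := h
      have h3 : ((a:ℕ):ℝ) + t b ≤ t a + (b:ℕ) := by exact_mod_cast (by omega : (a:ℕ) + t b ≤ t a + (b:ℕ))
      have h2' : ((b:ℕ):ℝ) ≤ (a:ℕ) := by exact_mod_cast h2
      rw [abs_of_nonneg (by linarith), abs_of_nonneg (by linarith)]; linarith
  obtain ⟨m, hm⟩ := Nat.exists_eq_add_of_le (show (i:ℕ) ≤ j from hij)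
  have hprod : (Nat.factorial i : ℝ) * (Nat.factorial m : ℝ) ≤ ∏ k ∈ (Finset.Iic j).erase i, ‖(t i : ℂ) - (t k : ℂ)‖ := by
    rw [← prod_dist, ← hm]
    have e : (Finset.Iic (j:ℕ)).erase (i:ℕ) = ((Finset.Iic j).erase i).map Fin.valEmbedding := by
      rw [Finset.map_erase, Fin.map_valEmbedding_Iic]; rfl
    rw [e, Finset.prod_map]
    apply Finset.prod_le_prod
    · intros; positivity
    · intro k _; exact hd i k
  rw [Lagrange.nodalWeight, norm_prod]
  simp only [norm_inv]
  rw [Finset.prod_inv_distrib]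
  have hpos : (0:ℝ) < (Nat.factorial i : ℝ) * (Nat.factorial m : ℝ) := by positivity
  refine le_trans (inv_anti₀ hpos hprod) ?_
  rw [le_div_iff₀ (by positivity), inv_mul_le_iff₀ hpos]
  have hch := Nat.choose_mul_factorial_mul_factorial (show (i:ℕ) ≤ j from hij)
  rw [show (j:ℕ) - i = m by omega] at hch
  have h2 : (Nat.choose j i) ≤ 2^(j:ℕ) := Nat.choose_le_two_pow _ _
  rw [← hch]
  push_cast
  have h3 : ((Nat.choose j i : ℕ):ℝ) ≤ 2^(j:ℕ) := by exact_mod_cast h2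
  calc ((Nat.choose j i : ℕ):ℝ) * (Nat.factorial i : ℝ) * (Nat.factorial m : ℝ) = ((Nat.factorial i : ℝ) * (Nat.factorial m : ℝ)) * (Nat.choose j i : ℕ) := by ring
    _ ≤ _ := by gcongr

theorem dd_err {N : ℕ} (t : Fin N → ℕ) (ht : StrictMono t) (j : Fin N) (g : Fin N → ℂ) (ε : ℝ) (hg : ∀ i, ‖g i‖ ≤ ε) :
    ‖∑ i ∈ Finset.Iic j, Lagrange.nodalWeight (Finset.Iic j) (fun i => (t i : ℂ)) i * g i‖ ≤ ((j:ℕ)+1) * (2^(j:ℕ) / (Nat.factorial j) * ε) := by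
  refine le_trans (norm_sum_le _ _) ?_
  have := Finset.sum_le_card_nsmul (Finset.Iic j) (fun i => ‖Lagrange.nodalWeight (Finset.Iic j) (fun i => (t i : ℂ)) i * g i‖) (2^(j:ℕ) / (Nat.factorial j) * ε) (by
    intro i hi
    rw [norm_mul]
    exact mul_le_mul (weight_bound t ht i j (Finset.mem_Iic.1 hi)) (hg i) (norm_nonneg _) (by positivity))
  refine le_trans this (le_of_eq ?_)
  simp
end

section
open Polynomial

theorem zero_est (n : ℕ) (P : Fin n → ℂ[X]) (x : Fin n → ℂ) (hP : ∀ l, P l ≠ 0) (hx0 : ∀ l, x l ≠ 0) (hx : Function.Injective x)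
    (Z : Finset ℂ) (hcard : ∑ l, (P l).natDegree < Z.card)
    (hv : ∀ ζ ∈ Z, ∃ v : Fin n → ℂ, v ≠ 0 ∧ ∀ s : Fin n, ∑ l, (P l).eval (ζ + (s:ℕ)) * (x l)^(s:ℕ) * v l = 0) : False := by
  set A : Matrix (Fin n) (Fin n) ℂ[X] := Matrix.of fun s l => (P l).comp (X + C ((s:ℕ):ℂ)) * C ((x l)^(s:ℕ)) with hA
  set m := ∑ l, (P l).natDegree with hm
  have hlin : ∀ c : ℂ, (X + C c : ℂ[X]).natDegree = 1 := fun c => natDegree_X_add_C c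
  have hd : ∀ s l, (A s l).natDegree = (P l).natDegree := by
    intro s l
    simp only [hA, Matrix.of_apply]
    rw [natDegree_mul_C (pow_ne_zero _ (hx0 l)), natDegree_comp, hlin, mul_one]
  have hl : ∀ s l, (A s l).leadingCoeff = (P l).leadingCoeff * (x l)^(s:ℕ) := by
    intro s l
    simp only [hA, Matrix.of_apply]
    rw [leadingCoeff_mul, leadingCoeff_C, leadingCoeff_comp (by rw [hlin]; norm_num), (monic_X_add_C _).leadingCoeff, one_pow, mul_one]
  have hne : ∀ s l, A s l ≠ 0 := by
    intro s l h
    have := hl s l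
    rw [h, leadingCoeff_zero] at this
    exact mul_ne_zero (leadingCoeff_ne_zero.2 (hP l)) (pow_ne_zero _ (hx0 l)) this.symm
  have hterm : ∀ σ : Equiv.Perm (Fin n), (∏ l, A (σ l) l).natDegree = m := by
    intro σ
    rw [natDegree_prod _ _ (fun l _ => hne _ _)]
    simp only [hd]; rfl
  have hcoef : ∀ σ : Equiv.Perm (Fin n), (∏ l, A (σ l) l).coeff m = ∏ l, (P l).leadingCoeff * (x l)^((σ l : Fin n):ℕ) := by
    intro σ
    rw [← hterm σ, coeff_natDegree, leadingCoeff_prod]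
    simp only [hl]
  have hsmul : ∀ (u : ℤˣ) (f : ℂ[X]), (u • f).natDegree = f.natDegree := by
    intro u f
    rcases Int.units_eq_one_or u with h | h <;> rw [h] <;> simp
  have hdeg : A.det.natDegree ≤ m := by
    rw [Matrix.det_apply]
    apply natDegree_sum_le_of_forall_le
    intro σ _
    rw [hsmul, hterm σ]
  have hc : A.det.coeff m = (∏ l, (P l).leadingCoeff) * (Matrix.vandermonde x).det := by
    rw [← Matrix.det_transpose (Matrix.vandermonde x), ← Matrix.det_mul_row, Matrix.det_apply, Matrix.det_apply, finset_sum_coeff]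
    apply Finset.sum_congr rfl
    intro σ _
    rcases Int.units_eq_one_or (Equiv.Perm.sign σ) with h | h <;> rw [h] <;> simp [hcoef, Matrix.vandermonde_apply]
  have hne0 : A.det ≠ 0 := by
    intro h
    rw [h, coeff_zero] at hc
    exact mul_ne_zero (Finset.prod_ne_zero_iff.2 (fun l _ => leadingCoeff_ne_zero.2 (hP l))) (Matrix.det_vandermonde_ne_zero_iff.2 hx) hc.symm
  apply hne0
  apply eq_zero_of_natDegree_lt_card_of_eval_eq_zero' A.det Z
  · intro ζ hζ
    obtain ⟨v, hv0, hvs⟩ := hv ζ hζ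
    rw [← coe_evalRingHom, RingHom.map_det]
    by_contra hdet
    apply hv0
    apply Matrix.eq_zero_of_mulVec_eq_zero hdet
    ext s
    simp only [Matrix.mulVec, dotProduct, RingHom.mapMatrix_apply, Matrix.map_apply, hA, Matrix.of_apply, coe_evalRingHom, eval_mul, eval_comp, eval_add, eval_X, eval_C, Pi.zero_apply]
    exact hvs s
  · omega

/-- binomial polynomial -/
noncomputable def bp (k : ℕ) : ℂ[X] := C ((Nat.factorial k : ℂ)⁻¹) * descPochhammer ℂ k

theorem bp_natDegree (k : ℕ) : (bp k).natDegree = k := by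
  unfold bp
  rw [natDegree_C_mul (by simp [Nat.factorial_ne_zero]), descPochhammer_natDegree]

theorem bp_ne_zero (k : ℕ) : bp k ≠ 0 := by
  unfold bp
  apply mul_ne_zero
  · simp [Nat.factorial_ne_zero]
  · exact (monic_descPochhammer ℂ k).ne_zero

theorem bp_eval (k n : ℕ) : (bp k).eval (n:ℂ) = (Nat.choose n k : ℂ) := by
  unfold bp
  rw [eval_mul, eval_C, descPochhammer_eval_eq_descFactorial, Nat.descFactorial_eq_factorial_mul_choose]
  push_cast
  rw [← mul_assoc, inv_mul_cancel₀ (by simp [Nat.factorial_ne_zero]), one_mul]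

theorem bp_comb_natDegree (K : ℕ) (hK : 0 < K) (a : Fin K → ℂ) : (∑ k, C (a k) * bp k).natDegree ≤ K - 1 := by
  apply natDegree_sum_le_of_forall_le
  intro k _
  refine le_trans (natDegree_C_mul_le _ _) ?_
  rw [bp_natDegree]; have := k.2; omega

theorem bp_indep (K : ℕ) (a : Fin K → ℂ) (h : ∑ k, C (a k) * bp k = 0) : a = 0 := by
  have key : ∀ n : ℕ, ∀ hn : n < K, a ⟨n, hn⟩ = 0 := by
    intro n
    induction n using Nat.strong_induction_on with
    | _ n ih =>
    intro hn
    have := congrArg (eval (n:ℂ)) h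
    simp only [eval_finset_sum, eval_mul, eval_C, eval_zero, bp_eval] at this
    rw [Finset.sum_eq_single ⟨n, hn⟩] at this
    · simpa using this
    · intro k _ hk
      rcases lt_trichotomy (k:ℕ) n with h1 | h1 | h1
      · rw [ih k h1 k.2]; simp
      · exact absurd (Fin.ext h1) hk
      · rw [Nat.choose_eq_zero_of_lt h1]; simp
    · simp
  ext k; exact key k k.2
end

section
open Polynomial

/-- entry of the interpolation matrix -/
noncomputable def ent (p : ℕ) (ω β : ℂ) (n : ℕ) (l : Fin 3) (k : ℕ) : ℂ :=
  (Nat.choose n k : ℂ) * (ω^(n/p) * β^(n%p))^(((l:ℕ):ℤ)-1)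

theorem ent_indep (p K R S : ℕ) (ω β : ℂ) (hp : 0 < p) (hK : 0 < K) (hS : S ≤ p) (hω : ω ≠ 0) (hβ : β ≠ 0) (hβ1 : β ≠ 1) (hβ2 : β ≠ -1)
    (hRS : 3*(K-1) < R*(S-2)) (a : Fin 3 → Fin K → ℂ) 
    (ha : ∀ n, n < R*p → n % p < S → ∑ l, ∑ k : Fin K, a l k * ent p ω β n l k = 0) : a = 0 := by
  by_contra hne
  set P : Fin 3 → ℂ[X] := fun l => ∑ k, C (a l k) * bp k with hP
  set Λ : Finset (Fin 3) := Finset.univ.filter (fun l => P l ≠ 0) with hΛ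
  have hΛne : Λ.Nonempty := by
    by_contra h
    rw [Finset.not_nonempty_iff_eq_empty] at h
    apply hne
    ext1 l
    apply bp_indep
    have : l ∉ Λ := by rw [h]; simp
    simpa [hΛ] using this
  have hΛ3 : Λ.card ≤ 3 := by simpa using Finset.card_le_univ Λ
  set q := Λ.equivFin.symm with hq
  set x : Fin Λ.card → ℂ := fun l => β^(((q l : Fin 3):ℕ):ℤ) * β⁻¹ with hx
  have hxinj : Function.Injective x := by
    intro l l' h
    simp only [hx] at h
    have h' := mul_right_cancel₀ (inv_ne_zero hβ) h
    apply q.injective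
    apply Subtype.ext
    generalize ((q l : Fin 3)) = u at h'
    generalize ((q l' : Fin 3)) = u' at h'
    have hb2 : β^2 ≠ 1 := by
      intro h
      have : (β-1)*(β+1) = 0 := by linear_combination h
      rcases mul_eq_zero.1 this with h | h
      · exact hβ1 (by linear_combination h)
      · exact hβ2 (by linear_combination h)
    have hb3 : β^2 ≠ β := by
      intro h
      exact hβ1 (mul_left_cancel₀ hβ (by linear_combination h))
    fin_cases u <;> fin_cases u' <;> simp at h' ⊢
    · exact hβ1 h'.symm
    · exact hb2 h'.symm
    · exact hβ1 h'
    · exact hb3 (by exact_mod_cast h'.symm)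
    · exact h'.elim hβ1 hβ2
    · exact hb3 (by exact_mod_cast h')
  set Z : Finset ℂ := (Finset.range R ×ˢ Finset.range (S-2)).image (fun rs => ((rs.1*p + rs.2 : ℕ):ℂ)) with hZ
  have hZc : Z.card = R*(S-2) := by
    rw [hZ, Finset.card_image_of_injOn, Finset.card_product, Finset.card_range, Finset.card_range]
    intro u hu v hv huv
    simp only [Finset.coe_product, Finset.coe_range, Set.mem_prod, Set.mem_Iio] at hu hv
    have huv' : ((u.1*p+u.2:ℕ):ℂ) = ((v.1*p+v.2:ℕ):ℂ) := huv
    have h1 : u.1*p + u.2 = v.1*p+v.2 := by exact_mod_cast huv'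
    have h2 : u.1 = v.1 := by
      have e1 : (u.1*p+u.2)/p = u.1 := by
        rw [mul_comm, Nat.mul_add_div hp, Nat.div_eq_of_lt (by omega), add_zero]
      have e2 : (v.1*p+v.2)/p = v.1 := by
        rw [mul_comm, Nat.mul_add_div hp, Nat.div_eq_of_lt (by omega), add_zero]
      rw [← e1, h1, e2]
    rw [h2] at h1
    exact Prod.ext h2 (by omega)
  refine zero_est Λ.card (fun l => P (q l)) x ?_ ?_ hxinj Z ?_ ?_
  · intro l
    have := (q l).2
    exact (Finset.mem_filter.1 this).2
  · intro l
    exact mul_ne_zero (zpow_ne_zero _ hβ) (inv_ne_zero hβ)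
  · rw [hZc]
    refine lt_of_le_of_lt ?_ hRS
    refine le_trans (Finset.sum_le_card_nsmul _ _ (K-1) (fun l _ => bp_comb_natDegree K hK _)) ?_
    simp only [Finset.card_univ, Fintype.card_fin, smul_eq_mul]
    exact Nat.mul_le_mul_right _ hΛ3
  · intro ζ hζ
    obtain ⟨⟨r, s⟩, hrs, rfl⟩ := Finset.mem_image.1 hζ
    simp only [Finset.mem_product, Finset.mem_range] at hrs
    obtain ⟨hr, hs⟩ := hrs
    set E : ℂ := ω^r * β^s with hE
    have hE0 : E ≠ 0 := mul_ne_zero (pow_ne_zero _ hω) (pow_ne_zero _ hβ)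
    refine ⟨fun l => E^((((q l : Fin 3):ℕ):ℤ)-1), ?_, ?_⟩
    · intro h
      obtain ⟨l, hl⟩ := hΛne
      have := congrFun h (q.symm ⟨l, hl⟩)
      exact zpow_ne_zero _ hE0 this
    · intro s1
      have hs1 : (s1:ℕ) < 3 := lt_of_lt_of_le s1.2 hΛ3
      have hdiv : (r*p + s + s1)/p = r := by
        rw [add_assoc, mul_comm, Nat.mul_add_div hp, Nat.div_eq_of_lt (by omega), add_zero]
      have hmod : (r*p + s + s1)%p = s + s1 := by
        rw [add_assoc, mul_comm, Nat.mul_add_mod, Nat.mod_eq_of_lt (by omega)]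
      have h := ha (r*p+s+s1) (by
        have : (r+1)*p ≤ R*p := Nat.mul_le_mul_right _ hr
        rw [add_mul, one_mul] at this; omega) (by rw [hmod]; omega)
      have hPe : ∀ l, ∑ k : Fin K, a l k * ent p ω β (r*p+s+s1) l k = (P l).eval (((r*p+s:ℕ):ℂ) + (s1:ℕ)) * (β^((l:ℕ):ℤ) * β⁻¹)^(s1:ℕ) * E^(((l:ℕ):ℤ)-1) := by
        intro l
        have e1 : (((r*p+s:ℕ):ℂ) + (s1:ℕ)) = ((r*p+s+s1:ℕ):ℂ) := by push_cast; ring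
        rw [e1]
        simp only [hP, eval_finsetSum, eval_mul, eval_C, bp_eval, ent, hdiv, hmod]
        rw [Finset.sum_mul, Finset.sum_mul]
        apply Finset.sum_congr rfl
        intro k _
        have e2 : (ω^r * β^(s+(s1:ℕ)))^(((l:ℕ):ℤ)-1) = (β^((l:ℕ):ℤ) * β⁻¹)^(s1:ℕ) * E^(((l:ℕ):ℤ)-1) := by
          rw [pow_add, ← mul_assoc, ← hE, mul_zpow, ← zpow_natCast, ← zpow_natCast, ← zpow_mul, ← zpow_sub_one₀ hβ, ← zpow_mul]
          rw [mul_comm, mul_comm ((s1:ℕ):ℤ)]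
        rw [e2]; ring
      rw [Finset.sum_congr rfl (fun l _ => hPe l)] at h
      rw [← h]
      have e3 : ∑ l : Fin Λ.card, (P (q l)).eval (((r*p+s:ℕ):ℂ) + (s1:ℕ)) * (x l)^(s1:ℕ) * E^((((q l : Fin 3):ℕ):ℤ)-1) 
         = ∑ l : Λ, (P l).eval (((r*p+s:ℕ):ℂ) + (s1:ℕ)) * (β^(((l:Fin 3):ℕ):ℤ) * β⁻¹)^(s1:ℕ) * E^((((l:Fin 3):ℕ):ℤ)-1) := by
        exact Equiv.sum_comp q (fun l : Λ => (P l).eval (((r*p+s:ℕ):ℂ) + (s1:ℕ)) * (β^(((l:Fin 3):ℕ):ℤ) * β⁻¹)^(s1:ℕ) * E^((((l:Fin 3):ℕ):ℤ)-1))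
      rw [e3, Finset.sum_coe_sort Λ (fun l : Fin 3 => (P l).eval (((r*p+s:ℕ):ℂ) + (s1:ℕ)) * (β^((l:ℕ):ℤ) * β⁻¹)^(s1:ℕ) * E^(((l:ℕ):ℤ)-1))]
      apply Finset.sum_subset (Finset.subset_univ _)
      intro l _ hl
      have : P l = 0 := by simpa [hΛ] using hl
      rw [this]; simp

theorem exists_rows (p K R S : ℕ) (ω β : ℂ) (hp : 0 < p) (hK : 0 < K) (hS : S ≤ p) (hω : ω ≠ 0) (hβ : β ≠ 0) (hβ1 : β ≠ 1) (hβ2 : β ≠ -1)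
    (hRS : 3*(K-1) < R*(S-2)) : ∃ t : Fin (3*K) → ℕ, StrictMono t ∧ (∀ i, t i < R*p ∧ t i % p < S) ∧
     (Matrix.of fun i c : Fin (3*K) => ent p ω β (t i) (finProdFinEquiv.symm c).1 (finProdFinEquiv.symm c).2).det ≠ 0 := by
  let T := {n : ℕ // n < R*p ∧ n % p < S}
  let v : T → (Fin (3*K) → ℂ) := fun n c => ent p ω β n.1 (finProdFinEquiv.symm c).1 (finProdFinEquiv.symm c).2
  have hspan : Submodule.span ℂ (Set.range v) = ⊤ := by
    by_contra h
    obtain ⟨f, hf0, hf⟩ := Submodule.exists_le_ker_of_lt_top _ (lt_top_iff_ne_top.2 h)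
    apply hf0
    have hfe : ∀ u : Fin (3*K) → ℂ, f u = ∑ c, f (Pi.single c 1) * u c := by
      intro u
      conv_lhs => rw [pi_eq_sum_univ' u]
      rw [map_sum]
      apply Finset.sum_congr rfl
      intro c _
      rw [map_smul, smul_eq_mul, mul_comm]
    have := ent_indep p K R S ω β hp hK hS hω hβ hβ1 hβ2 hRS (fun l k => f (Pi.single (finProdFinEquiv (l, k)) 1)) (by
      intro n hn hs
      have h1 : f (v ⟨n, hn, hs⟩) = 0 := hf (Submodule.subset_span ⟨_, rfl⟩)
      rw [hfe, ← Equiv.sum_comp finProdFinEquiv, Fintype.sum_prod_type] at h1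
      simp only [v, Equiv.symm_apply_apply] at h1
      exact h1)
    ext c
    have h2 := congrFun (congrFun this (finProdFinEquiv.symm c).1) (finProdFinEquiv.symm c).2
    simp only [Prod.mk.eta, Equiv.apply_symm_apply, Pi.zero_apply] at h2
    simpa using h2
  obtain ⟨κ, g, hg, hgs, hgl⟩ := exists_linearIndependent' ℂ v
  rw [hspan] at hgs
  let B := Module.Basis.mk hgl (by rw [hgs])
  haveI : Fintype κ := Module.Basis.fintypeIndexOfRankLtAleph0 B (by
    rw [← Module.finrank_eq_rank]; exact Cardinal.natCast_lt_aleph0)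
  have hcard : Fintype.card κ = 3*K := by
    rw [← Module.finrank_eq_card_basis B]; simp
  have hginj : Function.Injective (fun i => (g i).1) := fun i j h => hg (Subtype.ext h)
  set Q : Finset ℕ := Finset.univ.image (fun i => (g i).1) with hQ
  have hQc : Q.card = 3*K := by
    rw [hQ, Finset.card_image_of_injective _ hginj, Finset.card_univ, hcard]
  set t := Q.orderEmbOfFin hQc with ht
  have hmem : ∀ i, ∃ j, (g j).1 = t i := by
    intro i
    have := Finset.orderEmbOfFin_mem Q hQc i
    obtain ⟨j, _, hj⟩ := Finset.mem_image.1 this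
    exact ⟨j, hj⟩
  choose b hb using hmem
  have hbinj : Function.Injective b := by
    intro i j h
    apply t.injective
    rw [← hb i, ← hb j, h]
  refine ⟨t, t.strictMono, ?_, ?_⟩
  · intro i
    rw [← hb i]; exact (g (b i)).2
  · have hli := hgl.comp b hbinj
    have hrow : LinearIndependent ℂ (Matrix.of fun i c : Fin (3*K) => ent p ω β (t i) (finProdFinEquiv.symm c).1 (finProdFinEquiv.symm c).2).row := by
      have e : (Matrix.of fun i c : Fin (3*K) => ent p ω β (t i) (finProdFinEquiv.symm c).1 (finProdFinEquiv.symm c).2).row = (v ∘ g) ∘ b := by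
        ext i c
        simp only [Matrix.row, Matrix.of_apply, Function.comp, v]
        rw [hb i]
      rw [e]; exact hli
    have := Matrix.linearIndependent_rows_iff_isUnit.1 hrow
    exact (Matrix.isUnit_iff_isUnit_det _).1 this |>.ne_zero
end

section
theorem gauss_norm_ge (v : ℂ) (hv : v ∈ GaussianInt.toComplex.range) (h0 : v ≠ 0) : 1 ≤ ‖v‖ := by
  obtain ⟨g, rfl⟩ := hv
  have hg : g ≠ 0 := by rintro rfl; simp at h0
  have h1 : 1 ≤ Zsqrtd.norm g := by
    have := GaussianInt.norm_pos.2 hg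
    omega
  have h2 : ‖(GaussianInt.toComplex g)‖^2 = ((Zsqrtd.norm g : ℤ) : ℝ) := by
    rw [GaussianInt.intCast_real_norm, Complex.normSq_eq_norm_sq]
  have h3 : (1:ℝ) ≤ ((Zsqrtd.norm g : ℤ) : ℝ) := by exact_mod_cast h1
  rw [← h2] at h3
  exact (one_le_sq_iff₀ (norm_nonneg _)).1 h3

theorem ent_pair (p S : ℕ) (ω α α' : ℂ) (hα : α ≠ 0) (hα' : α' ≠ 0) (hω0 : ω ≠ 0)
    (hA : α ∈ GaussianInt.toComplex.range) (hA' : α' ∈ GaussianInt.toComplex.range)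
    (hω : ω ∈ GaussianInt.toComplex.range) (hω' : ω⁻¹ ∈ GaussianInt.toComplex.range) (n n' k : ℕ) 
    (hn : n % p < S) (hn' : n' % p < S) :
    ent p ω (α/α') n 0 k * ent p ω (α/α') n' 2 k * (α*α')^(S-1) ∈ GaussianInt.toComplex.range := by
  obtain ⟨u, hu⟩ := Nat.exists_eq_add_of_le (Nat.le_sub_one_of_lt hn)
  obtain ⟨u', hu'⟩ := Nat.exists_eq_add_of_le (Nat.le_sub_one_of_lt hn')
  have e : ent p ω (α/α') n 0 k * ent p ω (α/α') n' 2 k * (α*α')^(S-1) =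
     (Nat.choose n k : ℂ) * (Nat.choose n' k : ℂ) * ((ω⁻¹)^(n/p) * ω^(n'/p)) * (α'^(n%p) * α^u * (α^(n'%p) * α'^u')) := by
    have e1 : (α*α')^(S-1) = α^(n%p) * α^u * (α'^(n'%p) * α'^u') := by
      rw [mul_pow, ← pow_add, ← pow_add, ← hu, ← hu']
    rw [e1]
    unfold ent
    simp only [Fin.val_zero, Fin.val_two, Nat.cast_zero, Nat.cast_ofNat, zero_sub, zpow_neg, zpow_one]
    norm_num
    rw [div_pow, div_pow]
    field_simp
  rw [e]
  have hc : ∀ j : ℕ, (j:ℂ) ∈ GaussianInt.toComplex.range := fun j => natCast_mem _ j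
  exact mul_mem (mul_mem (mul_mem (hc _) (hc _)) (mul_mem (pow_mem hω' _) (pow_mem hω _)))
    (mul_mem (mul_mem (pow_mem hA' _) (pow_mem hA _)) (mul_mem (pow_mem hA _) (pow_mem hA' _)))

theorem det_lower (p K S : ℕ) (ω α α' : ℂ) (hα : α ≠ 0) (hα' : α' ≠ 0) (hω0 : ω ≠ 0)
    (hA : α ∈ GaussianInt.toComplex.range) (hA' : α' ∈ GaussianInt.toComplex.range)
    (hω : ω ∈ GaussianInt.toComplex.range) (hω' : ω⁻¹ ∈ GaussianInt.toComplex.range)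
    (t : Fin (3*K) → ℕ) (ht : ∀ i, t i % p < S)
    (hdet : (Matrix.of fun i c : Fin (3*K) => ent p ω (α/α') (t i) (finProdFinEquiv.symm c).1 (finProdFinEquiv.symm c).2).det ≠ 0) :
    1 ≤ ‖(Matrix.of fun i c : Fin (3*K) => ent p ω (α/α') (t i) (finProdFinEquiv.symm c).1 (finProdFinEquiv.symm c).2).det‖ * ‖α*α'‖^(K*(S-1)) := by
  rw [← norm_pow, ← norm_mul]
  refine gauss_norm_ge _ ?_ (mul_ne_zero hdet (pow_ne_zero _ (mul_ne_zero hα hα')))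
  rw [Matrix.det_apply', Finset.sum_mul]
  apply sum_mem
  intro τ _
  rw [mul_assoc]
  apply mul_mem (intCast_mem _ _)
  rw [← Equiv.prod_comp finProdFinEquiv, Fintype.prod_prod_type, Fin.prod_univ_three]
  simp only [Matrix.of_apply, Equiv.symm_apply_apply]
  have e : (α*α')^(K*(S-1)) = ∏ k : Fin K, (α*α')^(S-1) := by
    rw [Finset.prod_const, Finset.card_univ, Fintype.card_fin, ← pow_mul, mul_comm K]
  rw [e]
  have hr : ∀ a b c d : ℂ, a*b*c*d = (a*c*d)*b := by intros; ring
  rw [hr, ← Finset.prod_mul_distrib, ← Finset.prod_mul_distrib]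
  apply mul_mem
  · apply prod_mem
    intro k _
    exact ent_pair p S ω α α' hα hα' hω0 hA hA' hω hω' _ _ _ (ht _) (ht _)
  · apply prod_mem
    intro k _
    unfold ent
    simp only [Fin.val_one, Nat.cast_one, sub_self, zpow_zero, mul_one]
    exact natCast_mem _ _
end

section
open Polynomial

theorem bp_norm_le (K k : ℕ) (hk : k ≤ K) (c ρ : ℝ) (hc : 0 < c) (ζ : ℂ) (hζ : ‖ζ‖ ≤ ρ) :
    ‖(bp k).eval ζ‖ ≤ (c⁻¹)^k * Real.exp (c*(ρ+K)) := by
  have hρ : 0 ≤ ρ := le_trans (norm_nonneg _) hζ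
  have h1 : ‖(descPochhammer ℂ k).eval ζ‖ ≤ (ρ+K)^k := by
    rw [descPochhammer_eval_eq_prod_range, norm_prod]
    calc _ ≤ ∏ i ∈ Finset.range k, (ρ+K) := by
          apply Finset.prod_le_prod (fun _ _ => norm_nonneg _)
          intro i hi
          refine le_trans (norm_sub_le _ _) ?_
          have : ‖(i:ℂ)‖ ≤ K := by
            rw [Complex.norm_natCast]; exact_mod_cast (Finset.mem_range.1 hi).le.trans hk
          linarith
      _ = _ := by simp
  have h2 := Real.pow_div_factorial_le_exp (c*(ρ+K)) (by positivity) k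
  have h3 : ‖(bp k).eval ζ‖ ≤ (ρ+K)^k / k.factorial := by
    unfold bp
    rw [eval_mul, eval_C, norm_mul, norm_inv, Complex.norm_natCast, inv_mul_eq_div]
    gcongr
  refine h3.trans ?_
  calc (ρ+K)^k / k.factorial = (c⁻¹)^k * ((c*(ρ+K))^k/k.factorial) := by
        rw [mul_pow, inv_pow]; field_simp
    _ ≤ _ := by gcongr

theorem exp_diff (a b : ℝ) : ‖Complex.exp (Complex.I * a) - Complex.exp (Complex.I * b)‖ ≤ |a - b| := by
  have h : Complex.exp (Complex.I * a) - Complex.exp (Complex.I * b) = Complex.exp (Complex.I * b) * (Complex.exp (Complex.I * ((a-b:ℝ):ℂ)) - 1) := by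
    rw [mul_sub, ← Complex.exp_add, mul_one]; congr 2; push_cast; ring
  rw [h, norm_mul, mul_comm Complex.I, Complex.norm_exp_ofReal_mul_I, one_mul]
  exact Real.norm_exp_I_mul_ofReal_sub_one_le

theorem ent_err (p K R : ℕ) (x0 e ε c ρ : ℝ) (hc : 0 < c) (hp : 0 < p) (he : |e| ≤ ε) (n : ℕ) (hn : n < R*p) (hρ : ((R*p:ℕ):ℝ) ≤ ρ)
    (l : Fin 3) (k : ℕ) (hk : k ≤ K) :
    ‖ent p (Complex.exp (Complex.I * ((p*x0 - e : ℝ):ℂ))) (Complex.exp (Complex.I * (x0:ℂ))) n l k - (bp k).eval (n:ℂ) * Complex.exp (Complex.I * ((((l:ℕ):ℝ)-1)*x0 : ℝ) * (n:ℂ))‖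
      ≤ ε * R * ((c⁻¹)^k * Real.exp (c*(ρ+K))) := by
  have h0 : ‖(bp k).eval (n:ℂ)‖ ≤ (c⁻¹)^k * Real.exp (c*(ρ+K)) := by
    apply bp_norm_le K k hk c ρ hc
    rw [Complex.norm_natCast]
    exact le_trans (by exact_mod_cast hn.le) hρ
  have hε : 0 ≤ ε := (abs_nonneg _).trans he
  unfold ent
  rw [bp_eval] at h0 ⊢
  rw [← mul_sub, norm_mul, mul_comm]
  refine mul_le_mul ?_ h0 (norm_nonneg _) (by positivity)
  have hdm : (n:ℝ) = p * (n/p : ℕ) + (n%p : ℕ) := by exact_mod_cast (Nat.div_add_mod n p).symm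
  have e1 : (Complex.exp (Complex.I * ((p*x0 - e : ℝ):ℂ))^(n/p) * Complex.exp (Complex.I * (x0:ℂ))^(n%p))^(((l:ℕ):ℤ)-1) 
     = Complex.exp (Complex.I * (((((l:ℕ):ℝ)-1)*(x0*n - e*(n/p:ℕ)) : ℝ):ℂ)) := by
    rw [← Complex.exp_nat_mul, ← Complex.exp_nat_mul, ← Complex.exp_add, ← Complex.exp_int_mul]
    congr 1
    rw [hdm]
    push_cast
    ring
  have e2 : Complex.exp (Complex.I * ((((l:ℕ):ℝ)-1)*x0 : ℝ) * (n:ℂ)) = Complex.exp (Complex.I * (((((l:ℕ):ℝ)-1)*(x0*n) : ℝ):ℂ)) := by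
    congr 1; push_cast; ring
  rw [e1, e2]
  refine (exp_diff _ _).trans ?_
  have e3 : (((l:ℕ):ℝ)-1)*(x0*n - e*(n/p:ℕ)) - (((l:ℕ):ℝ)-1)*(x0*n) = -((((l:ℕ):ℝ)-1) * (e * (n/p:ℕ))) := by ring
  rw [e3, abs_neg, abs_mul, abs_mul]
  have h1 : |((l:ℕ):ℝ)-1| ≤ 1 := by fin_cases l <;> norm_num
  have h2 : |((n/p:ℕ):ℝ)| ≤ R := by
    rw [abs_of_nonneg (by positivity)]
    have : n/p < R := Nat.div_lt_of_lt_mul (by rw [mul_comm]; exact hn)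
    exact_mod_cast this.le
  calc _ ≤ 1 * (ε * R) := by gcongr
    _ = _ := one_mul _

theorem fun_bd (K : ℕ) (x0 c ρ : ℝ) (hc : 0 < c) (hx0 : 0 ≤ x0) (l : Fin 3) (k : ℕ) (hk : k ≤ K) (u : ℂ) (hu : ‖u‖ = ρ) :
    ‖(bp k).eval u * Complex.exp (Complex.I * ((((l:ℕ):ℝ)-1)*x0 : ℝ) * u)‖ ≤ (c⁻¹)^k * Real.exp (c*(ρ+K)) * Real.exp (|((l:ℕ):ℝ)-1| * x0 * ρ) := by
  rw [norm_mul]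
  refine mul_le_mul (bp_norm_le K k hk c ρ hc u hu.le) ?_ (norm_nonneg _) (by positivity)
  rw [Complex.norm_exp]
  apply Real.exp_le_exp.2
  refine (Complex.re_le_norm _).trans ?_
  rw [norm_mul, norm_mul, Complex.norm_I, hu, Complex.norm_real, Real.norm_eq_abs, abs_mul, abs_of_nonneg hx0, one_mul]

theorem prodA (K : ℕ) (c ρ x0 a : ℝ) : ∏ q : Fin (3*K), (a * ((c⁻¹)^((finProdFinEquiv.symm q).2:ℕ) * Real.exp (c*(ρ+K)) * Real.exp (|(((finProdFinEquiv.symm q).1:ℕ):ℝ)-1| * x0 * ρ)))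
    = a^(3*K) * (c⁻¹)^(3*(K*(K-1)/2)) * Real.exp (3*K*(c*(ρ+K)) + 2*K*(x0*ρ)) := by
  rw [← Equiv.prod_comp finProdFinEquiv, Fintype.prod_prod_type, Fin.prod_univ_three]
  simp only [Equiv.symm_apply_apply, Finset.prod_mul_distrib, Finset.prod_const, Finset.card_univ, Fintype.card_fin]
  have h : ∏ k : Fin K, (c⁻¹)^(k:ℕ) = (c⁻¹)^(K*(K-1)/2) := by
    rw [Finset.prod_pow_eq_pow_sum, Fin.sum_univ_eq_sum_range (fun i => i) K, Finset.sum_range_id]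
  rw [h]
  have e1 : Real.exp (3*K*(c*(ρ+K)) + 2*K*(x0*ρ)) = (Real.exp (c*(ρ+K))^K)^3 * (Real.exp (x0*ρ)^K)^2 := by
    rw [← Real.exp_nat_mul, ← Real.exp_nat_mul, ← Real.exp_nat_mul, ← Real.exp_nat_mul, ← Real.exp_add]
    congr 1; push_cast; ring
  rw [e1, pow_mul, pow_mul']
  norm_num
  ring

theorem det_upper (p K R : ℕ) (x0 e ε c D : ℝ) (hc : 0 < c) (hD : 0 < D) (hp : 0 < p) (hR : 0 < R) (he : |e| ≤ ε) (hx0 : 0 ≤ x0)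
    (t : Fin (3*K) → ℕ) (ht : StrictMono t) (htX : ∀ i, t i < R*p)
    (herr : ∀ j : ℕ, j < 3*K → ((j:ℝ)+1) * (2^j/j.factorial) * (ε * R) ≤ (D⁻¹)^j) :
    ‖(Matrix.of fun i q : Fin (3*K) => ent p (Complex.exp (Complex.I * ((p*x0 - e : ℝ):ℂ))) (Complex.exp (Complex.I * (x0:ℂ))) (t i) (finProdFinEquiv.symm q).1 (finProdFinEquiv.symm q).2).det‖
     ≤ ((3*K).factorial * (2^(3*K) * ((R*p:ℝ)/4)^((3*K)*(3*K-1)/2))) * ((3*K).factorial * ((D⁻¹)^((3*K)*(3*K-1)/2) * 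
       ((2*((R*p+D)/D))^(3*K) * (c⁻¹)^(3*(K*(K-1)/2)) * Real.exp (3*K*(c*(R*p+D+K)) + 2*K*(x0*(R*p+D)))))) := by
  set ρ : ℝ := R*p+D with hρ
  have hX : (0:ℝ) < R*p := by positivity
  have htinj : Function.Injective (fun i => (t i : ℂ)) := fun i j h => ht.injective (Nat.cast_injective (R := ℂ) h)
  have key := det_dd (fun i => (t i : ℂ)) htinj
    (Matrix.of fun i q : Fin (3*K) => ent p (Complex.exp (Complex.I * ((p*x0 - e : ℝ):ℂ))) (Complex.exp (Complex.I * (x0:ℂ))) (t i) (finProdFinEquiv.symm q).1 (finProdFinEquiv.symm q).2)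
    (fun q => 2*(ρ/D) * ((c⁻¹)^((finProdFinEquiv.symm q).2:ℕ) * Real.exp (c*(ρ+K)) * Real.exp (|(((finProdFinEquiv.symm q).1:ℕ):ℝ)-1| * x0 * ρ)))
    (fun j => (D⁻¹)^(j:ℕ)) (by
      intro j q
      simp only [Matrix.of_apply]
      generalize finProdFinEquiv.symm q = lk
      obtain ⟨l, k⟩ := lk
      simp only
      set f : ℂ → ℂ := fun u => (bp k).eval u * Complex.exp (Complex.I * ((((l:ℕ):ℝ)-1)*x0 : ℝ) * u) with hf
      set M := (c⁻¹)^(k:ℕ) * Real.exp (c*(ρ+K)) * Real.exp (|((l:ℕ):ℝ)-1| * x0 * ρ) with hM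
      have hMp : 0 < M := by positivity
      have h1 := dd_cauchy (fun i => (t i : ℂ)) htinj j (R*p) D M hX.le hD (by
        intro i; rw [Complex.norm_natCast]; exact_mod_cast (htX i).le) f (by
          rw [hf]
          exact (Polynomial.differentiable _).mul (by fun_prop)) (by
          intro u hu
          exact fun_bd K x0 c ρ hc hx0 l k k.2.le u hu)
      set g : Fin (3*K) → ℂ := fun i => ent p (Complex.exp (Complex.I * ((p*x0 - e : ℝ):ℂ))) (Complex.exp (Complex.I * (x0:ℂ))) (t i) l k - f (t i) with hg
      have h2 := dd_err t ht j g (ε * R * M) (by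
        intro i
        refine (ent_err p K R x0 e ε c ρ hc hp he (t i) (htX i) (by push_cast; rw [hρ]; linarith) l k k.2.le).trans ?_
        have : 1 ≤ Real.exp (|((l:ℕ):ℝ)-1| * x0 * ρ) := Real.one_le_exp (by positivity)
        have hε : 0 ≤ ε := (abs_nonneg _).trans he
        rw [hM]
        refine mul_le_mul_of_nonneg_left ?_ (by positivity)
        exact le_mul_of_one_le_right (by positivity) this)
      have hsum : ∀ i, Lagrange.nodalWeight (Finset.Iic j) (fun i => (t i : ℂ)) i * ent p (Complex.exp (Complex.I * ((p*x0 - e : ℝ):ℂ))) (Complex.exp (Complex.I * (x0:ℂ))) (t i) l k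
         = Lagrange.nodalWeight (Finset.Iic j) (fun i => (t i : ℂ)) i * f (t i) + Lagrange.nodalWeight (Finset.Iic j) (fun i => (t i : ℂ)) i * g i := by
        intro i; rw [hg]; ring
      rw [Finset.sum_congr rfl (fun i _ => hsum i), Finset.sum_add_distrib]
      refine (norm_add_le _ _).trans ?_
      have h3 := herr j j.2
      have h4 : ((j:ℕ):ℝ)+1 > 0 := by positivity
      have h5 : 1 ≤ ρ/D := by rw [le_div_iff₀ hD]; linarith
      have h6 : ((j:ℕ)+1:ℝ) * (2^(j:ℕ) / (j:ℕ).factorial * (ε*R*M)) ≤ (D⁻¹)^(j:ℕ) * (ρ/D) * M := by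
        calc _ = (((j:ℕ)+1:ℝ) * (2^(j:ℕ) / (j:ℕ).factorial) * (ε*R)) * M := by ring
          _ ≤ (D⁻¹)^(j:ℕ) * M := by gcongr
          _ ≤ _ := by
            apply mul_le_mul_of_nonneg_right _ hMp.le
            exact le_mul_of_one_le_right (by positivity) h5
      calc _ ≤ ρ/D * M * (D⁻¹)^(j:ℕ) + (D⁻¹)^(j:ℕ) * (ρ/D) * M := add_le_add h1 (h2.trans h6)
        _ = _ := by ring)
  refine key.trans ?_
  have hv : ‖(Matrix.vandermonde (fun i => (t i : ℂ))).det‖ ≤ (3*K).factorial * (2^(3*K) * ((R*p:ℝ)/4)^((3*K)*(3*K-1)/2)) := by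
    have := vand_bound (3*K) (fun i => (t i : ℝ)) (R*p) hX (fun i => ⟨by positivity, by exact_mod_cast (htX i).le⟩)
    have e : (Matrix.vandermonde (fun i => (t i : ℂ))).det = (((Matrix.vandermonde (fun i => (t i : ℝ))).det : ℝ) : ℂ) := by
      rw [Matrix.det_vandermonde, Matrix.det_vandermonde]; push_cast; rfl
    rw [e, Complex.norm_real]; exact this
  rw [prodA, Finset.prod_pow_eq_pow_sum, Fin.sum_univ_eq_sum_range (fun i => i) (3*K), Finset.sum_range_id]
  refine mul_le_mul_of_nonneg_right hv (by positivity)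
end

section
theorem numeric1 (p y R σ K : ℕ) (L lam : ℝ) (hp : 10000 ≤ p) (hy : p ≤ y) (hL : L = Real.log p) (hlam : lam = Real.log y)
    (hσ : σ = p/25) (hR : R = ⌈3*lam/L⌉₊) (hK : K = R*σ) :
    9 ≤ L ∧ L ≤ lam ∧ 3*lam ≤ R*L ∧ (R:ℝ)*L ≤ 4*lam ∧ 3 ≤ R ∧ 400 ≤ σ ∧ 1200 ≤ K ∧ (p:ℝ)/25 - 1 ≤ σ ∧ (σ:ℝ) ≤ p/25 := by
  have hp' : (10000:ℝ) ≤ p := by exact_mod_cast hp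
  have hL9 : 9 ≤ L := by
    rw [hL, Real.le_log_iff_exp_le (by positivity)]
    have : Real.exp 9 = Real.exp 1 ^ 9 := by rw [← Real.exp_nat_mul]; norm_num
    rw [this]
    have h := Real.exp_one_lt_d9
    calc Real.exp 1 ^ 9 ≤ 2.72^9 := by gcongr; linarith
      _ ≤ 10000 := by norm_num
      _ ≤ _ := hp'
  have hLl : L ≤ lam := by
    rw [hL, hlam]
    exact Real.log_le_log (by positivity) (by exact_mod_cast hy)
  have h1 : 3*lam/L ≤ R := by rw [hR]; exact Nat.le_ceil _
  have h2 : (R:ℝ) < 3*lam/L + 1 := by rw [hR]; exact Nat.ceil_lt_add_one (div_nonneg (by linarith) (by linarith))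
  have h3 : (3:ℝ) ≤ R := by
    refine le_trans ?_ h1
    rw [le_div_iff₀ (by linarith)]; linarith
  have hR3 : 3 ≤ R := by exact_mod_cast h3
  have hs4 : 400 ≤ σ := by omega
  refine ⟨hL9, hLl, ?_, ?_, hR3, hs4, ?_, ?_, ?_⟩
  · rwa [div_le_iff₀ (by linarith)] at h1
  · have : (R:ℝ)*L < (3*lam/L+1)*L := by gcongr
    have e : (3*lam/L+1)*L = 3*lam + L := by field_simp
    linarith
  · rw [hK]; nlinarith
  · have : p ≤ 25*σ + 24 := by omega
    have : (p:ℝ) ≤ 25*σ+24 := by exact_mod_cast this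
    linarith
  · have : 25*σ ≤ p := by omega
    have : (25:ℝ)*σ ≤ p := by exact_mod_cast this
    linarith

theorem exp_hundred (K : ℝ) (h : 1200 ≤ K) : 3*K ≤ Real.exp (K/100) := by
  have h2 : Real.exp 9 = Real.exp 1 ^ 9 := by rw [← Real.exp_nat_mul]; norm_num
  have h3 : (3600:ℝ) ≤ Real.exp 9 := by
    rw [h2]
    have h := Real.exp_one_gt_d9
    calc (3600:ℝ) ≤ 2.7^9 := by norm_num
      _ ≤ _ := by gcongr; linarith
  have h4 : Real.exp (K/100) = Real.exp 9 * Real.exp (K/100-9) := by rw [← Real.exp_add]; congr 1; ring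
  have h5 := Real.add_one_le_exp (K/100-9)
  rw [h4]
  calc 3*K ≤ 3600 * (K/100-9+1) := by linarith
    _ ≤ Real.exp 9 * Real.exp (K/100-9) := by gcongr; linarith

set_option maxHeartbeats 1000000 in
theorem numeric2 (p y R σ K : ℕ) (L lam x0 : ℝ) (hp : 10000 ≤ p) (hy : p ≤ y) (hL : L = Real.log p) (hlam : lam = Real.log y)
    (hσ : σ = p/25) (hR : R = ⌈3*lam/L⌉₊) (hK : K = R*σ) (hx0 : x0*p ≤ 4.725) (c D : ℝ) (hc : c = 3/(2*(p+3))) (hD : D = ((σ:ℝ)/3-1)*(R*p)) :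
    ((3*K).factorial * (2^(3*K) * ((R*p:ℝ)/4)^((3*K)*(3*K-1)/2))) * ((3*K).factorial * ((D⁻¹)^((3*K)*(3*K-1)/2) * 
       ((2*((R*p+D)/D))^(3*K) * (c⁻¹)^(3*(K*(K-1)/2)) * Real.exp (3*K*(c*(R*p+D+K)) + 2*K*(x0*(R*p+D)))))) * (y:ℝ)^(K*(3*σ+1)) < 1 := by
  obtain ⟨hL9, hLl, hRl, hRu, hR3, hs4, hK12, hsl, hsu⟩ := numeric1 p y R σ K L lam hp hy hL hlam hσ hR hK
  have hp' : (10000:ℝ) ≤ p := by exact_mod_cast hp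
  have hR' : (3:ℝ) ≤ R := by exact_mod_cast hR3
  have hs' : (400:ℝ) ≤ σ := by exact_mod_cast hs4
  have hK' : (1200:ℝ) ≤ K := by exact_mod_cast hK12
  have hKe : (K:ℝ) = R*σ := by exact_mod_cast hK
  have hpL : (p:ℝ) = Real.exp L := by rw [hL, Real.exp_log (by positivity)]
  have hyl : (y:ℝ) = Real.exp lam := by
    rw [hlam, Real.exp_log]
    have : 0 < y := by omega
    exact_mod_cast this
  set τ : ℝ := (σ:ℝ)/3-1 with hτ
  have hτ0 : 100 ≤ τ := by rw [hτ]; linarith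
  have hX : 0 < (R*p:ℝ) := by positivity
  have hDp : 0 < D := by rw [hD]; positivity
  set E := (3*K)*(3*K-1)/2 with hE
  have hEr : (E:ℝ) = 3*K*(3*K-1)/2 := by
    have h2 : 2 ∣ 3*K*(3*K-1) := even_iff_two_dvd.1 (Nat.even_mul_pred_self _)
    rw [hE, Nat.cast_div h2 (by norm_num)]
    push_cast [Nat.cast_sub (show 1 ≤ 3*K by omega)]; ring
  -- factor bounds
  have F1 : (y:ℝ)^(K*(3*σ+1)) ≤ Real.exp (K^2*L + K^2*(L/1200)) := by
    rw [hyl, ← Real.exp_nat_mul]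
    apply Real.exp_le_exp.2
    push_cast
    have h1 : (K:ℝ)*(3*σ+1)*(3*lam) ≤ K*(3*σ+1)*(R*L) := by gcongr
    have h2 : (K:ℝ)*(3*σ+1)*(R*L) = 3*(K^2*L) + K*R*L := by rw [hKe]; ring
    have h3 : (K:ℝ)*R*L ≤ 3*(K^2*(L/1200)) := by
      have : (R:ℝ)*400 ≤ K := by rw [hKe]; gcongr
      have : (K:ℝ)*L*(R*400) ≤ K*L*K := by gcongr
      nlinarith
    linarith
  have F2 : ((3*K).factorial:ℝ) ≤ Real.exp (0.03*K^2) := by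
    have h1 : ((3*K).factorial:ℝ) ≤ ((3*K:ℕ):ℝ)^(3*K) := by exact_mod_cast Nat.factorial_le_pow (3*K)
    refine h1.trans ?_
    have h2 := exp_hundred K hK'
    calc ((3*K:ℕ):ℝ)^(3*K) ≤ (Real.exp (K/100))^(3*K) := by
          gcongr; push_cast; exact h2
      _ = _ := by rw [← Real.exp_nat_mul]; congr 1; push_cast; ring
  have F3 : ((R*p:ℝ)/4)^E * (D⁻¹)^E ≤ Real.exp (-(E*(L-2.95))) := by
    rw [← mul_pow]
    have h1 : (R*p:ℝ)/4 * D⁻¹ = (4*τ)⁻¹ := by rw [hD]; field_simp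
    have h2 : (4*τ)⁻¹ ≤ Real.exp (-(L-2.95)) := by
      rw [Real.exp_neg]
      apply inv_anti₀ (Real.exp_pos _)
      rw [Real.exp_sub, ← hpL, div_le_iff₀ (Real.exp_pos _)]
      have h3 : (19:ℝ) ≤ Real.exp 2.95 := by
        have e : Real.exp 2.95 = Real.exp 1 ^ 3 * Real.exp (-0.05) := by
          rw [← Real.exp_nat_mul, ← Real.exp_add]; norm_num
        have h4 := Real.add_one_le_exp (-0.05:ℝ)
        have h5 := Real.exp_one_gt_d9
        rw [e]
        calc (19:ℝ) ≤ 2.718^3 * 0.95 := by norm_num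
          _ ≤ _ := by gcongr <;> linarith
      calc (p:ℝ) ≤ 4*τ*19 := by rw [hτ]; linarith
        _ ≤ _ := by gcongr
    rw [h1]
    calc ((4*τ)⁻¹)^E ≤ (Real.exp (-(L-2.95)))^E := by gcongr
      _ = _ := by rw [← Real.exp_nat_mul]; congr 1; ring
  have F4 : (2:ℝ)^(3*K) * (2*((R*p+D)/D))^(3*K) ≤ Real.exp (4.5*K) := by
    rw [← mul_pow]
    have h1 : 2*(2*((R*p+D)/D)) = 4*(1+1/τ) := by rw [hD]; field_simp; ring
    have h2 : 4*(1+1/τ) ≤ Real.exp 1.5 := by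
      have h3 : 1/τ ≤ 0.01 := by rw [div_le_iff₀ (by linarith)]; linarith
      have e : Real.exp 1.5 = Real.exp 1 * Real.exp 0.5 := by rw [← Real.exp_add]; norm_num
      have h4 : Real.exp 0.5 ≥ 1.5 := by have := Real.add_one_le_exp (0.5:ℝ); linarith
      have h5 := Real.exp_one_gt_d9
      have h6 : Real.exp 1 * Real.exp 0.5 ≥ 2.718*1.5 := by gcongr; linarith
      rw [e]; linarith
    rw [h1]
    calc _ ≤ (Real.exp 1.5)^(3*K) := by gcongr
      _ = _ := by rw [← Real.exp_nat_mul]; congr 1; push_cast; ring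
  have F5 : (c⁻¹)^(3*(K*(K-1)/2)) ≤ Real.exp (1.5*K^2*(L-0.4)) := by
    have h1 : c⁻¹ ≤ Real.exp (L-0.4) := by
      rw [Real.exp_sub, ← hpL, hc, inv_div, le_div_iff₀ (Real.exp_pos _)]
      have h2 : Real.exp 0.4 ≤ 1.499 := by
        have e : Real.exp 0.4 ^ 5 = Real.exp 1 ^ 2 := by rw [← Real.exp_nat_mul, ← Real.exp_nat_mul]; norm_num
        have h5 := Real.exp_one_lt_d9
        have : Real.exp 0.4 ^ 5 ≤ 1.499^5 := by
          rw [e]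
          calc Real.exp 1 ^ 2 ≤ 2.72^2 := by gcongr; linarith
            _ ≤ _ := by norm_num
        exact le_of_pow_le_pow_left₀ (by norm_num) (by norm_num) this
      calc _ ≤ 2*((p:ℝ)+3)/3 * 1.499 := by gcongr
        _ ≤ _ := by linarith
    have hc0 : 0 ≤ c⁻¹ := by rw [hc]; positivity
    calc _ ≤ (Real.exp (L-0.4))^(3*(K*(K-1)/2)) := by gcongr
      _ = Real.exp ((3*(K*(K-1)/2):ℕ) * (L-0.4)) := by rw [← Real.exp_nat_mul]
      _ ≤ _ := by
        apply Real.exp_le_exp.2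
        apply mul_le_mul_of_nonneg_right _ (by linarith)
        have : 2*(3*(K*(K-1)/2)) ≤ 3*K^2 := by
          have := Nat.div_mul_le_self (K*(K-1)) 2
          have h3 : K*(K-1) ≤ K^2 := by rw [pow_two]; exact Nat.mul_le_mul_left _ (by omega)
          omega
        have h4 : (2:ℝ)*((3*(K*(K-1)/2):ℕ):ℝ) ≤ 3*K^2 := by exact_mod_cast this
        linarith
  have F6 : Real.exp (3*K*(c*(R*p+D+K)) + 2*K*(x0*(R*p+D))) ≤ Real.exp (4.65*K^2) := by
    apply Real.exp_le_exp.2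
    have e1 : c*(R*p+D+K) = K/2 := by
      rw [hD, hc, hKe, hτ]; field_simp; ring
    have e2 : x0*(R*p+D) = (x0*p)*(K/3) := by rw [hD, hKe, hτ]; ring
    rw [e1, e2]
    calc 3*K*((K:ℝ)/2)+2*K*((x0*p)*(K/3)) ≤ 3*K*((K:ℝ)/2)+2*K*(4.725*(K/3)) := by gcongr
      _ = _ := by ring
  have hc0 : 0 < c⁻¹ := by rw [hc]; positivity
  calc _ = ((3*K).factorial:ℝ) * ((3*K).factorial) * (((R*p:ℝ)/4)^E * (D⁻¹)^E) * (2^(3*K) * (2*((R*p+D)/D))^(3*K)) * (c⁻¹)^(3*(K*(K-1)/2)) * Real.exp (3*K*(c*(R*p+D+K)) + 2*K*(x0*(R*p+D))) * (y:ℝ)^(K*(3*σ+1)) := by ring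
    _ ≤ Real.exp (0.03*K^2) * Real.exp (0.03*K^2) * Real.exp (-(E*(L-2.95))) * Real.exp (4.5*K) * Real.exp (1.5*K^2*(L-0.4)) * Real.exp (4.65*K^2) * Real.exp (K^2*L + K^2*(L/1200)) := by
        gcongr
    _ = Real.exp (0.03*K^2 + 0.03*K^2 + -(E*(L-2.95)) + 4.5*K + 1.5*K^2*(L-0.4) + 4.65*K^2 + (K^2*L + K^2*(L/1200))) := by
        simp only [Real.exp_add]
    _ < 1 := by
        rw [Real.exp_lt_one_iff, hEr]
        have hk1 : (K:ℝ) ≤ K^2/1200 := by nlinarith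
        have hk2 : (K:ℝ)*L ≤ K^2*L/1200 := by
          have : (K:ℝ)*L ≤ K^2/1200*L := by gcongr
          linarith
        have hk3 : (9:ℝ)*K^2 ≤ K^2*L := by nlinarith [sq_nonneg (K:ℝ)]
        have hk0 : (0:ℝ) < K^2 := by positivity
        nlinarith

theorem numeric3 (p y R σ K : ℕ) (L lam : ℝ) (hp : 10000 ≤ p) (hy : p ≤ y) (hL : L = Real.log p) (hlam : lam = Real.log y)
    (hσ : σ = p/25) (hR : R = ⌈3*lam/L⌉₊) (hK : K = R*σ) (D : ℝ) (hD : D = ((σ:ℝ)/3-1)*(R*p)) (j : ℕ) (hj : j < 3*K) :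
    ((j:ℝ)+1) * (2^j/j.factorial) * (Real.pi / (y:ℝ)^((p-1)/2) * R) ≤ (D⁻¹)^j := by
  obtain ⟨hL9, hLl, hRl, hRu, hR3, hs4, hK12, hsl, hsu⟩ := numeric1 p y R σ K L lam hp hy hL hlam hσ hR hK
  have hp' : (10000:ℝ) ≤ p := by exact_mod_cast hp
  have hR' : (3:ℝ) ≤ R := by exact_mod_cast hR3
  have hs' : (400:ℝ) ≤ σ := by exact_mod_cast hs4
  have hK' : (1200:ℝ) ≤ K := by exact_mod_cast hK12
  have hKe : (K:ℝ) = R*σ := by exact_mod_cast hK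
  have hpL : (p:ℝ) = Real.exp L := by rw [hL, Real.exp_log (by positivity)]
  have hy0 : (0:ℝ) < y := by
    have : 0 < y := by omega
    exact_mod_cast this
  have hyl : (y:ℝ) = Real.exp lam := by rw [hlam, Real.exp_log hy0]
  have hDp : 0 < D := by
    rw [hD]
    have : 0 < (σ:ℝ)/3-1 := by linarith
    positivity
  have hD2 : D ≤ K*p/3 := by
    rw [hD, hKe]
    have : 0 ≤ (R:ℝ)*p := by positivity
    nlinarith
  have hj' : (j:ℝ)+1 ≤ 3*K := by exact_mod_cast hj
  have h1 : (2*D)^j/j.factorial ≤ (2*p/9)^j * Real.exp (3*K) := by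
    have h2 := Real.pow_div_factorial_le_exp ((3*K:ℝ)) (by positivity) j
    calc (2*D)^j/j.factorial ≤ (2*p/9*(3*K))^j/j.factorial := by
          have : 2*D ≤ 2*p/9*(3*K) := by linarith
          gcongr
      _ = (2*p/9)^j * ((3*K)^j/j.factorial) := by rw [mul_pow]; ring
      _ ≤ _ := by gcongr
  have h2 : (2*(p:ℝ)/9)^j ≤ (2*(p:ℝ)/9)^(3*K) := pow_le_pow_right₀ (by linarith) hj.le
  have h3 : (2*(p:ℝ)/9)^(3*K) * Real.exp (3*K) ≤ Real.exp (3*K*L - K) := by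
    have h4 : 2*(p:ℝ)/9 ≤ Real.exp (L - 4/3) := by
      rw [Real.exp_sub, ← hpL, le_div_iff₀ (Real.exp_pos _)]
      have : Real.exp (4/3) ≤ 4.5 := by
        have e : Real.exp (4/3) ^ 3 = Real.exp 1 ^ 4 := by rw [← Real.exp_nat_mul, ← Real.exp_nat_mul]; norm_num
        have h5 := Real.exp_one_lt_d9
        have : Real.exp (4/3) ^ 3 ≤ 4.5^3 := by
          rw [e]
          calc Real.exp 1 ^ 4 ≤ 2.72^4 := by gcongr; linarith
            _ ≤ _ := by norm_num
        exact le_of_pow_le_pow_left₀ (by norm_num) (by norm_num) this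
      calc _ ≤ 2*(p:ℝ)/9*4.5 := by gcongr
        _ = _ := by ring
    calc _ ≤ (Real.exp (L-4/3))^(3*K) * Real.exp (3*K) := by gcongr
      _ = _ := by rw [← Real.exp_nat_mul, ← Real.exp_add]; congr 1; push_cast; ring
  have h4 : 3*K * Real.pi * R ≤ Real.exp K := by
    have h5 := exp_hundred K hK'
    have h6 : Real.pi ≤ 4 := Real.pi_le_four
    have h7 : (R:ℝ)*400 ≤ K := by rw [hKe]; gcongr
    have h8 : (R:ℝ) ≤ K := by linarith
    have h9 : R ≤ K := by exact_mod_cast h8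
    calc 3*K*Real.pi*R ≤ 3*K*4*K := by gcongr
      _ ≤ (3*K)*(3*K)*(3*K) := by nlinarith [mul_pos (show (0:ℝ) < K by linarith) (show (0:ℝ) < K by linarith)]
      _ ≤ Real.exp (K/100) * Real.exp (K/100) * Real.exp (K/100) := by gcongr
      _ = Real.exp (3*K/100) := by rw [← Real.exp_add, ← Real.exp_add]; congr 1; ring
      _ ≤ _ := by apply Real.exp_le_exp.2; linarith
  have h5 : Real.exp (3*K*L) ≤ (y:ℝ)^((p-1)/2) := by
    rw [hyl, ← Real.exp_nat_mul]
    apply Real.exp_le_exp.2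
    have h6 : ((p:ℝ)-2)/2 ≤ ((p-1)/2:ℕ) := by
      have : p ≤ 2*((p-1)/2) + 2 := by omega
      have : (p:ℝ) ≤ 2*((p-1)/2:ℕ) + 2 := by exact_mod_cast this
      linarith
    calc 3*K*L = 3*σ*(R*L) := by rw [hKe]; ring
      _ ≤ 3*(p/25)*(4*lam) := by gcongr
      _ ≤ (p-2)/2 * lam := by nlinarith
      _ ≤ _ := by gcongr; linarith
  have hyp : 0 < (y:ℝ)^((p-1)/2) := by positivity
  rw [inv_pow, le_inv_comm₀ (by positivity) (by positivity)]
  rw [show ((j:ℝ)+1) * (2^j/j.factorial) * (Real.pi / (y:ℝ)^((p-1)/2) * R) = (((j:ℝ)+1) * Real.pi * R) * (2^j/j.factorial) / (y:ℝ)^((p-1)/2) by ring]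
  rw [inv_div, le_div_iff₀ (by positivity)]
  calc D^j * ((((j:ℝ)+1) * Real.pi * R) * (2^j/j.factorial)) = (((j:ℝ)+1) * Real.pi * R) * ((2*D)^j/j.factorial) := by rw [mul_pow]; ring
    _ ≤ (3*K*Real.pi*R) * ((2*p/9)^(3*K) * Real.exp (3*K)) := by
        gcongr
        refine h1.trans ?_
        gcongr
    _ ≤ Real.exp K * Real.exp (3*K*L - K) := by gcongr
    _ = Real.exp (3*K*L) := by rw [← Real.exp_add]; congr 1; ring
    _ ≤ _ := h5
end

section
theorem arctan_lb (x : ℝ) (h0 : 0 ≤ x) (h1 : x ≤ 1) : x/2 ≤ Real.arctan x := by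
  have hmono : MonotoneOn (fun x : ℝ => Real.arctan x - x/2) (Set.Icc 0 1) := by
    apply monotoneOn_of_deriv_nonneg (convex_Icc _ _)
    · fun_prop
    · exact ((Real.differentiable_arctan).sub (differentiable_id.div_const 2)).differentiableOn
    · intro u hu
      rw [interior_Icc] at hu
      have : deriv (fun x : ℝ => Real.arctan x - x/2) u = 1/(1+u^2) - 1/2 := by
        have h1 := (Real.hasDerivAt_arctan u).sub ((hasDerivAt_id u).div_const 2)
        exact h1.deriv
      rw [this]
      have h2 : 1/2 ≤ 1/(1+u^2) := by
        apply one_div_le_one_div_of_le <;> nlinarith [hu.1, hu.2]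
      linarith
  have := hmono (Set.left_mem_Icc.2 zero_le_one) (Set.mem_Icc.2 ⟨h0, h1⟩) h0
  simp at this
  linarith

theorem partC (y p κ z w : ℕ) (hp : 10000 ≤ p) (hκ : κ = 1 ∨ κ = 3) (hw : 1 ≤ w) (hwz : w < z) (hy : z^2 + w^2 = y)
   (h : |(p:ℝ) * Real.arctan (w/z) - κ * (Real.pi/4)| ≤ Real.pi/2 / (y:ℝ)^((p-1)/2)) : False := by
  set θ := Real.arctan (w/z) with hθ
  have hp' : (10000:ℝ) ≤ p := by exact_mod_cast hp
  have hw' : (1:ℝ) ≤ w := by exact_mod_cast hw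
  have hwz' : (w:ℝ) < z := by exact_mod_cast hwz
  have hz' : (0:ℝ) < z := by linarith
  have hq0 : 0 < (w:ℝ)/z := by positivity
  have hq1 : (w:ℝ)/z < 1 := by rw [div_lt_one hz']; exact hwz'
  have hθ0 : 0 < θ := Real.arctan_pos.2 hq0
  have hθ1 : θ < Real.pi/4 := by rw [← Real.arctan_one]; exact Real.arctan_strictMono hq1
  have hpi := Real.pi_gt_three
  have hpi2 := Real.pi_lt_d6
  have hy5 : 5 ≤ y := by
    have : 2 ≤ z := by omega
    nlinarith
  have hy5' : (5:ℝ) ≤ y := by exact_mod_cast hy5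
  have hsmall : Real.pi/2/(y:ℝ)^((p-1)/2) ≤ 0.001 := by
    rw [div_le_iff₀ (by positivity)]
    have h1 : (y:ℝ)^5 ≤ (y:ℝ)^((p-1)/2) := pow_le_pow_right₀ (by linarith) (by omega)
    have h2 : (5:ℝ)^5 ≤ (y:ℝ)^5 := by gcongr
    have h3 : (5:ℝ)^5 = 3125 := by norm_num
    linarith
  have hκ3 : (κ:ℝ) ≤ 3 := by rcases hκ with h | h <;> rw [h] <;> norm_num
  have hpθ : p*θ ≤ 2.36 := by
    have := (abs_le.1 h).2
    have : (κ:ℝ)*(Real.pi/4) ≤ 3*(Real.pi/4) := by gcongr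
    linarith
  have hyp : p ≤ y := by
    have h1 := arctan_lb _ hq0.le hq1.le
    have h2 : (p:ℝ)*((w:ℝ)/z/2) ≤ 2.36 := by
      refine le_trans ?_ hpθ
      gcongr
    have h3 : (p:ℝ)*w ≤ 4.72*z := by
      have : (p:ℝ)*((w:ℝ)/z/2) = p*w/z/2 := by ring
      rw [this, div_le_iff₀ (by norm_num), div_le_iff₀ hz'] at h2
      linarith
    have h4 : (p:ℝ) ≤ 4.72*z := by nlinarith
    have h5 : (p:ℝ) ≤ z^2 := by nlinarith
    have h6 : p ≤ z^2 := by exact_mod_cast h5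
    nlinarith
  -- setup
  set x0 := 2*θ with hx0
  set e : ℝ := p*x0 - κ*(Real.pi/2) with he
  set σ := p/25 with hσ
  set L := Real.log p with hL
  set lam := Real.log y with hlam
  set R := ⌈3*lam/L⌉₊ with hR
  set K := R*σ with hK
  obtain ⟨hL9, hLl, hRl, hRu, hR3, hs4, hK12, hsl, hsu⟩ := numeric1 p y R σ K L lam hp hyp hL hlam hσ hR hK
  set D : ℝ := ((σ:ℝ)/3-1)*(R*p) with hD
  set c : ℝ := 3/(2*(p+3)) with hc
  have hs' : (400:ℝ) ≤ σ := by exact_mod_cast hs4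
  have hR' : (3:ℝ) ≤ R := by exact_mod_cast hR3
  have hDp : 0 < D := by
    have : 0 < (σ:ℝ)/3-1 := by linarith
    positivity
  set α : ℂ := (z:ℂ) + w * Complex.I with hα
  set α' : ℂ := (z:ℂ) - w * Complex.I with hα'
  have hz0 : (z:ℂ) ≠ 0 := by
    have : z ≠ 0 := by omega
    exact_mod_cast this
  have hαα : α*α' = (y:ℂ) := by
    rw [hα, hα', ← hy]; push_cast; linear_combination -(w:ℂ)^2 * Complex.I_sq
  have hy0 : (y:ℂ) ≠ 0 := by
    have : y ≠ 0 := by omega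
    exact_mod_cast this
  have hα0 : α ≠ 0 := fun h => hy0 (by rw [← hαα, h, zero_mul])
  have hα'0 : α' ≠ 0 := fun h => hy0 (by rw [← hαα, h, mul_zero])
  have hβ : α/α' = Complex.exp (Complex.I * (x0:ℂ)) := by
    have htan : Real.tan θ = w/z := by rw [hθ, Real.tan_arctan]
    have hcos : Real.cos θ ≠ 0 := (Real.cos_pos_of_mem_Ioo ⟨by linarith, by linarith⟩).ne'
    have hs : Real.sin θ * z = w * Real.cos θ := by
      rw [Real.tan_eq_sin_div_cos, div_eq_div_iff hcos hz'.ne'] at htan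
      exact htan
    have hsC : Complex.sin θ * z = w * Complex.cos θ := by exact_mod_cast hs
    have e1 : Complex.exp (Complex.I * (x0:ℂ)) = Complex.exp (θ * Complex.I) * Complex.exp (θ*Complex.I) := by
      rw [← Complex.exp_add]; congr 1; rw [hx0]; push_cast; ring
    have e2 : Complex.exp (θ * Complex.I) * Complex.exp (-θ * Complex.I) = 1 := by
      rw [← Complex.exp_add]; simp
    have e3 : Complex.exp (θ * Complex.I) * α' = Complex.exp (-θ * Complex.I) * α := by
      rw [Complex.exp_mul_I, Complex.exp_mul_I, Complex.cos_neg, Complex.sin_neg, hα, hα']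
      linear_combination 2*Complex.I*hsC
    rw [div_eq_iff hα'0, e1, mul_assoc, e3, ← mul_assoc, e2, one_mul]
  have hω : Complex.exp (Complex.I * ((p*x0 - e : ℝ):ℂ)) = Complex.I^κ := by
    have : (p*x0 - e : ℝ) = κ*(Real.pi/2) := by rw [he]; ring
    rw [this]
    have h2 : Complex.exp (Real.pi/2 * Complex.I) = Complex.I := Complex.exp_pi_div_two_mul_I
    calc _ = Complex.exp (Real.pi/2 * Complex.I)^κ := by
          rw [← Complex.exp_nat_mul]; congr 1; push_cast; ring
      _ = _ := by rw [h2]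
  have hβ1 : α/α' ≠ 1 := by
    intro h
    rw [div_eq_one_iff_eq hα'0, hα, hα'] at h
    have : (w:ℂ)*Complex.I = 0 := by linear_combination h/2
    have h1 : (w:ℂ) ≠ 0 := by
      have : w ≠ 0 := by omega
      exact_mod_cast this
    exact (mul_ne_zero h1 Complex.I_ne_zero) this
  have hβ2 : α/α' ≠ -1 := by
    intro h
    rw [div_eq_iff hα'0, hα, hα'] at h
    exact hz0 (by linear_combination h/2)
  obtain ⟨t, ht, htp, hdet⟩ := exists_rows p K R (3*σ+2) (Complex.I^κ) (α/α') (by omega) (by omega) (by omega)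
    (pow_ne_zero _ Complex.I_ne_zero) (div_ne_zero hα0 hα'0) hβ1 hβ2 (by
      have : R*(3*σ+2-2) = 3*K := by rw [hK]; simp; ring
      rw [this]; omega)
  have hI : Complex.I ∈ GaussianInt.toComplex.range := ⟨⟨0, 1⟩, by simp [GaussianInt.toComplex_def]⟩
  have hA : α ∈ GaussianInt.toComplex.range := add_mem (natCast_mem _ _) (mul_mem (natCast_mem _ _) hI)
  have hA' : α' ∈ GaussianInt.toComplex.range := sub_mem (natCast_mem _ _) (mul_mem (natCast_mem _ _) hI)
  have hlow := det_lower p K (3*σ+2) (Complex.I^κ) α α' hα0 hα'0 (pow_ne_zero _ Complex.I_ne_zero) hA hA' (pow_mem hI _) (by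
    rw [← inv_pow, Complex.inv_I]; exact pow_mem (neg_mem hI) _) t (fun i => (htp i).2) hdet
  have hup := det_upper p K R x0 e (Real.pi / (y:ℝ)^((p-1)/2)) c D (by positivity) hDp (by omega) (by omega) (by
      have : e = 2*(p*θ - κ*(Real.pi/4)) := by rw [he, hx0]; ring
      rw [this, abs_mul, abs_two]
      calc 2*|p*θ - κ*(Real.pi/4)| ≤ 2*(Real.pi/2/(y:ℝ)^((p-1)/2)) := by gcongr
        _ = _ := by ring) (by positivity) t ht (fun i => (htp i).1)
      (fun j hj => numeric3 p y R σ K L lam hp hyp hL hlam hσ hR hK D hD j hj)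
  rw [hω, ← hβ] at hup
  have hnum := numeric2 p y R σ K L lam x0 hp hyp hL hlam hσ hR hK (by rw [hx0]; linarith) c D hc hD
  rw [hαα, Complex.norm_natCast] at hlow
  have : (1:ℝ) < 1 := lt_of_le_of_lt (hlow.trans (mul_le_mul_of_nonneg_right hup (by positivity))) hnum
  exact lt_irrefl _ this
end

section
open Finset

/-- the nonzero squares modulo `p` -/
def QS (p : ℕ) [Fact p.Prime] : Finset (ZMod p) := univ.filter (fun j => quadraticChar (ZMod p) j = 1)

/-- coefficients of the product over residues in the group ring -/
def qc {R : Type*} [CommRing R] (p : ℕ) [Fact p.Prime] (u v : R) (k : ZMod p) : R :=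
  ∑ S ∈ (QS p).powerset, if ∑ j ∈ S, j = k then v ^ #S * u ^ #((QS p) \ S) else 0

section
variable {R : Type*} [CommRing R] (p : ℕ) [Fact p.Prime]

lemma mem_QS {j : ZMod p} : j ∈ QS p ↔ quadraticChar (ZMod p) j = 1 := by simp [QS]

lemma ne_zero_of_QS {j : ZMod p} (h : j ∈ QS p) : j ≠ 0 := by
  rw [mem_QS] at h
  rintro rfl
  simp at h

lemma QS_image {q : ZMod p} (hq : q ∈ QS p) : (QS p).image (q * ·) = QS p := by
  have hq0 := ne_zero_of_QS p hq
  rw [mem_QS] at hq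
  ext j
  simp only [mem_image, mem_QS]
  constructor
  · rintro ⟨i, hi, rfl⟩
    rw [map_mul, hq, hi, one_mul]
  · intro hj
    refine ⟨q⁻¹ * j, ?_, by field_simp⟩
    have : quadraticChar (ZMod p) (q * (q⁻¹ * j)) = 1 := by
      rw [← hj]; congr 1; field_simp
    rw [map_mul, hq, one_mul] at this
    exact this

lemma qc_inv (u v : R) {q : ZMod p} (hq : q ∈ QS p) (k : ZMod p) : qc p u v (q * k) = qc p u v k := by
  have hq0 := ne_zero_of_QS p hq
  have hinj : Function.Injective (q * · : ZMod p → ZMod p) := mul_right_injective₀ hq0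
  unfold qc
  symm
  refine sum_nbij (fun S => S.image (q * ·)) ?_ ?_ ?_ ?_
  · intro S hS
    rw [mem_powerset] at hS ⊢
    rw [← QS_image p hq]
    exact image_subset_image hS
  · intro S _ T _ h
    exact (image_injective hinj) h
  · intro T hT
    rw [mem_coe, mem_powerset, ← QS_image p hq, subset_image_iff] at hT
    obtain ⟨S, hS, rfl⟩ := hT
    exact ⟨S, by simpa using hS, rfl⟩
  · intro S hS
    have h1 : ∑ j ∈ S.image (q * ·), j = q * ∑ j ∈ S, j := by
      rw [sum_image (fun a _ b _ h => hinj h), mul_sum]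
    have h2 : #(QS p \ S.image (q * ·)) = #(QS p \ S) := by
      conv_lhs => rw [← QS_image p hq, ← image_sdiff _ _ hinj, card_image_of_injective _ hinj]
    have h3 : (∑ j ∈ S, j = k) ↔ (q * ∑ j ∈ S, j = q * k) := by
      constructor
      · rintro rfl; rfl
      · intro h; exact hinj h
    simp only [h1, h2, card_image_of_injective _ hinj, ← h3]

lemma qc_map {R' : Type*} [CommRing R'] (φ : R →+* R') (u v : R) (k : ZMod p) :
    qc p (φ u) (φ v) k = φ (qc p u v k) := by
  simp only [qc, map_sum]
  refine sum_congr rfl (fun S _ => ?_)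
  split_ifs <;> simp

lemma QS_sum (hp : 5 ≤ p) : ∑ j ∈ QS p, j = 0 := by
  have hq : (4 : ZMod p) ∈ QS p := by
    rw [mem_QS]
    have : (4 : ZMod p) = 2 ^ 2 := by norm_num
    rw [this]
    apply quadraticChar_sq_one'
    intro h
    have : ((2 : ℕ) : ZMod p) = 0 := by exact_mod_cast h
    rw [ZMod.natCast_eq_zero_iff] at this
    exact absurd (Nat.le_of_dvd (by norm_num) this) (by omega)
  have hinj : Function.Injective ((4 : ZMod p) * · : ZMod p → ZMod p) :=
    mul_right_injective₀ (ne_zero_of_QS p hq)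
  have h : ∑ j ∈ QS p, j = 4 * ∑ j ∈ QS p, j := by
    conv_lhs => rw [← QS_image p hq]
    rw [sum_image (fun a _ b _ h => hinj h), mul_sum]
  have h3 : (3 : ZMod p) * ∑ j ∈ QS p, j = 0 := by linear_combination -h
  rcases mul_eq_zero.mp h3 with h | h
  · have : ((3 : ℕ) : ZMod p) = 0 := by exact_mod_cast h
    rw [ZMod.natCast_eq_zero_iff] at this
    exact absurd (Nat.le_of_dvd (by norm_num) this) (by omega)
  · exact h

lemma qc_swap (hp : 5 ≤ p) (u v : R) (k : ZMod p) : qc p v u k = qc p u v (-k) := by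
  unfold qc
  refine sum_nbij' (fun S => QS p \ S) (fun S => QS p \ S) ?_ ?_ ?_ ?_ ?_
  · intro S _; simp
  · intro S _; simp
  · intro S hS; simp at hS; simp [hS]
  · intro S hS; simp at hS; simp [hS]
  · intro S hS
    rw [mem_powerset] at hS
    have h1 : ∑ j ∈ QS p \ S, j = - ∑ j ∈ S, j := by
      have := sum_sdiff (f := fun j : ZMod p => j) hS
      rw [QS_sum p hp] at this
      linear_combination this
    have h3 : (∑ j ∈ S, j = k) ↔ (∑ j ∈ QS p \ S, j = -k) := by rw [h1]; exact neg_inj.symm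
    simp only [h3, Finset.sdiff_sdiff_eq_self hS, mul_comm]

lemma qc_smul (c u v : R) (k : ZMod p) : qc p (c * u) (c * v) k = c ^ #(QS p) * qc p u v k := by
  simp only [qc, mul_sum]
  refine sum_congr rfl (fun S hS => ?_)
  rw [mem_powerset] at hS
  split_ifs
  · rw [← card_sdiff_add_card_eq_card hS]; ring
  · simp

lemma qc_eval (ψ : AddChar (ZMod p) R) (u v : R) :
    ∏ j ∈ QS p, (u + ψ j * v) = ∑ k, ψ k * qc p u v k := by
  have hψ : ∀ S : Finset (ZMod p), ψ (∑ j ∈ S, j) = ∏ j ∈ S, ψ j := by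
    intro S
    induction S using Finset.induction_on with
    | empty => simp
    | insert a s ha ih => rw [sum_insert ha, prod_insert ha, AddChar.map_add_eq_mul, ih]
  simp only [add_comm u, prod_add, qc, mul_sum]
  rw [sum_comm]
  refine sum_congr rfl (fun S hS => ?_)
  simp only [mul_ite, mul_zero]
  rw [sum_ite_eq]
  simp only [mem_univ, if_true, prod_mul_distrib, prod_const, hψ S]
  ring

end
end

section
open Finset

def qY {R : Type*} [CommRing R] (p : ℕ) [Fact p.Prime] (ν : ZMod p) (u v : R) : R :=
  2 * qc p u v 0 - qc p u v 1 - qc p u v ν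
def qZ {R : Type*} [CommRing R] (p : ℕ) [Fact p.Prime] (ν : ZMod p) (u v : R) : R :=
  qc p u v 1 - qc p u v ν

/-- the complex valued quadratic character -/
noncomputable def chiC (p : ℕ) [Fact p.Prime] : MulChar (ZMod p) ℂ :=
  (quadraticChar (ZMod p)).ringHomComp (Int.castRingHom ℂ)

section

lemma qc_nonres (p : ℕ) [Fact p.Prime] (ν : ZMod p) (hν : quadraticChar (ZMod p) ν = -1) {R : Type*} [CommRing R] (u v : R) {k : ZMod p} (hk : quadraticChar (ZMod p) k = -1) :
    qc p u v k = qc p u v ν := by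
  have hν0 : ν ≠ 0 := by rintro rfl; simp at hν
  have h : k * ν⁻¹ ∈ QS p := by
    rw [mem_QS]
    have : quadraticChar (ZMod p) (k * ν⁻¹ * ν) = -1 := by
      rw [← hk]; congr 1; field_simp
    rw [map_mul, hν] at this
    linarith
  rw [← qc_inv p u v h ν]
  congr 1; field_simp

lemma qc_res (p : ℕ) [Fact p.Prime] {R : Type*} [CommRing R] (u v : R) {k : ZMod p} (hk : quadraticChar (ZMod p) k = 1) :
    qc p u v k = qc p u v 1 := by
  rw [← qc_inv p u v ((mem_QS p).2 hk) 1, mul_one]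

lemma two_qc (p : ℕ) [Fact p.Prime] (ν : ZMod p) (hν : quadraticChar (ZMod p) ν = -1) (u v : ℂ) (k : ZMod p) : 2 * qc p u v k =
    (qc p u v 1 + qc p u v ν) * (1 - (if k = 0 then 1 else 0)) + qZ p ν u v * chiC p k
      + 2 * qc p u v 0 * (if k = 0 then 1 else 0) := by
  by_cases hk : k = 0
  · subst hk
    simp [chiC]
  · rcases quadraticChar_dichotomy hk with h | h
    · have : chiC p k = 1 := by simp only [chiC, MulChar.ringHomComp_apply, h]; simp
      rw [qc_res p u v h, this]
      simp [hk, qZ]; ring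
    · have : chiC p k = -1 := by simp only [chiC, MulChar.ringHomComp_apply, h]; simp
      rw [qc_nonres p ν hν u v h, this]
      simp [hk, qZ]; ring

lemma ev1 (p : ℕ) [Fact p.Prime] (ν : ZMod p) (hν : quadraticChar (ZMod p) ν = -1) (ψ : AddChar (ZMod p) ℂ) (hψ : ψ ≠ 1) (u v : ℂ) :
    2 * ∏ j ∈ QS p, (u + ψ j * v) = qY p ν u v + qZ p ν u v * gaussSum (chiC p) ψ := by
  rw [qc_eval, mul_sum]
  have hs : ∑ k, ψ k = 0 := AddChar.sum_eq_zero_of_ne_one hψ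
  have : ∀ k, 2 * (ψ k * qc p u v k) = (qc p u v 1 + qc p u v ν) * ψ k
     - (qc p u v 1 + qc p u v ν) * (if k = 0 then ψ k else 0) + qZ p ν u v * (chiC p k * ψ k)
     + 2 * qc p u v 0 * (if k = 0 then ψ k else 0) := by
    intro k
    have := two_qc p ν hν u v k
    split_ifs at this ⊢ <;> linear_combination ψ k * this
  simp only [this, sum_add_distrib, sum_sub_distrib, ← mul_sum, hs]
  simp only [sum_ite_eq', mem_univ, if_true, AddChar.map_zero_eq_one, qY, gaussSum]
  ring

lemma ev2 (p : ℕ) [Fact p.Prime] (ν : ZMod p) (hν : quadraticChar (ZMod p) ν = -1) (ψ : AddChar (ZMod p) ℂ) (hψ : ψ.IsPrimitive) (u v : ℂ) :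
    2 * ∏ j ∈ QS p, (u + ψ (ν * j) * v) = qY p ν u v - qZ p ν u v * gaussSum (chiC p) ψ := by
  have hν0 : ν ≠ 0 := by rintro rfl; simp at hν
  have h := ev1 p ν hν (ψ.mulShift ν) (hψ hν0) u v
  have hg := gaussSum_mulShift (chiC p) ψ (Units.mk0 ν hν0)
  have h1 : chiC p ν = -1 := by simp only [chiC, MulChar.ringHomComp_apply, hν]; simp
  simp only [Units.val_mk0, h1] at hg
  simp only [AddChar.mulShift_apply] at h
  rw [h, ← hg]; ring

lemma prod_split (p : ℕ) [Fact p.Prime] (ν : ZMod p) (hν : quadraticChar (ZMod p) ν = -1) (F : ZMod p → ℂ) : (∏ j ∈ QS p, F j) * ∏ j ∈ QS p, F (ν * j) = ∏ j ∈ univ.erase 0, F j := by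
  have hν0 : ν ≠ 0 := by rintro rfl; simp at hν
  have hinj : Function.Injective (ν * · : ZMod p → ZMod p) := mul_right_injective₀ hν0
  have h1 : ∏ j ∈ QS p, F (ν * j) = ∏ j ∈ (QS p).image (ν * ·), F j := by
    rw [prod_image (fun a _ b _ h => hinj h)]
  rw [h1, ← prod_union]
  · congr 1
    ext j
    simp only [mem_union, mem_image, mem_QS, mem_erase, mem_univ, and_true]
    constructor
    · rintro (h | ⟨i, hi, rfl⟩)
      · rintro rfl; simp at h
      · intro h
        rcases mul_eq_zero.mp h with h | h
        · exact hν0 h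
        · subst h; simp at hi
    · intro h
      rcases quadraticChar_dichotomy h with h' | h'
      · exact Or.inl h'
      · right
        refine ⟨ν⁻¹ * j, ?_, by field_simp⟩
        have : quadraticChar (ZMod p) (ν * (ν⁻¹ * j)) = -1 := by
          rw [← h']; congr 1; field_simp
        rw [map_mul, hν] at this
        linarith
  · rw [Finset.disjoint_left]
    intro j hj hj'
    rw [mem_QS] at hj
    rw [mem_image] at hj'
    obtain ⟨i, hi, rfl⟩ := hj'
    rw [mem_QS] at hi
    rw [map_mul, hi, hν] at hj
    norm_num at hj
end

lemma prod_all (p : ℕ) [Fact p.Prime] (hp : Odd p) (ψ : AddChar (ZMod p) ℂ) (ζ : ℂ) (hζ : IsPrimitiveRoot ζ p)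
    (hψ : ∀ k : ZMod p, ψ k = ζ ^ k.val) (u v : ℂ) :
    (u + v) * ∏ j ∈ univ.erase (0 : ZMod p), (u + ψ j * v) = u ^ p + v ^ p := by
  have h0 : (u + v) = u + ψ 0 * v := by simp
  rw [h0, mul_prod_erase univ (fun j => u + ψ j * v) (mem_univ _)]
  rw [hζ.pow_add_pow_eq_prod_add_mul _ _ hp]
  refine prod_nbij (fun j => ψ j) ?_ ?_ ?_ (fun _ _ => rfl)
  · intro j _
    rw [Polynomial.mem_nthRootsFinset (Fact.out : p.Prime).pos, hψ, ← pow_mul, mul_comm, pow_mul, hζ.pow_eq_one,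
      one_pow]
  · intro i _ j _ h
    simp only [hψ] at h
    exact ZMod.val_injective p (hζ.pow_inj (ZMod.val_lt _) (ZMod.val_lt _) h)
  · intro z hz
    rw [mem_coe, Polynomial.mem_nthRootsFinset (Fact.out : p.Prime).pos] at hz
    obtain ⟨i, hi, rfl⟩ := hζ.eq_pow_of_pow_eq_one hz
    refine ⟨(i : ZMod p), by simp, ?_⟩
    simp only [hψ]
    rw [ZMod.val_natCast_of_lt hi]

lemma prod_one (p : ℕ) [Fact p.Prime] (ψ : AddChar (ZMod p) ℂ) (ζ : ℂ) (hζ : IsPrimitiveRoot ζ p)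
    (hψ : ∀ k : ZMod p, ψ k = ζ ^ k.val) :
    ∏ j ∈ univ.erase (0 : ZMod p), (1 + ψ j * (-1)) = p := by
  obtain ⟨n, hn⟩ : ∃ n, p = n + 1 := ⟨p - 1, by have := (Fact.out : p.Prime).pos; omega⟩
  have h := IsPrimitiveRoot.prod_one_sub_pow_eq_order (n := n) (hn ▸ hζ)
  have : (p : ℂ) = n + 1 := by rw [hn]; push_cast; ring
  rw [this, ← h]
  refine prod_nbij' (fun j => j.val - 1) (fun k => ((k + 1 : ℕ) : ZMod p)) ?_ ?_ ?_ ?_ ?_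
  · intro j hj
    have h0 : j.val ≠ 0 := by simpa [ZMod.val_eq_zero] using hj
    have := ZMod.val_lt j
    rw [mem_range]; omega
  · intro k hk
    rw [mem_range] at hk
    rw [mem_erase]
    refine ⟨?_, mem_univ _⟩
    intro h
    rw [ZMod.natCast_eq_zero_iff] at h
    exact absurd (Nat.le_of_dvd (by omega) h) (by omega)
  · intro j hj
    have h0 : j.val ≠ 0 := by simpa [ZMod.val_eq_zero] using hj
    have : j.val - 1 + 1 = j.val := by omega
    simp only [this, ZMod.natCast_zmod_val]
  · intro k hk
    rw [mem_range] at hk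
    rw [ZMod.val_natCast_of_lt (by omega)]; rfl
  · intro j hj
    have h0 : j.val ≠ 0 := by simpa [ZMod.val_eq_zero] using hj
    have : j.val - 1 + 1 = j.val := by omega
    rw [hψ, this]; ring

/-- Summary over the complex numbers. -/
lemma ev_main (p : ℕ) [Fact p.Prime] (hp : Odd p) (ν : ZMod p) (hν : quadraticChar (ZMod p) ν = -1) :
    ∃ P : ℂ → ℂ → ℂ, (∀ u v, (u + v) * P u v = u ^ p + v ^ p) ∧ P 1 (-1) = p ∧
      (∀ u v : ℂ, qY p ν u v ^ 2 - (quadraticChar (ZMod p) (-1) : ℂ) * p * qZ p ν u v ^ 2 = 4 * P u v) ∧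
      (∀ u v : ℂ, ‖qY p ν u v‖ ≤ 2 * (‖u‖ + ‖v‖) ^ #(QS p)) ∧
      (∀ u v : ℂ, (p : ℝ) * ‖qZ p ν u v‖ ^ 2 ≤ 4 * ((‖u‖ + ‖v‖) ^ #(QS p)) ^ 2) := by
  have hpp : p.Prime := Fact.out
  set ζ := Complex.exp (2 * Real.pi * Complex.I / p) with hζd
  have hζ : IsPrimitiveRoot ζ p := Complex.isPrimitiveRoot_exp p hpp.ne_zero
  set ψ : AddChar (ZMod p) ℂ := AddChar.zmodChar p hζ.pow_eq_one with hψd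
  have hprim : ψ.IsPrimitive := AddChar.zmodChar_primitive_of_primitive_root p hζ
  have hψ : ∀ k : ZMod p, ψ k = ζ ^ k.val := fun k => AddChar.zmodChar_apply _ k
  have hne : ψ ≠ 1 := by
    have := hprim (a := 1) one_ne_zero
    simpa using this
  have hnorm : ∀ k, ‖ψ k‖ = 1 := by
    intro k
    rw [hψ, norm_pow, hζ.norm'_eq_one hpp.ne_zero, one_pow]
  have hchar : ringChar (ZMod p) ≠ 2 := by
    rw [ZMod.ringChar_zmod_n]; rintro rfl; exact absurd hp (by decide)
  have hg : gaussSum (chiC p) ψ ^ 2 = (quadraticChar (ZMod p) (-1) : ℂ) * p := by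
    have hq : (chiC p).IsQuadratic := (quadraticChar_isQuadratic (ZMod p)).comp _
    have h1 : chiC p ≠ 1 := by
      intro h
      have : chiC p ν = 1 := by
        rw [h, MulChar.one_apply]
        rw [isUnit_iff_ne_zero]
        rintro rfl; simp at hν
      simp only [chiC, MulChar.ringHomComp_apply, hν] at this
      norm_num at this
    rw [gaussSum_sq h1 hq hprim, ZMod.card]
    simp [chiC, MulChar.ringHomComp_apply]
  have hgn : ‖gaussSum (chiC p) ψ‖ ^ 2 = p := by
    rw [← norm_pow, hg]
    rcases quadraticChar_dichotomy (F := ZMod p) (a := -1) (by simp) with h | h <;> simp [h]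
  have e1 := ev1 p ν hν ψ hne
  have e2 := ev2 p ν hν ψ hprim
  have hb : ∀ u v (σ : ZMod p → ZMod p), ‖∏ j ∈ QS p, (u + ψ (σ j) * v)‖ ≤ (‖u‖ + ‖v‖) ^ #(QS p) := by
    intro u v σ
    rw [norm_prod, ← prod_const]
    refine prod_le_prod (fun _ _ => norm_nonneg _) (fun j _ => ?_)
    refine (norm_add_le _ _).trans ?_
    rw [norm_mul, hnorm, one_mul]
  refine ⟨fun u v => ∏ j ∈ univ.erase (0 : ZMod p), (u + ψ j * v),
    fun u v => prod_all p hp ψ ζ hζ hψ u v, prod_one p ψ ζ hζ hψ, ?_, ?_, ?_⟩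
  · intro u v
    simp only
    rw [← prod_split p ν hν (fun j => u + ψ j * v)]
    have a1 := e1 u v
    have a2 := e2 u v
    rw [← hg]
    linear_combination -(qY p ν u v - qZ p ν u v * gaussSum (chiC p) ψ) * a1 - 2 * (∏ j ∈ QS p, (u + ψ j * v)) * a2
  · intro u v
    have h : qY p ν u v = ∏ j ∈ QS p, (u + ψ j * v) + ∏ j ∈ QS p, (u + ψ (ν * j) * v) := by
      linear_combination (-1 / 2) * e1 u v - (1 / 2) * e2 u v
    rw [h]
    have := norm_add_le (∏ j ∈ QS p, (u + ψ j * v)) (∏ j ∈ QS p, (u + ψ (ν * j) * v))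
    have a1 := hb u v id
    have a2 := hb u v (ν * ·)
    simp only [id] at a1
    linarith
  · intro u v
    have h : qZ p ν u v * gaussSum (chiC p) ψ = ∏ j ∈ QS p, (u + ψ j * v) - ∏ j ∈ QS p, (u + ψ (ν * j) * v) := by
      linear_combination (-1 / 2) * e1 u v + (1 / 2) * e2 u v
    have := norm_sub_le (∏ j ∈ QS p, (u + ψ j * v)) (∏ j ∈ QS p, (u + ψ (ν * j) * v))
    have a1 := hb u v id
    have a2 := hb u v (ν * ·)
    simp only [id] at a1
    have h3 : ‖qZ p ν u v * gaussSum (chiC p) ψ‖ ≤ 2 * (‖u‖ + ‖v‖) ^ #(QS p) := by rw [h]; linarith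
    have h4 : ‖qZ p ν u v * gaussSum (chiC p) ψ‖ ^ 2 ≤ (2 * (‖u‖ + ‖v‖) ^ #(QS p)) ^ 2 := by
      gcongr
    rw [norm_mul, mul_pow, hgn] at h4
    linarith
end

section
open Finset

lemma card_QS (p : ℕ) [Fact p.Prime] (hp : Odd p) : #(QS p) = (p - 1) / 2 := by
  have hchar : ringChar (ZMod p) ≠ 2 := by
    rw [ZMod.ringChar_zmod_n]; rintro rfl; exact absurd hp (by decide)
  obtain ⟨ν, hν⟩ := quadraticChar_exists_neg_one hchar
  have h := prod_split p ν hν (fun _ => 2)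
  simp only [prod_const] at h
  rw [← pow_add, card_erase_of_mem (mem_univ _), card_univ, ZMod.card] at h
  have h2 : #(QS p) + #(QS p) = p - 1 := by
    have : (2 : ℕ) ^ (#(QS p) + #(QS p)) = 2 ^ (p - 1) := by exact_mod_cast h
    exact Nat.pow_right_injective le_rfl this
  omega

lemma qc_star (p : ℕ) [Fact p.Prime] (hp : 5 ≤ p) (s t : ℤ) (k : ZMod p) :
    star (qc p (⟨s, t⟩ : GaussianInt) ⟨t, s⟩ k) = (⟨0, -1⟩ : GaussianInt) ^ #(QS p) * qc p (⟨s, t⟩ : GaussianInt) ⟨t, s⟩ (-k) := by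
  have h1 : star (qc p (⟨s, t⟩ : GaussianInt) ⟨t, s⟩ k) =
      qc p (starRingEnd GaussianInt (⟨s, t⟩ : GaussianInt)) (starRingEnd GaussianInt ⟨t, s⟩) k := by
    rw [qc_map]; rfl
  have e1 : starRingEnd GaussianInt (⟨s, t⟩ : GaussianInt) = (⟨0, -1⟩ : GaussianInt) * ⟨t, s⟩ := by
    rw [starRingEnd_apply]; ext <;> simp
  have e2 : starRingEnd GaussianInt (⟨t, s⟩ : GaussianInt) = (⟨0, -1⟩ : GaussianInt) * ⟨s, t⟩ := by
    rw [starRingEnd_apply]; ext <;> simp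
  rw [h1, e1, e2, qc_smul, qc_swap p hp]

lemma qY_map {R R' : Type*} [CommRing R] [CommRing R'] (φ : R →+* R') (p : ℕ) [Fact p.Prime] (ν : ZMod p) (u v : R) :
    qY p ν (φ u) (φ v) = φ (qY p ν u v) := by
  simp [qY, qc_map, map_ofNat]
lemma qZ_map {R R' : Type*} [CommRing R] [CommRing R'] (φ : R →+* R') (p : ℕ) [Fact p.Prime] (ν : ZMod p) (u v : R) :
    qZ p ν (φ u) (φ v) = φ (qZ p ν u v) := by
  simp [qZ, qc_map]

/-- reduction modulo `s + t` -/
lemma mod_b (p : ℕ) [Fact p.Prime] (ν : ZMod p) (s t : ℤ) :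
    ((s + t : ℤ) : GaussianInt) ∣ qY p ν (⟨s, t⟩ : GaussianInt) ⟨t, s⟩ -
        (⟨s, t⟩ : GaussianInt) ^ #(QS p) * (qY p ν (1 : ℤ) (-1) : ℤ) ∧
    ((s + t : ℤ) : GaussianInt) ∣ qZ p ν (⟨s, t⟩ : GaussianInt) ⟨t, s⟩ -
        (⟨s, t⟩ : GaussianInt) ^ #(QS p) * (qZ p ν (1 : ℤ) (-1) : ℤ) := by
  set b : GaussianInt := ((s + t : ℤ) : GaussianInt) with hb
  let φ := Ideal.Quotient.mk (Ideal.span {b})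
  set u : GaussianInt := ⟨s, t⟩ with hu
  set v : GaussianInt := ⟨t, s⟩ with hv
  have hv' : φ v = φ (u * (-1)) := by
    rw [Ideal.Quotient.eq, Ideal.mem_span_singleton]
    refine ⟨⟨1, 1⟩, ?_⟩
    ext <;> simp [hb, hu, hv] <;> ring
  have key : ∀ k, φ (qc p u v k) = φ (u ^ #(QS p) * (qc p (1 : ℤ) (-1) k : ℤ)) := by
    intro k
    rw [← qc_map, hv', qc_map]
    have : qc p u (u * -1) k = qc p (u * 1) (u * -1) k := by rw [mul_one]
    rw [this, qc_smul]
    have h2 := qc_map p (Int.castRingHom GaussianInt) 1 (-1) k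
    simp only [map_one, map_neg, eq_intCast] at h2
    rw [h2]
  have fin : ∀ A B : GaussianInt, φ A = φ B → b ∣ A - B := by
    intro A B h
    rwa [Ideal.Quotient.eq, Ideal.mem_span_singleton] at h
  constructor
  · apply fin
    simp only [qY, map_sub, map_mul, map_ofNat, key, Int.cast_sub, Int.cast_mul, Int.cast_ofNat]
    ring
  · apply fin
    simp only [qZ, map_sub, map_mul, map_ofNat, key, Int.cast_sub, Int.cast_mul, Int.cast_ofNat]
    ring

lemma P_val (p : ℕ) (d : ℕ) (hp : p = 2 * d + 1) (s t y : ℤ) (hst : s + t ≠ 0) (hy : s ^ 2 + t ^ 2 = y)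
    (P : ℂ) (h : (GaussianInt.toComplex ⟨s, t⟩ + GaussianInt.toComplex ⟨t, s⟩) * P =
      (GaussianInt.toComplex ⟨s, t⟩) ^ p + (GaussianInt.toComplex ⟨t, s⟩) ^ p) :
    P = (-Complex.I) ^ d * (uu ((s - t) ^ 2 - (s + t) ^ 2) y d : ℤ) := by
  have hI : Complex.I ^ 2 = -1 := Complex.I_sq
  have him := (im_pow_odd (s - t) (s + t) y (by rw [← hy]; ring) d).1
  set W : ℤ := uu ((s - t) ^ 2 - (s + t) ^ 2) y d
  set π : ℂ := GaussianInt.toComplex ⟨s - t, s + t⟩ with hπ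
  have hπ' : π = (s - t) + (s + t) * Complex.I := by rw [hπ, GaussianInt.toComplex_def']; push_cast; ring
  have hu : GaussianInt.toComplex ⟨s, t⟩ = ((1 - Complex.I) / 2) * π := by
    rw [hπ', GaussianInt.toComplex_def']
    linear_combination ((s + t : ℂ) / 2) * hI
  have hv : GaussianInt.toComplex ⟨t, s⟩ = -(((1 - Complex.I) / 2) * (starRingEnd ℂ π)) := by
    rw [hπ', GaussianInt.toComplex_def']
    simp only [map_add, map_sub, map_mul, Complex.conj_I, map_intCast]
    linear_combination ((s + t : ℂ) / 2) * hI
  have hodd : Odd p := ⟨d, hp⟩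
  have hpow : π ^ p - (starRingEnd ℂ π) ^ p = 2 * Complex.I * (2 ^ d * (s + t) * W) := by
    rw [← map_pow (starRingEnd ℂ), Complex.sub_conj]
    have : π ^ p = GaussianInt.toComplex ((⟨s - t, s + t⟩ : GaussianInt) ^ (2 * d + 1)) := by
      rw [hπ, hp, map_pow]
    rw [this, ← GaussianInt.intCast_im, him]
    push_cast; ring
  have hsum : (GaussianInt.toComplex ⟨s, t⟩ + GaussianInt.toComplex ⟨t, s⟩) = (1 + Complex.I) * (s + t) := by
    simp only [GaussianInt.toComplex_def']; ring
  rw [hsum, hu, hv, Odd.neg_pow hodd, mul_pow, mul_pow] at h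
  have h2 : (1 + Complex.I) * (s + t) * P = ((1 - Complex.I) / 2) ^ p * (2 * Complex.I * (2 ^ d * (s + t) * W)) := by
    rw [h, ← hpow]; ring
  have h3 : ((1 - Complex.I) / 2) ^ p = (-Complex.I / 2) ^ d * ((1 - Complex.I) / 2) := by
    rw [hp, pow_succ, pow_mul]
    congr 2
    linear_combination (1 / 4) * hI
  rw [h3, div_pow] at h2
  have h4 : (1 + Complex.I) * (s + t : ℂ) ≠ 0 := by
    refine mul_ne_zero ?_ (by exact_mod_cast hst)
    intro h
    have := congrArg Complex.re h
    simp at this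
  apply mul_left_cancel₀ h4
  rw [h2]
  field_simp
  linear_combination (-(s + t) * W : ℂ) * hI
end

section
open Finset

lemma normsq_toC (s t y : ℤ) (hy : s ^ 2 + t ^ 2 = y) : ‖GaussianInt.toComplex ⟨s, t⟩‖ = Real.sqrt y := by
  rw [Complex.norm_def, GaussianInt.toComplex_def']
  congr 1
  simp [Complex.normSq_apply, ← hy]; ring

lemma negI_pow1 {R : Type*} [CommRing R] (x : R) (hx : x ^ 2 = -1) (d : ℕ) (hd : d % 4 = 1) : (-x) ^ d = -x := by
  obtain ⟨k, rfl⟩ : ∃ k, d = 4 * k + 1 := ⟨d / 4, by omega⟩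
  have : (-x) ^ 4 = 1 := by linear_combination (x ^ 2 - 1) * hx
  rw [pow_succ, pow_mul, this, one_pow, one_mul]

lemma negI_pow2 {R : Type*} [CommRing R] (x : R) (hx : x ^ 2 = -1) (d : ℕ) (hd : d % 4 = 2) : (-x) ^ d = -1 := by
  obtain ⟨k, rfl⟩ : ∃ k, d = 4 * k + 2 := ⟨d / 4, by omega⟩
  have : (-x) ^ 4 = 1 := by linear_combination (x ^ 2 - 1) * hx
  rw [pow_add, pow_mul, this, one_pow, one_mul, neg_sq, hx]

lemma sqrt_pow_bound (y : ℤ) (hy : 0 ≤ y) (d : ℕ) :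
    ((Real.sqrt y + Real.sqrt y) ^ d) ^ 2 = (4 * (y : ℝ)) ^ d := by
  rw [← pow_mul, mul_comm d 2, pow_mul]
  congr 1
  have : (0 : ℝ) ≤ y := by exact_mod_cast hy
  have := Real.sq_sqrt this
  linear_combination 4 * this

lemma case11 (p : ℕ) (hpp : p.Prime) (hp : p % 24 = 11) (s t y : ℤ) (hst : s + t ≠ 0)
    (hy : s ^ 2 + t ^ 2 = y) (h : uu ((s - t) ^ 2 - (s + t) ^ 2) y ((p - 1) / 2) = 1) :
    ∃ Y Z : ℤ, p * Z ^ 2 - Y ^ 2 = 2 ∧ (s + t) ∣ Y ∧ Y ^ 2 ≤ 2 * (4 * y) ^ ((p - 1) / 2) := by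
  haveI : Fact p.Prime := ⟨hpp⟩
  have hodd : Odd p := Nat.odd_iff.mpr (by omega)
  have hp5 : 5 ≤ p := by omega
  have hchar : ringChar (ZMod p) ≠ 2 := by
    rw [ZMod.ringChar_zmod_n]; omega
  have hm1 : quadraticChar (ZMod p) (-1) = -1 := by
    rw [quadraticChar_neg_one_iff_not_isSquare, FiniteField.isSquare_neg_one_iff, ZMod.card]
    omega
  have hcard := card_QS p hodd
  set d := (p - 1) / 2 with hd
  have hd4 : d % 4 = 1 := by omega
  obtain ⟨P, hP, -, hYZ, hYb, -⟩ := ev_main p hodd (-1) hm1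
  set u : GaussianInt := ⟨s, t⟩ with hu
  set v : GaussianInt := ⟨t, s⟩ with hv
  have hI : (-(⟨0, 1⟩ : GaussianInt)) ^ d = -⟨0, 1⟩ := negI_pow1 _ (by ext <;> simp [pow_two]) d hd4
  have hI' : (⟨0, -1⟩ : GaussianInt) = -(⟨0, 1⟩ : GaussianInt) := by ext <;> simp
  have hst' := qc_star p hp5 s t
  rw [hcard, hI', hI, ← hu, ← hv] at hst'
  have c0 := hst' 0
  have c1 := hst' 1
  have cn := hst' (-1)
  rw [neg_zero] at c0
  rw [neg_neg] at cn
  have sY : star (qY p (-1) u v) = -⟨0, 1⟩ * qY p (-1) u v := by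
    simp only [qY, star_sub, star_mul, c0, c1, cn, star_ofNat]; ring
  have sZ : star (qZ p (-1) u v) = ⟨0, 1⟩ * qZ p (-1) u v := by
    simp only [qZ, star_sub, c1, cn]; ring
  set A := qY p (-1) u v with hA
  set B := qZ p (-1) u v with hB
  have hAe : A.im = A.re := by
    have := congrArg Zsqrtd.re sY; simp at this; linarith
  have hBe : B.im = -B.re := by
    have := congrArg Zsqrtd.re sZ; simp at this; linarith
  have hPv := P_val p d (by omega) s t y hst hy _ (hP _ _)
  rw [h, negI_pow1 _ Complex.I_sq d hd4] at hPv
  have hm := hYZ (GaussianInt.toComplex u) (GaussianInt.toComplex v)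
  rw [qY_map, qZ_map, hm1, ← hA, ← hB, hPv, GaussianInt.toComplex_def A, GaussianInt.toComplex_def B, hAe, hBe] at hm
  have hI2 := Complex.I_sq
  refine ⟨A.re, B.re, ?_, ?_, ?_⟩
  · have : ((p * B.re ^ 2 - A.re ^ 2 : ℤ) : ℂ) * (-2 * Complex.I) = ((2 : ℤ) : ℂ) * (-2 * Complex.I) := by
      push_cast at hm ⊢
      linear_combination hm - (A.re ^ 2 + p * B.re ^ 2 : ℂ) * hI2
    have h2 : (-2 * Complex.I : ℂ) ≠ 0 := by simp
    exact_mod_cast mul_right_cancel₀ h2 this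
  · have hb := (mod_b p (-1) s t).1
    have he : qY p (-1) (1 : ℤ) (-1) = 0 := by
      have key : ∀ k, qc p (1 : ℤ) (-1) (-k) = - qc p (1 : ℤ) (-1) k := by
        intro k
        rw [← qc_swap p hp5]
        have := qc_smul p (-1 : ℤ) 1 (-1) k
        rw [hcard, Odd.neg_one_pow (Nat.odd_iff.mpr (by omega))] at this
        simpa using this
      have k0 := key 0
      have k1 := key 1
      rw [neg_zero] at k0
      simp only [qY]
      linarith
    rw [he] at hb
    simp only [Int.cast_zero, mul_zero, sub_zero] at hb
    rw [← hu, ← hv, ← hA, Zsqrtd.intCast_dvd] at hb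
    exact hb.1
  · have hyb := hYb (GaussianInt.toComplex u) (GaussianInt.toComplex v)
    rw [normsq_toC s t y hy, normsq_toC t s y (by rw [← hy]; ring), qY_map, ← hA, hcard] at hyb
    have hy0 : 0 ≤ y := by rw [← hy]; positivity
    have h1 : ‖GaussianInt.toComplex A‖ ^ 2 = 2 * (A.re : ℝ) ^ 2 := by
      rw [Complex.sq_norm, GaussianInt.toComplex_def, hAe]
      simp [Complex.normSq_apply]; ring
    have h2 : ‖GaussianInt.toComplex A‖ ^ 2 ≤ (2 * (Real.sqrt y + Real.sqrt y) ^ d) ^ 2 := by gcongr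
    rw [h1, mul_pow, sqrt_pow_bound y hy0] at h2
    have : ((A.re ^ 2 : ℤ) : ℝ) ≤ ((2 * (4 * y) ^ d : ℤ) : ℝ) := by push_cast; linarith
    exact_mod_cast this

lemma case5 (p : ℕ) (hpp : p.Prime) (hp : p % 24 = 5) (s t y : ℤ) (hst : s + t ≠ 0)
    (hy : s ^ 2 + t ^ 2 = y) (h : uu ((s - t) ^ 2 - (s + t) ^ 2) y ((p - 1) / 2) = -1) :
    ∃ Y Z Y0 Z0 : ℤ, Y ^ 2 - p * Z ^ 2 = -4 ∧ Y0 ^ 2 - p * Z0 ^ 2 = 4 * p ∧ (s + t) ∣ Y * Z0 - Z * Y0 ∧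
      Y ^ 2 ≤ 4 * (4 * y) ^ ((p - 1) / 2) ∧ p * Z ^ 2 ≤ 4 * (4 * y) ^ ((p - 1) / 2) ∧
      Y0 ^ 2 ≤ 4 * 4 ^ ((p - 1) / 2) ∧ p * Z0 ^ 2 ≤ 4 * 4 ^ ((p - 1) / 2) := by
  haveI : Fact p.Prime := ⟨hpp⟩
  have hodd : Odd p := Nat.odd_iff.mpr (by omega)
  have hp5 : 5 ≤ p := by omega
  have hchar : ringChar (ZMod p) ≠ 2 := by
    rw [ZMod.ringChar_zmod_n]; omega
  have hm1 : quadraticChar (ZMod p) (-1) = 1 := by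
    rw [quadraticChar_one_iff_isSquare (by simp), FiniteField.isSquare_neg_one_iff, ZMod.card]
    omega
  obtain ⟨ν, hν⟩ := quadraticChar_exists_neg_one hchar
  have hcard := card_QS p hodd
  set d := (p - 1) / 2 with hd
  have hd4 : d % 4 = 2 := by omega
  obtain ⟨P, hP, hP1, hYZ, hYb, hZb⟩ := ev_main p hodd ν hν
  set u : GaussianInt := ⟨s, t⟩ with hu
  set v : GaussianInt := ⟨t, s⟩ with hv
  have hI : (-(⟨0, 1⟩ : GaussianInt)) ^ d = -1 := negI_pow2 _ (by ext <;> simp [pow_two]) d hd4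
  have hI' : (⟨0, -1⟩ : GaussianInt) = -(⟨0, 1⟩ : GaussianInt) := by ext <;> simp
  have hst' : ∀ k, star (qc p u v k) = - qc p u v k := by
    intro k
    have h1 := qc_star p hp5 s t k
    rw [hcard, hI', hI, ← hu, ← hv] at h1
    have h2 := qc_inv p u v ((mem_QS p).2 hm1) k
    rw [h1, ← h2]; simp
  have sY : star (qY p ν u v) = - qY p ν u v := by
    simp only [qY, star_sub, star_mul, hst', star_ofNat]; ring
  have sZ : star (qZ p ν u v) = - qZ p ν u v := by
    simp only [qZ, star_sub, hst']; ring
  have hbY := (mod_b p ν s t).1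
  have hbZ := (mod_b p ν s t).2
  rw [← hu, ← hv] at hbY hbZ
  set A := qY p ν u v with hA
  set B := qZ p ν u v with hB
  set A0 := qY p ν (1 : ℤ) (-1) with hA0
  set B0 := qZ p ν (1 : ℤ) (-1) with hB0
  have hAe : A.re = 0 := by
    have := congrArg Zsqrtd.re sY; simp at this; linarith
  have hBe : B.re = 0 := by
    have := congrArg Zsqrtd.re sZ; simp at this; linarith
  have hPv := P_val p d (by omega) s t y hst hy _ (hP _ _)
  rw [h, negI_pow2 _ Complex.I_sq d hd4] at hPv
  have hm := hYZ (GaussianInt.toComplex u) (GaussianInt.toComplex v)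
  rw [qY_map, qZ_map, hm1, ← hA, ← hB, hPv, GaussianInt.toComplex_def A, GaussianInt.toComplex_def B, hAe, hBe] at hm
  have hA0C : qY p ν (1 : ℂ) (-1) = A0 := by
    have := qY_map (Int.castRingHom ℂ) p ν 1 (-1)
    simpa using this
  have hB0C : qZ p ν (1 : ℂ) (-1) = B0 := by
    have := qZ_map (Int.castRingHom ℂ) p ν 1 (-1)
    simpa using this
  have hm0 := hYZ 1 (-1)
  rw [hA0C, hB0C, hP1, hm1] at hm0
  have hI2 := Complex.I_sq
  have hy0 : 0 ≤ y := by rw [← hy]; positivity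
  have hyb := hYb (GaussianInt.toComplex u) (GaussianInt.toComplex v)
  rw [normsq_toC s t y hy, normsq_toC t s y (by rw [← hy]; ring), qY_map, ← hA, hcard] at hyb
  have hzb := hZb (GaussianInt.toComplex u) (GaussianInt.toComplex v)
  rw [normsq_toC s t y hy, normsq_toC t s y (by rw [← hy]; ring), qZ_map, ← hB, hcard, sqrt_pow_bound y hy0] at hzb
  have hyb0 := hYb 1 (-1)
  have hzb0 := hZb 1 (-1)
  rw [hA0C, hcard] at hyb0
  rw [hB0C, hcard] at hzb0
  have nrm : ∀ A : GaussianInt, A.re = 0 → ‖GaussianInt.toComplex A‖ ^ 2 = (A.im : ℝ) ^ 2 := by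
    intro A hA
    rw [Complex.sq_norm, GaussianInt.toComplex_def, hA]
    simp [Complex.normSq_apply]; ring
  have nrm0 : ∀ n : ℤ, ‖(n : ℂ)‖ ^ 2 = (n : ℝ) ^ 2 := by
    intro n
    rw [Complex.norm_intCast, sq_abs]
  refine ⟨A.im, B.im, A0, B0, ?_, ?_, ?_, ?_, ?_, ?_, ?_⟩
  · have : ((A.im ^ 2 - p * B.im ^ 2 : ℤ) : ℂ) = ((-4 : ℤ) : ℂ) := by
      push_cast at hm ⊢
      linear_combination -hm + (A.im ^ 2 - p * B.im ^ 2 : ℂ) * hI2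
    exact_mod_cast this
  · have : ((A0 ^ 2 - p * B0 ^ 2 : ℤ) : ℂ) = ((4 * p : ℤ) : ℂ) := by
      push_cast at hm0 ⊢
      linear_combination hm0
    exact_mod_cast this
  · have h1 : ((s + t : ℤ) : GaussianInt) ∣ A * B0 - B * A0 := by
      have := dvd_sub (Dvd.dvd.mul_right hbY (B0 : GaussianInt)) (Dvd.dvd.mul_right hbZ (A0 : GaussianInt))
      convert this using 1
      ring
    rw [Zsqrtd.intCast_dvd] at h1
    have := h1.2
    simpa using this
  · have h2 : ‖GaussianInt.toComplex A‖ ^ 2 ≤ (2 * (Real.sqrt y + Real.sqrt y) ^ d) ^ 2 := by gcongr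
    rw [nrm A hAe, mul_pow, sqrt_pow_bound y hy0] at h2
    have : ((A.im ^ 2 : ℤ) : ℝ) ≤ ((4 * (4 * y) ^ d : ℤ) : ℝ) := by push_cast; linarith
    exact_mod_cast this
  · rw [nrm B hBe] at hzb
    exact_mod_cast hzb
  · have h2 : ‖(A0 : ℂ)‖ ^ 2 ≤ (2 * (‖(1 : ℂ)‖ + ‖(-1 : ℂ)‖) ^ d) ^ 2 := by gcongr
    rw [nrm0, norm_neg, norm_one, mul_pow, ← pow_mul, mul_comm d 2, pow_mul] at h2
    norm_num at h2
    exact_mod_cast h2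
  · rw [nrm0, norm_neg, norm_one, ← pow_mul, mul_comm d 2, pow_mul] at hzb0
    norm_num at hzb0
    exact_mod_cast hzb0
end

section
lemma pell_cong {d : ℤ} (T : Pell.Solution₁ d) (n : ℕ) :
    ∃ a b c : ℤ, (T ^ n).x = T.x ^ n + a * T.y ^ 2 ∧ (T ^ n).y = b * T.y ∧
      T.x * (T ^ n).y = n * T.x ^ n * T.y + c * T.y ^ 2 := by
  induction n with
  | zero => exact ⟨0, 0, 0, by simp, by simp, by simp⟩
  | succ n ih =>
    obtain ⟨a, b, c, h1, h2, h3⟩ := ih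
    refine ⟨a * T.x + d * b, b * T.x + (T ^ n).x, c * T.x + T.y * T.x * a, ?_, ?_, ?_⟩
    · rw [pow_succ, Pell.Solution₁.x_mul, h1, h2]; ring
    · rw [pow_succ, Pell.Solution₁.y_mul, h2]; ring
    · rw [pow_succ, Pell.Solution₁.y_mul, h1]
      push_cast
      linear_combination T.x * h3

lemma pell_three (d : ℤ) (j : ℕ) : ∀ (T : Pell.Solution₁ d) (k n : ℕ), 1 ≤ k → (3 : ℤ) ^ k ∣ T.y → ¬ (3 : ℤ) ^ (k + 1) ∣ T.y →
    (3 : ℤ) ^ (k + j) ∣ (T ^ n).y → 3 ^ j ∣ n := by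
  induction j with
  | zero => intros; simp
  | succ j ih =>
    intro T k n hk h1 h2 h3
    have hx : ¬ (3 : ℤ) ∣ T.x := by
      intro h
      have hy : (3 : ℤ) ∣ T.y := (dvd_pow_self 3 (by omega)).trans h1
      have := T.prop
      have h9 : (3 : ℤ) ∣ 1 := by
        rw [← this]
        exact dvd_sub (h.trans (dvd_pow_self _ two_ne_zero)) ((hy.trans (dvd_pow_self _ two_ne_zero)).mul_left _)
      norm_num at h9
    have hp3 : Prime (3 : ℤ) := Int.prime_three
    obtain ⟨y', hy'⟩ := h1
    have hy'3 : ¬ (3 : ℤ) ∣ y' := by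
      rintro ⟨z, rfl⟩
      exact h2 ⟨z, by rw [hy', pow_succ]; ring⟩
    have hn : 3 ∣ n := by
      obtain ⟨a, b, c, -, -, e⟩ := pell_cong T n
      have h4 : (3 : ℤ) ^ (k + 1) ∣ (T ^ n).y := (pow_dvd_pow 3 (by omega)).trans h3
      have h5 : (3 : ℤ) ^ (k + 1) ∣ n * T.x ^ n * T.y := by
        have : (n * T.x ^ n * T.y : ℤ) = T.x * (T ^ n).y - c * T.y ^ 2 := by rw [e]; ring
        rw [this]
        refine dvd_sub (h4.mul_left _) (Dvd.dvd.mul_left ?_ _)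
        rw [hy', mul_pow, ← pow_mul]
        exact (pow_dvd_pow 3 (by omega)).mul_right _
      rw [hy', pow_succ] at h5
      have h6 : (3 : ℤ) ∣ n * T.x ^ n * y' := by
        have h7 : (3 : ℤ) ^ k * 3 ∣ 3 ^ k * (n * T.x ^ n * y') := by convert h5 using 1; ring
        exact (mul_dvd_mul_iff_left (by positivity)).mp h7
      rcases hp3.dvd_or_dvd h6 with h | h
      · rcases hp3.dvd_or_dvd h with h | h
        · exact_mod_cast h
        · exact absurd (hp3.dvd_of_dvd_pow h) hx
      · exact absurd h hy'3
    obtain ⟨n', rfl⟩ := hn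
    rw [pow_mul] at h3
    have hT3 : (T ^ 3).y = T.y * (3 + 4 * d * T.y ^ 2) := by
      have : T ^ 3 = T * T * T := by rw [pow_succ, pow_two]
      rw [this]
      simp only [Pell.Solution₁.y_mul, Pell.Solution₁.x_mul]
      have := T.prop
      linear_combination 3 * T.y * this
    have h9 : ∃ z, 3 + 4 * d * T.y ^ 2 = 3 * (1 + 3 * z) := by
      refine ⟨4 * d * 3 ^ (2 * k - 2) * y' ^ 2, ?_⟩
      rw [hy']
      have : (3 : ℤ) ^ (2 * k) = 9 * 3 ^ (2 * k - 2) := by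
        obtain ⟨k', rfl⟩ : ∃ k', k = k' + 1 := ⟨k - 1, by omega⟩
        have : 2 * (k' + 1) - 2 = 2 * k' := by omega
        rw [this, mul_add, pow_add]; ring
      linear_combination 4 * d * y' ^ 2 * this
    obtain ⟨z, hz⟩ := h9
    have := ih (T ^ 3) (k + 1) n' (by omega) ⟨y' * (1 + 3 * z), by rw [hT3, hz, hy', pow_succ]; ring⟩ ?_
      (by convert h3 using 2; ring)
    · rw [pow_succ, mul_comm]
      exact mul_dvd_mul_left 3 this
    · rintro ⟨q, hq⟩
      rw [hT3, hz, hy'] at hq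
      have : (3 : ℤ) ^ (k + 1) * (y' * (1 + 3 * z)) = 3 ^ (k + 1) * (3 * q) := by
        rw [pow_succ] at hq ⊢; rw [pow_succ] at hq; linear_combination hq
      have h5 := mul_left_cancel₀ (by positivity) this
      rcases hp3.dvd_or_dvd (Dvd.intro q h5.symm) with h | h
      · exact hy'3 h
      · omega

lemma pell_bound (p : ℕ) (hpp : p.Prime) (hp : p % 3 = 2) (g h : ℤ) (v : ℕ) (hg : 0 < g) (hh : 0 ≤ h)
    (hgh : g ^ 2 - p * h ^ 2 = 1) (hv : ¬ (3 : ℤ) ^ (v + 1) ∣ g * h) (X W : ℤ) (M : ℕ) (hX : 0 < X) (hW : W ≠ 0)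
    (hXW : X ^ 2 - p * W ^ 2 = 1) (hM : (3 : ℤ) ^ M ∣ W) : (p : ℤ) ^ (3 ^ (M - v)) ≤ X ^ 2 := by
  have hp0 : (0 : ℤ) < p := by exact_mod_cast hpp.pos
  have hns : ¬ IsSquare (p : ℤ) := by
    intro h
    exact (Nat.prime_iff_prime_int.mp hpp).not_isSquare h
  obtain ⟨F, hF⟩ := Pell.IsFundamental.exists_of_not_isSquare hp0 hns
  have hp3 : Prime (3 : ℤ) := Int.prime_three
  have hWa : X ^ 2 - p * |W| ^ 2 = 1 := by rw [sq_abs]; exact hXW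
  obtain ⟨s, hs⟩ := hF.eq_pow_of_nonneg (a := Pell.Solution₁.mk X |W| hWa) (by simpa using hX) (by simp)
  obtain ⟨r, hr⟩ := hF.eq_pow_of_nonneg (a := Pell.Solution₁.mk g h hgh) (by simpa using hg) (by simpa using hh)
  have hsx : (F ^ s).x = X := by rw [← hs]; simp
  have hsy : (F ^ s).y = |W| := by rw [← hs]; simp
  have hrx : (F ^ r).x = g := by rw [← hr]; simp
  have hry : (F ^ r).y = h := by rw [← hr]; simp
  have hFx : 0 < F.x := hF.x_pos
  have hFy : 0 < F.y := hF.2.1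
  have hsq : ∀ T : Pell.Solution₁ (p : ℤ), (T ^ 2).y = 2 * (T.x * T.y) := by
    intro T; rw [pow_two, Pell.Solution₁.y_mul]; ring
  -- 3 divides y of F^2
  have h3 : (3 : ℤ) ∣ (F ^ 2).y := by
    rw [hsq]
    have hprop := F.prop
    have : (3 : ℤ) ∣ F.x * F.y := by
      by_contra hcon
      have hx3 : ¬ (3 : ℤ) ∣ F.x := fun h => hcon (h.mul_right _)
      have hy3 : ¬ (3 : ℤ) ∣ F.y := fun h => hcon (h.mul_left _)
      have hx1 : F.x ^ 2 % 3 = 1 := by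
        have : F.x % 3 = 1 ∨ F.x % 3 = 2 := by omega
        rcases this with h | h <;> simp [pow_two, Int.mul_emod, h]
      have hy1 : F.y ^ 2 % 3 = 1 := by
        have : F.y % 3 = 1 ∨ F.y % 3 = 2 := by omega
        rcases this with h | h <;> simp [pow_two, Int.mul_emod, h]
      have hp2 : (p : ℤ) % 3 = 2 := by omega
      have hpy : ((p : ℤ) * F.y ^ 2) % 3 = 2 := by
        rw [Int.mul_emod, hp2, hy1]; rfl
      omega
    exact this.mul_left _
  have hy2 : (F ^ 2).y ≠ 0 := by rw [hsq]; positivity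
  obtain ⟨k, hk1, hk2⟩ : ∃ k, (3 : ℤ) ^ k ∣ (F ^ 2).y ∧ ¬ (3 : ℤ) ^ (k + 1) ∣ (F ^ 2).y := by
    have hf : FiniteMultiplicity (3 : ℤ) (F ^ 2).y := Int.finiteMultiplicity_iff.mpr ⟨by norm_num, hy2⟩
    exact ⟨multiplicity 3 (F ^ 2).y, pow_multiplicity_dvd _ _, hf.not_pow_dvd_of_multiplicity_lt (Nat.lt_succ_self _)⟩
  have hk : 1 ≤ k := by
    rcases Nat.eq_zero_or_pos k with h | h
    · subst h; simp at hk2; exact absurd h3 hk2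
    · exact h
  have hkv : k ≤ v := by
    by_contra hcon
    apply hv
    have h5 : (3 : ℤ) ^ k ∣ 2 * (g * h) := by
      have : (F ^ 2) ^ r = (F ^ r) ^ 2 := by rw [← pow_mul, ← pow_mul, mul_comm]
      obtain ⟨a, b, c, -, e, -⟩ := pell_cong (F ^ 2) r
      rw [this, hsq, hrx, hry] at e
      rw [e]
      exact hk1.mul_left _
    have h6 : IsCoprime ((3 : ℤ) ^ k) 2 := by
      apply IsCoprime.pow_left
      exact ⟨1, -1, by norm_num⟩
    exact (pow_dvd_pow 3 (by omega)).trans (h6.dvd_of_dvd_mul_left h5)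
  have hs0 : s ≠ 0 := by
    rintro rfl
    simp at hsy
    exact hW (by simpa using hsy.symm)
  have hsM : 3 ^ (M - v) ≤ s := by
    by_cases hMk : k ≤ M
    · have h5 : (3 : ℤ) ^ (k + (M - k)) ∣ ((F ^ 2) ^ s).y := by
        have : (F ^ 2) ^ s = (F ^ s) ^ 2 := by rw [← pow_mul, ← pow_mul, mul_comm]
        rw [this, hsq, hsy, Nat.add_sub_cancel' hMk]
        exact (((dvd_abs _ _).mpr hM).mul_left _).mul_left _
      have := Nat.le_of_dvd (Nat.pos_of_ne_zero hs0) (pell_three _ (M - k) (F ^ 2) k s hk hk1 hk2 h5)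
      exact (Nat.pow_le_pow_right (by norm_num) (by omega)).trans this
    · have : M - v = 0 := by omega
      rw [this, pow_zero]; exact Nat.pos_of_ne_zero hs0
  have hgrow : ∀ n : ℕ, F.x ^ n ≤ (F ^ n).x ∧ 0 ≤ (F ^ n).y := by
    intro n
    induction n with
    | zero => simp
    | succ n ih =>
      obtain ⟨i1, i2⟩ := ih
      rw [pow_succ F, Pell.Solution₁.x_mul, Pell.Solution₁.y_mul, pow_succ]
      have : 0 < F.x ^ n := by positivity
      have hxn : 0 < (F ^ n).x := by linarith
      constructor
      · have : 0 ≤ (p : ℤ) * ((F ^ n).y * F.y) := by positivity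
        have := mul_le_mul_of_nonneg_right i1 hFx.le
        linarith
      · positivity
  have hFx2 : (p : ℤ) ≤ F.x ^ 2 := by
    have := F.prop
    have h1 : 1 ≤ F.y ^ 2 := by nlinarith
    nlinarith
  calc (p : ℤ) ^ (3 ^ (M - v)) ≤ (p : ℤ) ^ s := pow_le_pow_right₀ (by linarith) hsM
    _ ≤ (F.x ^ 2) ^ s := by gcongr
    _ = (F.x ^ s) ^ 2 := by rw [← pow_mul, ← pow_mul, mul_comm]
    _ ≤ X ^ 2 := by
      have := (hgrow s).1
      rw [hsx] at this
      gcongr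
end

section
lemma size11 (p : ℕ) (hpp : p.Prime) (hp : p % 24 = 11) (s t y : ℤ) (m : ℕ) (hst : s + t = 3 ^ m)
    (hy : s ^ 2 + t ^ 2 = y) (h : uu ((s - t) ^ 2 - (s + t) ^ 2) y ((p - 1) / 2) = 1)
    (g k : ℤ) (v : ℕ) (hg : 0 < g) (hk : 0 ≤ k) (hgk : g ^ 2 - p * k ^ 2 = 1) (hv : ¬ (3 : ℤ) ^ (v + 1) ∣ g * k) :
    (p : ℤ) ^ (3 ^ (m - v)) ≤ (16 * y) ^ (p - 1) := by
  have hst0 : s + t ≠ 0 := by rw [hst]; positivity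
  obtain ⟨Y, Z, h1, h2, h3⟩ := case11 p hpp hp s t y hst0 hy h
  have hp11 : (11 : ℤ) ≤ p := by
    have : 11 ≤ p := by omega
    exact_mod_cast this
  have hy1 : 1 ≤ y := by
    rcases eq_or_ne s 0 with h0 | h0
    · have : t ≠ 0 := by rintro rfl; apply hst0; rw [h0]; rfl
      have := Int.one_le_abs this
      nlinarith [sq_abs t, sq_nonneg s]
    · have := Int.one_le_abs h0
      nlinarith [sq_abs s, sq_nonneg t]
  have hZ : Z ≠ 0 := by rintro rfl; nlinarith [sq_nonneg Y]
  have hY : Y ≠ 0 := by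
    rintro rfl
    have := Int.one_le_abs hZ
    nlinarith [sq_abs Z]
  rw [hst] at h2
  have hb := pell_bound p hpp (by omega) g k v hg hk hgk hv (Y ^ 2 + 1) (Y * Z) m (by positivity) (mul_ne_zero hY hZ)
    (by linear_combination (-Y ^ 2) * h1) (h2.mul_right _)
  refine hb.trans ?_
  obtain ⟨d, hd⟩ : ∃ d, d = (p - 1) / 2 := ⟨_, rfl⟩
  rw [← hd] at h3
  have hpd : p - 1 = d * 2 := by omega
  rw [hpd, pow_mul]
  have h5 : Y ^ 2 + 1 ≤ (16 * y) ^ d := by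
    have e : (16 * y) ^ d = 4 ^ d * (4 * y) ^ d := by rw [← mul_pow]; ring
    have : (4 : ℤ) ≤ 4 ^ d := by
      calc (4 : ℤ) = 4 ^ 1 := by norm_num
        _ ≤ 4 ^ d := pow_le_pow_right₀ (by norm_num) (by omega)
    have h6 : 1 ≤ (4 * y) ^ d := one_le_pow₀ (by linarith)
    rw [e]
    nlinarith
  gcongr

lemma size5_core (p : ℤ) (hp29' : 29 ≤ p) (hpodd : p % 2 = 1) (m : ℕ) (hm : 1 ≤ m) (A B : ℤ)
    (hAB : A ^ 2 - p * B ^ 2 = 4) (hbA : (3 : ℤ) ^ m ∣ A) :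
    ∃ X6 W6 : ℤ, 0 < X6 ∧ W6 ≠ 0 ∧ X6 ^ 2 - p * W6 ^ 2 = 1 ∧ (3 : ℤ) ^ (m + 1) ∣ W6 ∧ X6 ≤ (A ^ 2) ^ 3 := by
  obtain ⟨q, hq⟩ : ∃ q : ℤ, p = 2 * q + 1 := ⟨p / 2, by omega⟩
  have par : ∀ a b : ℤ, ∀ c : ℤ, a ^ 2 - p * b ^ 2 = 2 * c → Even (a - b) := by
    intro a b c h
    have : Even ((a - b) ^ 2) := by
      refine ⟨c + q * b ^ 2 + b ^ 2 - a * b, ?_⟩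
      rw [hq] at h
      linear_combination h
    exact (Int.even_pow.mp this).1
  have h3A : (3 : ℤ) ∣ A := (dvd_pow_self 3 (by omega)).trans hbA
  have hA0 : A ≠ 0 := by rintro rfl; nlinarith [sq_nonneg B]
  have hB0 : B ≠ 0 := by
    rintro rfl
    obtain ⟨c, rfl⟩ := h3A
    have : 9 * c ^ 2 = 4 := by linear_combination hAB
    omega
  obtain ⟨c, hc⟩ := h3A
  have hc0 : c ≠ 0 := by rintro rfl; simp at hc; exact hA0 hc
  have hA9 : 9 ≤ A ^ 2 := by
    have := Int.one_le_abs hc0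
    have : 1 ≤ c ^ 2 := by nlinarith [sq_abs c]
    rw [hc]; linarith
  set X2 := A ^ 2 - 2 with hX2
  set W2 := A * B with hW2
  have hXW2 : X2 ^ 2 - p * W2 ^ 2 = 4 := by
    rw [hX2, hW2]; linear_combination A ^ 2 * hAB
  obtain ⟨e3, he3⟩ := par X2 W2 2 (by linear_combination hXW2)
  obtain ⟨X6, hX6⟩ : ∃ X6, 2 * X6 = X2 ^ 3 - 3 * X2 := by
    obtain ⟨r, hr⟩ := Int.even_mul_pred_self X2
    exact ⟨r * (X2 + 1) - X2, by linear_combination (-X2 - 1) * hr⟩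
  obtain ⟨W6, hW6⟩ : ∃ W6, 2 * W6 = (X2 ^ 2 - 1) * W2 := by
    obtain ⟨r, hr⟩ := Int.even_mul_pred_self X2
    exact ⟨r * (X2 + 1) - e3 * (X2 ^ 2 - 1), by
      linear_combination (-(X2 + 1)) * hr + (X2 ^ 2 - 1) * he3⟩
  have hP : X6 ^ 2 - p * W6 ^ 2 = 1 := by
    have : 4 * (X6 ^ 2 - p * W6 ^ 2) = 4 * 1 := by
      linear_combination (2 * X6 + (X2 ^ 3 - 3 * X2)) * hX6 - p * (2 * W6 + (X2 ^ 2 - 1) * W2) * hW6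
        + (X2 ^ 2 - 1) ^ 2 * hXW2
    linarith
  have hX27 : 7 ≤ X2 := by linarith
  have hX49 : 7 ^ 2 ≤ X2 ^ 2 := by gcongr
  clear_value X2 W2
  have hW60 : W6 ≠ 0 := by
    rintro rfl
    have : (X2 ^ 2 - 1) * W2 = 0 := by linarith
    rcases mul_eq_zero.mp this with h | h
    · linarith
    · exact mul_ne_zero hA0 hB0 (hW2 ▸ h)
  have hX60 : 0 < X6 := by
    have : 0 < X2 * (X2 ^ 2 - 3) := mul_pos (by linarith) (by linarith)
    linarith
  have hdvd : (3 : ℤ) ^ (m + 1) ∣ W6 := by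
    have h6 : IsCoprime ((3 : ℤ) ^ (m + 1)) 2 := by
      apply IsCoprime.pow_left
      exact ⟨1, -1, by norm_num⟩
    apply h6.dvd_of_dvd_mul_left
    rw [hW6, pow_succ, mul_comm]
    refine mul_dvd_mul ?_ (hW2 ▸ hbA.mul_right _)
    exact ⟨27 * c ^ 4 - 12 * c ^ 2 + 1, by rw [hX2, hc]; ring⟩
  refine ⟨X6, W6, hX60, hW60, hP, hdvd, ?_⟩
  have : X2 ^ 3 ≤ (A ^ 2) ^ 3 := by
    have : X2 ≤ A ^ 2 := by rw [hX2]; linarith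
    gcongr
  have h0 : 0 ≤ X2 ^ 3 := by positivity
  linarith

lemma size5 (p : ℕ) (hpp : p.Prime) (hp : p % 24 = 5) (hp29 : 29 ≤ p) (s t y : ℤ) (m : ℕ) (hm : 1 ≤ m) (hst : s + t = 3 ^ m)
    (hy : s ^ 2 + t ^ 2 = y) (h : uu ((s - t) ^ 2 - (s + t) ^ 2) y ((p - 1) / 2) = -1)
    (g k : ℤ) (v : ℕ) (hvm : v ≤ m) (hg : 0 < g) (hk : 0 ≤ k) (hgk : g ^ 2 - p * k ^ 2 = 1)
    (hv : ¬ (3 : ℤ) ^ (v + 1) ∣ g * k) :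
    (p : ℤ) ^ (3 ^ (m - v)) ≤ (16 * y) ^ (p - 1) := by
  have hst0 : s + t ≠ 0 := by rw [hst]; positivity
  obtain ⟨Y, Z, Y0, Z0, h1, h2, h3, b1, b2, b3, b4⟩ := case5 p hpp hp s t y hst0 hy h
  have hpi : Prime (p : ℤ) := Nat.prime_iff_prime_int.mp hpp
  have hp29' : (29 : ℤ) ≤ p := by exact_mod_cast hp29
  have hpodd : (p : ℤ) % 2 = 1 := by omega
  have hy1 : 1 ≤ y := by
    rcases eq_or_ne s 0 with h0 | h0
    · have : t ≠ 0 := by rintro rfl; apply hst0; rw [h0]; rfl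
      have := Int.one_le_abs this
      nlinarith [sq_abs t, sq_nonneg s]
    · have := Int.one_le_abs h0
      nlinarith [sq_abs s, sq_nonneg t]
  have hpY0 : (p : ℤ) ∣ Y0 := by
    apply hpi.dvd_of_dvd_pow (n := 2)
    exact ⟨Z0 ^ 2 + 4, by linear_combination h2⟩
  obtain ⟨Y1, rfl⟩ := hpY0
  have h2' : p * Y1 ^ 2 - Z0 ^ 2 = 4 := by
    apply mul_left_cancel₀ hpi.ne_zero
    linear_combination h2
  obtain ⟨q, hq⟩ : ∃ q : ℤ, (p : ℤ) = 2 * q + 1 := ⟨p / 2, by omega⟩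
  have par : ∀ a b : ℤ, ∀ c : ℤ, a ^ 2 - p * b ^ 2 = 2 * c → Even (a - b) := by
    intro a b c h
    have : Even ((a - b) ^ 2) := by
      refine ⟨c + q * b ^ 2 + b ^ 2 - a * b, ?_⟩
      rw [hq] at h
      linear_combination h
    exact (Int.even_pow.mp this).1
  obtain ⟨e1, he1⟩ := par Y Z (-2) (by linear_combination h1)
  obtain ⟨e2, he2⟩ := par Z0 Y1 (-2) (by linear_combination -h2')
  obtain ⟨A, hA⟩ : ∃ A, 2 * A = p * Z * Y1 - Y * Z0 := by
    refine ⟨q * Z * Y1 - (Z + e1 + e1) * e2 - e1 * Y1, ?_⟩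
    rw [hq]
    linear_combination Z0 * he1 + Z * he2 + (e1 * 2) * he2
  obtain ⟨B, hB⟩ : ∃ B, 2 * B = Z * Z0 - Y * Y1 := by
    refine ⟨Z * e2 - e1 * Y1, ?_⟩
    linear_combination Y1 * he1 - Z * he2
  have hAB : A ^ 2 - p * B ^ 2 = 4 := by
    have : 4 * (A ^ 2 - p * B ^ 2) = 4 * 4 := by
      linear_combination (2 * A + (p * Z * Y1 - Y * Z0)) * hA - p * (2 * B + (Z * Z0 - Y * Y1)) * hB
        + (Z ^ 2 * p - Y ^ 2) * h2' - 4 * h1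
    linarith
  have hbA : (3 : ℤ) ^ m ∣ A := by
    rw [hst] at h3
    have : (3 : ℤ) ^ m ∣ 2 * A := by
      have e : 2 * A = -(Y * Z0 - Z * (p * Y1)) := by rw [hA]; ring
      rw [e]
      exact h3.neg_right
    have h6 : IsCoprime ((3 : ℤ) ^ m) 2 := by
      apply IsCoprime.pow_left
      exact ⟨1, -1, by norm_num⟩
    exact h6.dvd_of_dvd_mul_left this
  obtain ⟨X6, W6, hX60, hW60, hP, hdvd, hXle⟩ := size5_core p hp29' hpodd m hm A B hAB hbA
  have hb := pell_bound p hpp (by omega) g k v hg hk hgk hv X6 W6 (m + 1) hX60 hW60 hP hdvd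
  obtain ⟨d, hd⟩ : ∃ d, d = (p - 1) / 2 := ⟨_, rfl⟩
  rw [← hd] at b1 b2 b3 b4
  have hpd : p - 1 = 2 * d := by omega
  have hD : (16 * y) ^ d = (4 * y) ^ d * 4 ^ d := by rw [← mul_pow]; ring
  have hA2 : A ^ 2 ≤ (16 * y) ^ d := by
    have h4 : 0 < (4 * y) ^ d := by positivity
    have h5 : (0 : ℤ) < 4 ^ d := by positivity
    have c1 : (p * Z ^ 2) * (p * Y1) ^ 2 ≤ (4 * (4 * y) ^ d) * (4 * 4 ^ d) := by gcongr
    have c2 : Y ^ 2 * (p * Z0 ^ 2) ≤ (4 * (4 * y) ^ d) * (4 * 4 ^ d) := by gcongr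
    have c3 : (2 * A) ^ 2 ≤ 2 * ((p * Z * Y1) ^ 2 + (Y * Z0) ^ 2) := by
      rw [hA]
      have := sq_nonneg (p * Z * Y1 + Y * Z0)
      have e : 2 * ((p * Z * Y1) ^ 2 + (Y * Z0) ^ 2) = (p * Z * Y1 - Y * Z0) ^ 2 + (p * Z * Y1 + Y * Z0) ^ 2 := by ring
      rw [e]
      exact le_add_of_nonneg_right this
    have c4 : (p : ℤ) * (2 * A) ^ 2 ≤ p * (2 * ((p * Z * Y1) ^ 2 + (Y * Z0) ^ 2)) := by gcongr
    have c5 : (p : ℤ) * (4 * A ^ 2) ≤ 64 * (16 * y) ^ d := by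
      have c7 : (p : ℤ) * (2 * ((p * Z * Y1) ^ 2 + (Y * Z0) ^ 2)) =
        2 * ((p * Z ^ 2) * (p * Y1) ^ 2 + Y ^ 2 * (p * Z0 ^ 2)) := by ring
      have c8 : (p : ℤ) * (2 * A) ^ 2 = p * (4 * A ^ 2) := by ring
      have c9 : (4 * (4 * y) ^ d) * (4 * 4 ^ d) = 16 * (16 * y) ^ d := by rw [hD]; ring
      rw [c9] at c1 c2
      rw [c7, c8] at c4
      linarith
    have c6 : 0 < (16 * y) ^ d := by positivity
    have c10 : 29 * (4 * A ^ 2) ≤ (p : ℤ) * (4 * A ^ 2) := by gcongr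
    linarith
  have hfin : (p : ℤ) ^ (3 ^ (m + 1 - v)) ≤ ((16 * y) ^ (p - 1)) ^ 3 := by
    refine hb.trans ?_
    calc X6 ^ 2 ≤ ((A ^ 2) ^ 3) ^ 2 := by gcongr
      _ ≤ (((16 * y) ^ d) ^ 3) ^ 2 := by gcongr
      _ = ((16 * y) ^ (p - 1)) ^ 3 := by rw [hpd, ← pow_mul, ← pow_mul, ← pow_mul]; congr 1; ring
  have : m + 1 - v = (m - v) + 1 := by omega
  rw [this, pow_succ 3, pow_mul] at hfin
  exact le_of_pow_le_pow_left₀ three_ne_zero (by positivity) hfin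
end

section
set_option linter.all false

theorem arctan_ub5 (x : ℝ) (h0 : 0 ≤ x) : Real.arctan x ≤ x - x^3/3 + x^5/5 := by
  have hd : ∀ u : ℝ, HasDerivAt (fun x : ℝ => x - x^3/3 + x^5/5 - Real.arctan x) (1 - u^2 + u^4 - 1/(1+u^2)) u := by
    intro u
    have h1 := ((((hasDerivAt_id u).sub ((hasDerivAt_pow 3 u).div_const 3)).add ((hasDerivAt_pow 5 u).div_const 5)).sub (Real.hasDerivAt_arctan u))
    refine h1.congr_deriv ?_
    push_cast
    ring
  have hmono : MonotoneOn (fun x : ℝ => x - x^3/3 + x^5/5 - Real.arctan x) (Set.Ici 0) := by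
    apply monotoneOn_of_deriv_nonneg (convex_Ici _)
    · exact fun u _ => (hd u).continuousAt.continuousWithinAt
    · exact fun u _ => (hd u).differentiableAt.differentiableWithinAt
    · intro u _
      rw [(hd u).deriv]
      have : 1 - u^2 + u^4 - 1/(1+u^2) = u^6/(1+u^2) := by field_simp; ring
      rw [this]; positivity
  have := hmono (Set.mem_Ici.2 le_rfl) (Set.mem_Ici.2 h0) h0
  simp at this
  linarith

theorem arctan_lb7 (x : ℝ) (h0 : 0 ≤ x) : x - x^3/3 + x^5/5 - x^7/7 ≤ Real.arctan x := by
  have hd : ∀ u : ℝ, HasDerivAt (fun x : ℝ => Real.arctan x - (x - x^3/3 + x^5/5 - x^7/7)) (1/(1+u^2) - (1 - u^2 + u^4 - u^6)) u := by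
    intro u
    have h1 := (Real.hasDerivAt_arctan u).sub ((((hasDerivAt_id u).sub ((hasDerivAt_pow 3 u).div_const 3)).add ((hasDerivAt_pow 5 u).div_const 5)).sub ((hasDerivAt_pow 7 u).div_const 7))
    refine h1.congr_deriv ?_
    push_cast
    ring
  have hmono : MonotoneOn (fun x : ℝ => Real.arctan x - (x - x^3/3 + x^5/5 - x^7/7)) (Set.Ici 0) := by
    apply monotoneOn_of_deriv_nonneg (convex_Ici _)
    · exact fun u _ => (hd u).continuousAt.continuousWithinAt
    · exact fun u _ => (hd u).differentiableAt.differentiableWithinAt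
    · intro u _
      rw [(hd u).deriv]
      have : 1/(1+u^2) - (1 - u^2 + u^4 - u^6) = u^8/(1+u^2) := by field_simp; ring
      rw [this]; positivity
  have := hmono (Set.mem_Ici.2 le_rfl) (Set.mem_Ici.2 h0) h0
  simp at this
  linarith

/-- first inequality: the angle is too small -/
def ck1 (p κ E w z : ℕ) : Bool :=
  Nat.blt (4*p*100000000000000*(15*w*z^4+3*w^5)+120*z^5*E) (15*z^5*κ*314159265358979+20*p*100000000000000*w^3*z^2)

/-- second inequality: the angle is too large -/
def ck2 (p κ E w z : ℕ) : Bool :=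
  Nat.blt (105*z^7*(κ*314159265358980+8*E)+4*p*100000000000000*(35*w^3*z^4+15*w^7)) (4*p*100000000000000*(105*w*z^6+21*w^5*z^2))

theorem ck1_sound (p κ E w z w' z' : ℕ) (δ : ℝ) (hz : 0 < z) (hz' : 0 < z') (h : ck1 p κ E w z = true)
    (hwz : w' * z ≤ w * z') (hδ : δ ≤ 2*E/10^14) :
    (p:ℝ) * Real.arctan (w'/z') < κ*(Real.pi/4) - δ := by
  unfold ck1 at h
  have h : 4*p*100000000000000*(15*w*z^4+3*w^5)+120*z^5*E < 15*z^5*κ*314159265358979+20*p*100000000000000*w^3*z^2 := by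
    simpa using h
  have hR : (4*p*100000000000000*(15*w*z^4+3*w^5)+120*z^5*E : ℝ) < 15*z^5*κ*314159265358979+20*p*100000000000000*w^3*z^2 := by
    exact_mod_cast h
  have hzR : (0:ℝ) < z := by exact_mod_cast hz
  have hzR' : (0:ℝ) < z' := by exact_mod_cast hz'
  have hle : (w':ℝ)/z' ≤ w/z := by
    rw [div_le_div_iff₀ hzR' hzR]; exact_mod_cast hwz
  have h1 := Real.arctan_strictMono.monotone hle
  set x : ℝ := w/z with hx
  have hw : (w:ℝ) = x*z := by rw [hx]; field_simp
  have h2 := arctan_ub5 x (by positivity)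
  rw [hw] at hR
  have h3 : (60*z^5*10^14:ℝ) * (p*(x - x^3/3+x^5/5) + 2*E/10^14) < (60*z^5*10^14:ℝ) * (κ*314159265358979/(4*10^14)) := by
    linarith
  have h4 := lt_of_mul_lt_mul_left h3 (by positivity)
  have h5 : (p:ℝ)*Real.arctan (w'/z') ≤ p*(x - x^3/3+x^5/5) := by
    have := h1.trans h2
    gcongr
  have h6 := Real.pi_gt_d20
  have h7 : (κ:ℝ)*314159265358979/(4*10^14) ≤ κ*(Real.pi/4) := by
    have : (314159265358979:ℝ)/(4*10^14) ≤ Real.pi/4 := by norm_num at h6 ⊢; linarith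
    rw [mul_div_assoc]
    gcongr
  linarith

theorem ck2_sound (p κ E w z w' z' : ℕ) (δ : ℝ) (hz : 0 < z) (hz' : 0 < z') (h : ck2 p κ E w z = true)
    (hwz : w * z' ≤ w' * z) (hδ : δ ≤ 2*E/10^14) :
    κ*(Real.pi/4) + δ < (p:ℝ) * Real.arctan (w'/z') := by
  unfold ck2 at h
  have h : 105*z^7*(κ*314159265358980+8*E)+4*p*100000000000000*(35*w^3*z^4+15*w^7) < 4*p*100000000000000*(105*w*z^6+21*w^5*z^2) := by
    simpa using h
  have hR : (105*z^7*(κ*314159265358980+8*E)+4*p*100000000000000*(35*w^3*z^4+15*w^7) : ℝ) < 4*p*100000000000000*(105*w*z^6+21*w^5*z^2) := by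
    exact_mod_cast h
  have hzR : (0:ℝ) < z := by exact_mod_cast hz
  have hzR' : (0:ℝ) < z' := by exact_mod_cast hz'
  have hle : (w:ℝ)/z ≤ w'/z' := by
    rw [div_le_div_iff₀ hzR hzR']; exact_mod_cast hwz
  have h1 := Real.arctan_strictMono.monotone hle
  set x : ℝ := w/z with hx
  have hw : (w:ℝ) = x*z := by rw [hx]; field_simp
  have h2 := arctan_lb7 x (by positivity)
  rw [hw] at hR
  have h3 : (420*z^7*10^14:ℝ) * (κ*314159265358980/(4*10^14) + 2*E/10^14) < (420*z^7*10^14:ℝ) * (p*(x - x^3/3+x^5/5-x^7/7)) := by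
    linarith
  have h4 := lt_of_mul_lt_mul_left h3 (by positivity)
  have h5 : p*(x - x^3/3+x^5/5-x^7/7) ≤ (p:ℝ)*Real.arctan (w'/z') := by
    have := h2.trans h1
    gcongr
  have h6 := Real.pi_lt_d20
  have h7 : κ*(Real.pi/4) ≤ (κ:ℝ)*314159265358980/(4*10^14) := by
    have : Real.pi/4 ≤ (314159265358980:ℝ)/(4*10^14) := by norm_num at h6 ⊢; linarith
    rw [mul_div_assoc]
    gcongr
  linarith

/-- candidate for `w` -/
def tanG (p κ : ℕ) : ℕ :=
  let K := 100000000000000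
  let th := κ*314159265358979/(4*p)
  th + th^3/(3*K^2) + 2*th^5/(15*K^4) + 17*th^7/(315*K^6)

def resP (p κ E b w : ℕ) : Bool :=
  Nat.blt (w+1) b && ck1 p κ E w (b-w) && ck2 p κ E (w+1) (b-(w+1))

def resM (p κ E b w : ℕ) : Bool :=
  ck1 p κ E w (b+w) && ck2 p κ E (w+1) (b+(w+1))

def resAt (p κ E b : ℕ) : Bool :=
  let T := tanG p κ
  resP p κ E b (b*T/(100000000000000+T)) && resM p κ E b (b*T/(100000000000000-T))

theorem resP_sound (p κ E b w0 w z : ℕ) (δ : ℝ) (h : resP p κ E b w0 = true) (hb : b = z + w) (hz : 0 < z)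
    (hδ : δ ≤ 2*E/10^14) (hh : |(p:ℝ)*Real.arctan (w/z) - κ*(Real.pi/4)| ≤ δ) : False := by
  simp only [resP, Bool.and_eq_true, Nat.blt_eq] at h
  obtain ⟨⟨h0, h1⟩, h2⟩ := h
  rw [abs_le] at hh
  rcases le_or_gt w w0 with hw | hw
  · have := ck1_sound p κ E w0 (b-w0) w z δ (by omega) hz h1 (by
      zify [show w0 ≤ b by omega]; subst hb; push_cast; zify at hw; nlinarith) hδ
    linarith
  · have := ck2_sound p κ E (w0+1) (b-(w0+1)) w z δ (by omega) hz h2 (by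
      zify [show w0+1 ≤ b by omega]; subst hb; push_cast; zify at hw; nlinarith) hδ
    linarith

theorem resM_sound (p κ E b w0 w z : ℕ) (δ : ℝ) (hb0 : 0 < b) (h : resM p κ E b w0 = true) (hb : z = b + w)
    (hδ : δ ≤ 2*E/10^14) (hh : |(p:ℝ)*Real.arctan (w/z) - κ*(Real.pi/4)| ≤ δ) : False := by
  simp only [resM, Bool.and_eq_true] at h
  obtain ⟨h1, h2⟩ := h
  rw [abs_le] at hh
  have hz : 0 < z := by omega
  rcases le_or_gt w w0 with hw | hw
  · have := ck1_sound p κ E w0 (b+w0) w z δ (by omega) hz h1 (by subst hb; nlinarith) hδ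
    linarith
  · have := ck2_sound p κ E (w0+1) (b+(w0+1)) w z δ (by omega) hz h2 (by subst hb; nlinarith) hδ
    linarith

theorem resAt_sound (p κ E b w z : ℕ) (δ : ℝ) (hb0 : 0 < b) (h : resAt p κ E b = true) (hz : 0 < z)
    (hb : (b:ℤ) = z + w ∨ (b:ℤ) = z - w)
    (hδ : δ ≤ 2*E/10^14) (hh : |(p:ℝ)*Real.arctan (w/z) - κ*(Real.pi/4)| ≤ δ) : False := by
  simp only [resAt, Bool.and_eq_true] at h
  rcases hb with hb | hb
  · exact resP_sound p κ E b _ w z δ h.1 (by omega) hz hδ hh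
  · exact resM_sound p κ E b _ w z δ hb0 h.2 (by omega) hδ hh

/-- all `b = 3^m`, `1 ≤ m ≤ M` -/
def resAll (p E : ℕ) : ℕ → Bool
  | 0 => true
  | M+1 => resAt p 1 E (3^(M+1)) && resAt p 3 E (3^(M+1)) && resAll p E M

theorem resAll_sound (p E : ℕ) : ∀ M : ℕ, resAll p E M = true → ∀ m, 1 ≤ m → m ≤ M →
    resAt p 1 E (3^m) = true ∧ resAt p 3 E (3^m) = true
  | 0, _, m, h1, h2 => by omega
  | M+1, h, m, h1, h2 => by
    simp only [resAll, Bool.and_eq_true] at h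
    rcases Nat.lt_or_ge m (M+1) with h3 | h3
    · exact resAll_sound p E M h.2 m h1 (by omega)
    · have : m = M+1 := by omega
      subst this
      exact h.1
end

section
set_option linter.all false

/-- all requirements on the data of one prime, with a unit `g + k√p` -/
def goodC (p g k v M : ℕ) : Bool :=
  Nat.beq (g*g) (p*k*k+1) && Nat.blt 0 ((g*k) % 3^(v+1)) && Nat.ble v M &&
  Nat.ble (2^(Nat.log2 (p^4))) (p^4) &&
  Nat.blt ((p-1)*(600+317*(M+1))) (25*(Nat.log2 (p^4))*3^(M+1-v)) &&
  resAll p (cond (Nat.beq p 11) 1000000000 1) M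

def good11 (p t s v M : ℕ) : Bool := goodC p (t*t+1) (t*s) v M

def good5 (p t s v M : ℕ) : Bool :=
  goodC p ((t*t+2)*((t*t+2)*(t*t+2)-3)/2) (((t*t+2)*(t*t+2)-1)*(t*s)/2) v M

def comp (n : ℕ) : Bool :=
  [5,7,11,13,17,19,23,29,31,37,41,43,47,53,59,61,67,71,73,79,83,89,97].any
    fun r => Nat.beq (n % r) 0 && Nat.blt r n

def cov (good : ℕ → ℕ → ℕ → ℕ → ℕ → Bool) : ℕ → ℕ → List (ℕ × ℕ × ℕ × ℕ × ℕ) → Bool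
  | 0, _, _ => true
  | f+1, n, [] => comp n && cov good f (n+24) []
  | f+1, n, (p, t, s, v, M) :: l =>
    cond (Nat.beq p n) (good p t s v M && cov good f (n+24) l) (comp n && cov good f (n+24) ((p, t, s, v, M) :: l))

theorem comp_sound (n : ℕ) (h : comp n = true) : ¬ n.Prime := by
  intro hn
  simp only [comp, List.any_eq_true, Bool.and_eq_true, Nat.beq_eq, Nat.blt_eq] at h
  obtain ⟨r, hr, h0, hlt⟩ := h
  have hd : r ∣ n := Nat.dvd_of_mod_eq_zero h0
  rcases (Nat.dvd_prime hn).1 hd with h | h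
  · subst h; revert hr; decide
  · omega

theorem cov_sound (good : ℕ → ℕ → ℕ → ℕ → ℕ → Bool) : ∀ (f n : ℕ) (l : List (ℕ × ℕ × ℕ × ℕ × ℕ)),
    cov good f n l = true → ∀ i, i < f → (n + 24*i).Prime → ∃ t s v M, good (n+24*i) t s v M = true
  | 0, n, l, h, i, hi, hp => by omega
  | f+1, n, [], h, i, hi, hp => by
    simp only [cov, Bool.and_eq_true] at h
    rcases Nat.eq_zero_or_pos i with h0 | h0
    · subst h0; exact absurd hp (comp_sound n h.1)
    · obtain ⟨j, rfl⟩ : ∃ j, i = j+1 := ⟨i-1, by omega⟩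
      have e : n + 24*(j+1) = (n+24) + 24*j := by ring
      rw [e] at hp ⊢
      exact cov_sound good f (n+24) _ h.2 j (by omega) hp
  | f+1, n, (p, t, s, v, M) :: l, h, i, hi, hp => by
    simp only [cov] at h
    rcases hb : Nat.beq p n with _ | _
    · rw [hb, cond_false, Bool.and_eq_true] at h
      rcases Nat.eq_zero_or_pos i with h0 | h0
      · subst h0; exact absurd hp (comp_sound n h.1)
      · obtain ⟨j, rfl⟩ : ∃ j, i = j+1 := ⟨i-1, by omega⟩
        have e : n + 24*(j+1) = (n+24) + 24*j := by ring
        rw [e] at hp ⊢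
        exact cov_sound good f (n+24) _ h.2 j (by omega) hp
    · rw [hb, cond_true, Bool.and_eq_true] at h
      rcases Nat.eq_zero_or_pos i with h0 | h0
      · subst h0
        have := Nat.eq_of_beq_eq_true hb
        subst this
        exact ⟨t, s, v, M, h.1⟩
      · obtain ⟨j, rfl⟩ : ∃ j, i = j+1 := ⟨i-1, by omega⟩
        have e : n + 24*(j+1) = (n+24) + 24*j := by ring
        rw [e] at hp ⊢
        exact cov_sound good f (n+24) _ h.2 j (by omega) hp

def tab5 : List (ℕ × ℕ × ℕ × ℕ × ℕ) :=
  [(29, 5, 1, 4, 8), (53, 7, 1, 2, 7), (101, 20, 2, 2, 7), (149, 61, 5, 2, 7), (173, 13, 1, 3, 9),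
    (197, 28, 2, 2, 8), (269, 164, 10, 2, 8), (293, 17, 1, 2, 8), (317, 89, 5, 2, 8),
    (389, 2564, 130, 2, 8), (461, 365, 17, 3, 9), (509, 925, 41, 2, 8), (557, 236, 10, 2, 8),
    (653, 1661, 65, 3, 10), (677, 52, 2, 2, 9), (701, 23564, 890, 2, 9), (773, 139, 5, 3, 10),
    (797, 367, 13, 2, 9), (821, 16189, 565, 2, 9), (941, 1135, 37, 2, 9), (1013, 923, 29, 4, 11),
    (1061, 264395, 8117, 2, 9), (1109, 106865, 3209, 2, 9), (1181, 29039, 845, 3, 10),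
    (1229, 35, 1, 2, 9), (1277, 6611, 185, 3, 10), (1301, 434636, 12050, 2, 9),
    (1373, 37, 1, 2, 9), (1493, 2357, 61, 2, 9), (1613, 2972, 74, 2, 9), (1637, 5543, 137, 2, 9),
    (1709, 5391115, 130409, 2, 9), (1733, 172387, 4141, 2, 9), (1877, 1603, 37, 2, 10),
    (1901, 436, 10, 3, 11), (1949, 166436, 3770, 2, 10), (1973, 177052, 3986, 3, 11),
    (1997, 9161, 205, 2, 10), (2069, 13134340, 288754, 2, 10), (2141, 956189, 20665, 2, 10),
    (2213, 47, 1, 2, 10), (2237, 1257389, 26585, 2, 10), (2309, 17539, 365, 2, 10),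
    (2333, 352067, 7289, 3, 11), (2357, 50588, 1042, 2, 10), (2381, 532470311, 10912285, 2, 10),
    (2477, 647, 13, 2, 10), (2549, 76534439, 1515905, 3, 11), (2621, 219220, 4282, 2, 10),
    (2693, 4411, 85, 2, 10), (2741, 95689739, 1827725, 2, 10), (2789, 437539, 8285, 3, 11),
    (2837, 12903508, 242258, 2, 10), (2861, 121569155, 2272817, 2, 10),
    (2909, 5686040789, 105423665, 2, 10), (2957, 59653, 1097, 2, 10), (3221, 3689, 65, 2, 10),
    (3389, 126262367315, 2168893081, 2, 10), (3413, 11709532, 200434, 2, 10),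
    (3461, 865805, 14717, 3, 11), (3533, 2437, 41, 2, 10), (3557, 10953889, 183665, 2, 10),
    (3581, 228923315, 3825497, 2, 10), (3677, 543137, 8957, 4, 12),
    (3701, 22774811, 374365, 3, 11), (3797, 62236, 1010, 2, 10),
    (3821, 7585341460, 122711882, 2, 10), (3917, 4154267, 66377, 2, 10),
    (3989, 130675, 2069, 5, 13), (4013, 1166404988, 18412586, 2, 10),
    (4133, 353972, 5506, 2, 10), (4157, 24307, 377, 2, 10), (4229, 65, 1, 2, 10),
    (4253, 56411, 865, 2, 10), (4349, 214834392761, 3257685125, 3, 11),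
    (4373, 51911, 785, 2, 10), (4397, 1392839, 21005, 2, 10),
    (4421, 43660503164, 656641730, 2, 10), (4493, 67, 1, 3, 11), (4517, 179111, 2665, 2, 10),
    (4637, 1798607, 26413, 2, 10), (4733, 336395036, 4889690, 2, 10),
    (4877, 6889763, 98657, 2, 10), (4973, 45203, 641, 4, 12),
    (5021, 3022528598420, 42655526618, 6, 15), (5189, 2033682961, 28231985, 3, 11),
    (5237, 47814548, 660722, 4, 13), (5261, 33220, 458, 2, 10), (5309, 449564, 6170, 3, 11),
    (5333, 73, 1, 2, 10), (5381, 32692435789, 445672445, 3, 11), (5477, 148, 2, 3, 12),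
    (5501, 1925177239, 25956725, 2, 10), (5573, 22449583, 300721, 2, 10),
    (5669, 70975923260, 942665954, 3, 12), (5693, 1372722239, 18193325, 2, 10),
    (5717, 3213839, 42505, 2, 10), (5741, 985, 13, 3, 12), (5813, 4907764, 64370, 2, 10),
    (5861, 15707719991875, 205176345533, 3, 12), (5981, 680031085, 8793097, 3, 12),
    (6029, 115331235477061, 1485334615945, 3, 12), (6053, 389, 5, 2, 11),
    (6101, 25464377489689, 326011223185, 2, 11), (6173, 17431273, 221861, 2, 11),
    (6197, 9369799847, 119025377, 2, 11), (6221, 4344500, 55082, 2, 11),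
    (6269, 169138226748211, 2136203578265, 2, 11), (6317, 33709903, 424133, 2, 11),
    (6389, 42321436585, 529473169, 2, 11), (6581, 34768979451065405, 428593912158197, 2, 11),
    (6653, 45052612, 552346, 2, 11), (6701, 183458654461, 2241136945, 2, 11),
    (6869, 24659882111660, 297539232146, 3, 12), (6917, 95095960993, 1143413153, 2, 11),
    (7013, 257428, 3074, 2, 11), (7109, 105552297223564, 1251882108130, 3, 12),
    (7229, 85, 1, 3, 12), (7253, 3185912093, 37408901, 4, 13),
    (7349, 212206252045, 2475392389, 3, 12), (7517, 4291508, 49498, 2, 11),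
    (7541, 355155681952780, 4089820963762, 2, 11), (7589, 26160472037980, 300298594594, 2, 11),
    (7757, 12691101964, 144096170, 3, 12), (7829, 4208034094636, 47558276050, 3, 12),
    (7853, 664022603, 7493161, 2, 11), (7877, 17226336692, 194094178, 2, 11),
    (7901, 108371688677039, 1219199595245, 2, 11), (7949, 155222045300, 1740993514, 2, 11),
    (8069, 2605, 29, 3, 12), (8093, 194132911, 2157965, 4, 13), (8117, 41668027, 462493, 2, 11),
    (8237, 208454333, 2296817, 3, 12), (8429, 29856285548789, 325197912265, 3, 12),
    (8501, 461, 5, 2, 11), (8573, 5576633, 60229, 2, 11), (8597, 4636, 50, 2, 11),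
    (8669, 4402596840580, 47285111354, 2, 11), (8693, 13857239, 148625, 2, 11),
    (8741, 2699520095, 28873937, 2, 11), (8837, 188, 2, 2, 11),
    (8861, 377077955164, 4005804730, 2, 11), (8933, 2795549090917, 29577976261, 3, 12),
    (9029, 95, 1, 3, 12), (9173, 260989, 2725, 2, 11),
    (9221, 844404093436955564, 8793490909678690, 2, 11), (9293, 964, 10, 2, 11),
    (9341, 10535073436, 109003610, 2, 11), (9413, 97, 1, 2, 11),
    (9437, 132899611, 1368065, 4, 13), (9461, 34713401845750078561, 356885295616538665, 2, 11),
    (9533, 7784507, 79729, 2, 11), (9629, 191661709734794735, 1953191225690701, 2, 11),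
    (9677, 80751889, 820885, 2, 11), (9749, 28535, 289, 3, 12),
    (9941, 83181995981382020, 834284740729138, 3, 12)]

def tab11 : List (ℕ × ℕ × ℕ × ℕ × ℕ) :=
  [(11, 3, 1, 1, 4), (59, 23, 3, 1, 6), (83, 9, 1, 2, 7), (107, 31, 3, 1, 6), (131, 103, 9, 2, 7),
    (179, 2047, 153, 2, 8), (227, 15, 1, 1, 7), (251, 1917, 121, 3, 9), (347, 801, 43, 2, 8),
    (419, 16437, 803, 1, 7), (443, 21, 1, 1, 7), (467, 1275, 59, 1, 7),
    (491, 305987, 13809, 1, 7), (563, 261, 11, 2, 8), (587, 1381, 57, 1, 7), (659, 77, 3, 1, 8),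
    (683, 13041, 499, 4, 11), (827, 949, 33, 1, 8), (947, 116231, 3777, 1, 8),
    (971, 3532677, 113369, 1, 8), (1019, 2467777, 77307, 1, 8), (1091, 33, 1, 1, 8),
    (1163, 35501, 1041, 1, 8), (1187, 197725, 5739, 1, 8), (1259, 10555053, 297473, 1, 8),
    (1283, 1358865, 37937, 2, 9), (1307, 13991, 387, 2, 9), (1427, 96819, 2563, 1, 8),
    (1451, 180299273, 4733259, 1, 8), (1499, 54795774897, 1415292667, 2, 9), (1523, 39, 1, 1, 8),
    (1571, 1195853, 30171, 1, 8), (1619, 8834785403, 219569787, 2, 9),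
    (1667, 521671, 12777, 1, 8), (1787, 465, 11, 1, 8), (1811, 383, 9, 2, 9),
    (1907, 131, 3, 1, 8), (1931, 231097, 5259, 1, 8), (1979, 14034117, 315473, 1, 8),
    (2003, 65912269, 1472739, 1, 8), (2027, 45, 1, 2, 10), (2099, 1237, 27, 3, 11),
    (2243, 64931, 1371, 1, 9), (2267, 3334959, 70043, 3, 11),
    (2339, 83421289017, 1724891513, 4, 12), (2411, 5377693, 109521, 2, 10),
    (2459, 843, 17, 1, 9), (2531, 594457822393053, 11816122198859, 1, 9),
    (2579, 129088143, 2541913, 2, 10), (2699, 55560020692397, 1069451161617, 1, 9),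
    (2819, 49044488103, 923724937, 2, 10), (2843, 1426945125, 26762017, 1, 9),
    (2939, 34646980713, 639095267, 1, 9), (2963, 1693902255, 31118777, 1, 9),
    (3011, 12230549562623, 222890005089, 2, 10), (3083, 174013905, 3133987, 1, 9),
    (3203, 1735017385, 30656697, 1, 9), (3251, 57, 1, 1, 9),
    (3299, 17399362373257, 302929923657, 1, 9), (3323, 24201931, 419841, 2, 10),
    (3347, 531212881, 9182073, 1, 9), (3371, 7473067112033177, 128712138561819, 2, 10),
    (3467, 28688687559, 487229707, 2, 10), (3491, 2063266683, 34920499, 1, 9),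
    (3539, 151452371600187, 2545867500283, 1, 9), (3659, 1429187429217, 23626967443, 1, 9),
    (3779, 81488551747, 1325586747, 1, 9), (3803, 185, 3, 1, 9),
    (3851, 222236299336138203, 3581197208551769, 1, 9), (3923, 1122913499, 17928219, 1, 9),
    (3947, 234275, 3729, 1, 9), (4019, 41335267817777, 652021254057, 1, 9),
    (4091, 194504292067, 3040986201, 1, 9), (4139, 193, 3, 1, 9),
    (4211, 418143872750863707, 6443667415004171, 3, 11), (4259, 14150499873, 216829297, 1, 9),
    (4283, 589, 9, 2, 10), (4451, 60449009287, 906067161, 3, 11),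
    (4523, 964569192601, 14342342619, 1, 9), (4547, 1311676030905989, 19451993034147, 1, 9),
    (4643, 41401661031, 607600921, 3, 11), (4691, 716382192764310583, 10459527485633601, 1, 9),
    (4787, 1911461, 27627, 1, 9), (4931, 7053238703191297, 100443324964641, 1, 9),
    (5003, 220053765, 3111097, 1, 9), (5051, 4459620514920393, 62749348395299, 1, 9),
    (5099, 105897, 1483, 1, 9), (5147, 30043820885151, 418772428043, 1, 9),
    (5171, 1254516889576217, 17445733892961, 1, 9), (5387, 169056149, 2303337, 1, 9),
    (5483, 587976184103179, 7940550506361, 1, 9), (5507, 12513075, 168619, 1, 9),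
    (5531, 874272462839493, 11755604604161, 1, 9),
    (5651, 452125817219279507, 6014460169172451, 1, 9), (5843, 3150149, 41211, 2, 10),
    (5867, 38414764411445265, 501522163126259, 1, 9), (5939, 20337072873, 263895377, 1, 9),
    (5987, 10522362875091, 135990523547, 1, 9), (6011, 97668810221463, 1259744680931, 2, 10),
    (6131, 7043735555627, 89957501499, 1, 9), (6203, 62127738851, 788832249, 1, 9),
    (6299, 774684394447, 9760880667, 1, 9), (6323, 11166506845119, 140428658009, 4, 13),
    (6491, 1537143132254735312717, 19079127245423595801, 1, 9), (6563, 81, 1, 4, 13),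
    (6659, 181640213386888596548467, 2225909463964830022443, 1, 10), (6779, 247, 3, 1, 10),
    (6803, 273611892945, 3317299897, 1, 10), (6827, 23932869411, 289654193, 1, 10),
    (6899, 5663472012956817, 68185132101353, 2, 11), (6947, 89943295, 1079121, 1, 10),
    (6971, 5184008394094713, 62089498882451, 1, 10), (7019, 3960507, 47273, 1, 10),
    (7043, 3365372302779, 40100914051, 1, 10), (7187, 132970381605, 1568487611, 2, 11),
    (7211, 16488219491838407463, 194167264597786331, 1, 10),
    (7283, 20423933861, 239322891, 1, 10), (7307, 18591271179475, 217490119569, 2, 11),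
    (7331, 82967, 969, 1, 10), (7451, 369281139543, 4278089299, 2, 11),
    (7499, 27574520615209244523, 318424366998108937, 1, 10),
    (7523, 413071360161, 4762440401, 1, 10), (7547, 71653068547792781, 824798037308073, 1, 10),
    (7643, 2885, 33, 1, 10), (7691, 18956918367, 216160499, 2, 11), (7883, 11631, 131, 1, 10),
    (7907, 522967051058337399, 5881233984230473, 1, 10), (8123, 481113401, 5338131, 1, 10),
    (8147, 49967314591, 553588617, 1, 10),
    (8171, 1965858375786029076095937, 21747764522736471215651, 2, 11),
    (8219, 287132105112606512655943, 3167176488476972001123, 1, 10),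
    (8243, 213228501638100192535, 2348565112353112017, 1, 10),
    (8291, 1736323034471923, 19068962696571, 1, 10), (8363, 8139, 89, 1, 10),
    (8387, 108895513341279, 1189067927233, 1, 10), (8627, 181894440639, 1958346457, 1, 10),
    (8699, 14212668848180567287, 152384562241465923, 3, 12),
    (8747, 126480827785, 1352368779, 1, 10), (8819, 659199367317, 7019515067, 1, 10),
    (8867, 63005098298585, 669094314009, 1, 10), (8963, 3097139333199, 32714029841, 1, 10),
    (9011, 16760933898427222573773, 176567886454678130611, 1, 10),
    (9059, 522978304743740443, 5494694399615283, 1, 10), (9203, 13250376931, 138122211, 1, 10),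
    (9227, 14256772780178047595, 148419501201876201, 1, 10), (9323, 869, 9, 2, 11),
    (9371, 4937, 51, 1, 10), (9419, 164528843, 1695273, 1, 10), (9467, 6519, 67, 1, 10),
    (9491, 15103677722473811543, 155033918321739969, 1, 10), (9539, 293, 3, 1, 10),
    (9587, 1663119886352459, 16985650858203, 1, 10), (9803, 99, 1, 2, 11),
    (9851, 187027400007014674323276553, 1884365207609598641622531, 1, 10),
    (9923, 1514788853791649261, 15206546878913451, 1, 10)]

theorem cov5_ok : cov good5 416 29 tab5 = true := by decide +kernel

theorem cov11_ok : cov good11 417 11 tab11 = true := by decide +kernel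
end

section
set_option linter.all false

theorem size_contra (p y m M v : ℕ) (hy : y ≤ 4*9^m) (hvM : v ≤ M)
    (hQ : 2^(Nat.log2 (p^4)) ≤ p^4)
    (ht : (p-1)*(600+317*(M+1)) < 25*(Nat.log2 (p^4))*3^(M+1-v)) (hm : M+1 ≤ m)
    (h : p^(3^(m-v)) ≤ (16*y)^(p-1)) : False := by
  set Q := Nat.log2 (p^4) with hQd
  clear_value Q
  have key : ∀ j, (p-1)*(600+317*(M+1+j)) < 25*Q*3^(M+1+j-v) := by
    intro j
    induction j with
    | zero => simpa using ht
    | succ j ih =>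
      have e : M+1+(j+1)-v = (M+1+j-v)+1 := by omega
      rw [e, pow_succ]
      have : (p-1)*(600+317*(M+1+(j+1))) ≤ 3*((p-1)*(600+317*(M+1+j))) := by
        have : (600+317*(M+1+(j+1))) ≤ 3*(600+317*(M+1+j)) := by omega
        calc _ ≤ (p-1)*(3*(600+317*(M+1+j))) := by gcongr
          _ = _ := by ring
      calc _ ≤ _ := this
        _ < 3*(25*Q*3^(M+1+j-v)) := by omega
        _ = _ := by ring
  have hk := key (m-(M+1))
  rw [show M+1+(m-(M+1)) = m by omega] at hk
  set N := 3^(m-v) with hN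
  have h1 : p^N ≤ (2^6*9^m)^(p-1) := h.trans (Nat.pow_le_pow_left (by omega) _)
  have h2 : 2^(25*Q*N) ≤ 2^((p-1)*(600+317*m)) := by
    calc 2^(25*Q*N) = ((2^Q)^N)^25 := by rw [← pow_mul, ← pow_mul]; ring_nf
      _ ≤ ((p^4)^N)^25 := by gcongr
      _ = (p^N)^100 := by rw [← pow_mul, ← pow_mul, ← pow_mul]; ring_nf
      _ ≤ ((2^6*9^m)^(p-1))^100 := by gcongr
      _ = (2^600*(9^100)^m)^(p-1) := by
        rw [← pow_mul, mul_comm (p-1) 100, pow_mul, mul_pow, ← pow_mul, ← pow_mul, ← pow_mul, mul_comm m 100]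
      _ ≤ (2^600*(2^317)^m)^(p-1) := by
        have : 9^100 ≤ 2^317 := by
          calc 9^100 ≤ 2^200*2^117 := by norm_num
            _ = 2^(200+117) := (pow_add 2 200 117).symm
            _ = 2^317 := by rw [show 200+117 = 317 from rfl]
        gcongr
      _ = _ := by
        rw [← pow_mul, ← pow_add, ← pow_mul, mul_comm]
  have h3 := (Nat.pow_le_pow_iff_right (by norm_num : 1 < 2)).1 h2
  omega

theorem geom (y p κ z w b : ℕ) (hp : 11 ≤ p) (hκ : κ = 1 ∨ κ = 3) (hw : 1 ≤ w) (hwz : w < z) (hy : z^2 + w^2 = y)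
   (hb : (b:ℤ) = z + w ∨ (b:ℤ) = z - w)
   (h : |(p:ℝ) * Real.arctan (w/z) - κ * (Real.pi/4)| ≤ Real.pi/2 / (y:ℝ)^((p-1)/2)) :
   10 ≤ y ∧ y ≤ 4*b^2 := by
  have hy5 : 5 ≤ y := by nlinarith
  have hπ := Real.pi_lt_d4
  have hπ0 := Real.pi_pos
  have hδ : Real.pi/2 / (y:ℝ)^((p-1)/2) ≤ 0.001 := by
    have h1 : (5:ℝ)^5 ≤ (y:ℝ)^((p-1)/2) := by
      calc (5:ℝ)^5 ≤ (5:ℝ)^((p-1)/2) := pow_le_pow_right₀ (by norm_num) (by omega)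
        _ ≤ _ := by gcongr; exact_mod_cast hy5
    rw [div_le_iff₀ (by positivity)]
    linarith
  have hw' : (1:ℝ) ≤ w := by exact_mod_cast hw
  have hwz' : (w:ℝ) < z := by exact_mod_cast hwz
  have hz' : (0:ℝ) < z := by linarith
  have hq1 : (w:ℝ)/z ≤ 1 := by rw [div_le_one hz']; linarith
  have h1 := arctan_lb _ (by positivity) hq1
  have hκ' : (κ:ℝ) ≤ 3 := by rcases hκ with h | h <;> subst h <;> norm_num
  have h2 : (p:ℝ) * Real.arctan (w/z) ≤ 2.36 := by
    have := (abs_le.1 h).2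
    have : (κ:ℝ)*(Real.pi/4) ≤ 3*(Real.pi/4) := by gcongr
    linarith
  have hp' : (11:ℝ) ≤ p := by exact_mod_cast hp
  have h3 : 11*((w:ℝ)/z/2) ≤ 2.36 := by
    calc 11*((w:ℝ)/z/2) ≤ p*Real.arctan (w/z) := by gcongr
      _ ≤ _ := h2
  have h4 : (w:ℝ) ≤ 0.43*z := by
    have : (w:ℝ)/z ≤ 0.43 := by linarith
    rwa [div_le_iff₀ hz'] at this
  have h5 : 100*w ≤ 43*z := by
    have : (100:ℝ)*w ≤ 43*z := by linarith
    exact_mod_cast this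
  constructor
  · have : 3 ≤ z := by omega
    nlinarith
  · have h6 : 57*z ≤ 100*b := by omega
    nlinarith

theorem goodC_sound (p y m κ z w g k v M : ℕ) (hp : p = 11 ∨ 29 ≤ p) (hm : 1 ≤ m)
    (hκ : κ = 1 ∨ κ = 3) (hw : 1 ≤ w) (hwz : w < z) (hy : z^2 + w^2 = y)
    (hb : ((3^m : ℕ):ℤ) = z + w ∨ ((3^m : ℕ):ℤ) = z - w)
    (h : |(p:ℝ) * Real.arctan (w/z) - κ * (Real.pi/4)| ≤ Real.pi/2 / (y:ℝ)^((p-1)/2))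
    (hgood : goodC p g k v M = true)
    (hsize : (g:ℤ)^2 - p*k^2 = 1 → ¬ (3:ℤ)^(v+1) ∣ g*k → v ≤ m → (p:ℤ)^(3^(m-v)) ≤ (16*y)^(p-1)) : False := by
  simp only [goodC, Bool.and_eq_true, Nat.beq_eq, Nat.blt_eq, Nat.ble_eq] at hgood
  obtain ⟨⟨⟨⟨⟨hg, hv⟩, hvM⟩, hQ⟩, ht⟩, hres⟩ := hgood
  obtain ⟨hy10, hyb⟩ := geom y p κ z w (3^m) (by omega) hκ hw hwz hy hb h
  rcases Nat.lt_or_ge M m with hmM | hmM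
  · have hs := hsize (by zify at hg; linarith) (by
      intro hd
      have : 3^(v+1) ∣ g*k := by exact_mod_cast hd
      rw [Nat.mod_eq_zero_of_dvd this] at hv
      exact lt_irrefl _ hv) (by omega)
    refine size_contra p y m M v ?_ hvM hQ ht hmM (by exact_mod_cast hs)
    rw [← pow_mul, mul_comm m 2, pow_mul] at hyb
    simpa using hyb
  · obtain ⟨r1, r3⟩ := resAll_sound p _ M hres m hm hmM
    have hδ : Real.pi/2 / (y:ℝ)^((p-1)/2) ≤ 2*((cond (Nat.beq p 11) 1000000000 1 : ℕ):ℝ)/10^14 := by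
      have hπ := Real.pi_lt_d2
      have hy10' : (10:ℝ) ≤ y := by exact_mod_cast hy10
      have h1 : (10:ℝ)^((p-1)/2) ≤ (y:ℝ)^((p-1)/2) := by gcongr
      rw [div_le_iff₀ (by positivity)]
      rcases hp with hp | hp
      · subst hp
        norm_num at h1 ⊢
        linarith
      · have hb : Nat.beq p 11 = false := by
          rw [Bool.eq_false_iff]
          intro hc
          have := Nat.eq_of_beq_eq_true hc
          omega
        rw [hb, cond_false]
        have h2 : (10:ℝ)^14 ≤ (10:ℝ)^((p-1)/2) := pow_le_pow_right₀ (by norm_num) (by omega)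
        norm_num at h2 ⊢
        linarith
    have hb0 : 0 < 3^m := by positivity
    rcases hκ with rfl | rfl
    · exact resAt_sound p 1 _ (3^m) w z _ hb0 r1 (by omega) hb hδ h
    · exact resAt_sound p 3 _ (3^m) w z _ hb0 r3 (by omega) hb hδ h

theorem goodC_pos (p g k v M : ℕ) (hgood : goodC p g k v M = true) : 0 < g := by
  simp only [goodC, Bool.and_eq_true, Nat.beq_eq] at hgood
  have := hgood.1.1.1.1.1
  rcases Nat.eq_zero_or_pos g with h | h
  · subst h; omega
  · exact h

theorem partD (y p m κ z w : ℕ) (a : ℤ) (hpp : p.Prime) (hp : 11 ≤ p) (hp' : p < 10000) (hm : 1 ≤ m)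
    (hao : Odd a) (hy2 : a^2 + (3^m)^2 = 2*(y:ℤ))
    (hu : (p % 24 = 5 ∧ uu (a^2-(3^m)^2) y ((p-1)/2) = -1) ∨ (p % 24 = 11 ∧ uu (a^2-(3^m)^2) y ((p-1)/2) = 1))
    (hκ : κ = 1 ∨ κ = 3) (hw : 1 ≤ w) (hwz : w < z) (hy : z^2 + w^2 = y)
    (hb : ((3^m : ℤ)) = z + w ∨ ((3^m : ℤ)) = z - w)
    (h : |(p:ℝ) * Real.arctan (w/z) - κ * (Real.pi/4)| ≤ Real.pi/2 / (y:ℝ)^((p-1)/2)) : False := by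
  have hbo : Odd ((3:ℤ)^m) := Odd.pow (by decide)
  obtain ⟨s, hs⟩ : ∃ s, (3:ℤ)^m + a = 2*s := by
    obtain ⟨r, hr⟩ := hbo.add_odd hao
    exact ⟨r, by omega⟩
  have hst : s + (3^m - s) = (3:ℤ)^m := by ring
  have ha : a = s - (3^m - s) := by linarith
  have hyst : s^2 + (3^m - s)^2 = (y:ℤ) := by
    have : (2:ℤ)*(s^2 + (3^m - s)^2) = 2*y := by rw [← hy2, ha]; ring
    linarith
  have hu1 : uu (a^2-(3^m)^2) y ((p-1)/2) = uu ((s-(3^m - s))^2-(s+(3^m - s))^2) y ((p-1)/2) := by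
    rw [hst, ← ha]
  rw [hu1] at hu
  rcases hu with ⟨h5, hu⟩ | ⟨h11, hu⟩
  · obtain ⟨i, hi⟩ : ∃ i, p = 29 + 24*i := ⟨(p-29)/24, by omega⟩
    obtain ⟨t, s', v, M, hgood⟩ := cov_sound good5 416 29 tab5 cov5_ok i (by omega) (hi ▸ hpp)
    rw [← hi] at hgood
    have hg0 := goodC_pos _ _ _ _ _ hgood
    refine goodC_sound p y m κ z w _ _ v M (by omega) hm hκ hw hwz hy (by exact_mod_cast hb) h hgood ?_
    intro hg hd hvm
    exact size5 p hpp h5 (by omega) s (3^m - s) y m hm hst hyst hu _ _ v hvm (by exact_mod_cast hg0) (by positivity) hg hd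
  · obtain ⟨i, hi⟩ : ∃ i, p = 11 + 24*i := ⟨(p-11)/24, by omega⟩
    obtain ⟨t, s', v, M, hgood⟩ := cov_sound good11 417 11 tab11 cov11_ok i (by omega) (hi ▸ hpp)
    rw [← hi] at hgood
    have hg0 := goodC_pos _ _ _ _ _ hgood
    refine goodC_sound p y m κ z w _ _ v M (by omega) hm hκ hw hwz hy (by exact_mod_cast hb) h hgood ?_
    intro hg hd hvm
    exact size11 p hpp h11 s (3^m - s) y m hst hyst hu _ _ v (by exact_mod_cast hg0) (by positivity) hg hd
end

theorem eq_fixed_q_three (x y m p : ℕ) (hx : 0 < x) (hy : 0 < y) (hm : 1 ≤ m)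
    (hcop : Nat.gcd x y = 1) (hp : Nat.Prime p) (hop : Odd p)
    (heq : x ^ 2 + 3 ^ (2 * m) = 2 * y ^ p) :
    (x, y, m, p) = (13, 5, 2, 3) ∨ (x, y, m, p) = (79, 5, 1, 5) ∨
      (x, y, m, p) = (545, 53, 3, 3) := by
  rcases partA x y m p hx hy hm hcop hp hop heq with h | ⟨hp11, a, ha, hao, ha3, hy2, hyo, hu⟩
  · exact h
  · exfalso
    have hbo : Odd ((3:ℤ)^m) := Odd.pow (by decide)
    have hne : a ≠ 3^m := by
      intro hc
      have h3 : (3:ℤ) ∣ a := by rw [hc]; exact dvd_pow_self _ (by omega)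
      have := ha3.isUnit_of_dvd' h3 dvd_rfl
      rw [Int.isUnit_iff] at this
      omega
    obtain ⟨κ, z, w, hκ, hw, hwz, hzw, hb, h⟩ := partB' y p a (3^m) ha (by positivity) hao hbo (ha3.pow_right) hne hy2 hp11
      (by
        rcases hu with ⟨h1, h2⟩ | ⟨h1, h2⟩
        · exact Or.inl ⟨by omega, h2⟩
        · exact Or.inr ⟨by omega, h2⟩)
    rcases Nat.lt_or_ge p 10000 with hlt | hge
    · exact partD y p m κ z w a hp hp11 hlt hm hao hy2 hu hκ hw hwz hzw hb h
    · exact partC y p κ z w hge hκ hw hwz hzw h
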